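/- Let Γ be a non-elementary hyperbolic group and μ a non-elementary probability measure on Γ with finite first moment relative to a word metric. For ρ ∈ [0,1] define π^ρ := ρ μ×μ + (1−ρ) μ_diag on Γ × Γ, where μ_diag((x,x*)) = μ(x) if x = x* and 0 otherwise. Then: (i) for every ρ ∈ (0,1] and ν_μ-almost every η ∈ ∂Γ, the conditional measure ν_{π^ρ}^η is exact dimensional with dim ν_{π^ρ}^η = (h(π^ρ) − h(μ))/l(Γ,μ) > 0; (ii) for ρ = 0, h(π^0) = h(μ) and dim ν_{π^0}^η = 0 for ν_μ-almost every η ∈ ∂Γ; (iii) for every ρ ∈ [0,1], dim ν_{π^ρ} = h(π^ρ)/l(Γ,μ). -/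

import Mathlib

open MeasureTheory Filter Topology Metric Set
open scoped ENNReal Classical

noncomputable section

namespace HMDim

/-! ### Gromov products and hyperbolicity -/

/-- The Gromov product `(x|y)_o = (d(x,o)+d(o,y)-d(x,y))/2`. -/
def gp {X : Type*} [MetricSpace X] (o x y : X) : ℝ :=
  (dist x o + dist o y - dist x y) / 2

/-- `X` is `δ`-hyperbolic. -/
def IsHyperbolicWith (X : Type*) [MetricSpace X] (δ : ℝ) : Prop :=
  ∀ x y z w : X, min (gp w x z) (gp w z y) - δ ≤ gp w x y

/-- `X` is hyperbolic: `δ`-hyperbolic for some `δ ≥ 0`. -/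
def IsHyperbolic (X : Type*) [MetricSpace X] : Prop :=
  ∃ δ : ℝ, 0 ≤ δ ∧ IsHyperbolicWith X δ

/-- `X` is `C`-roughly geodesic for some `C ≥ 0`: any two points are joined by a
`C`-rough geodesic. -/
def IsRoughGeodesicSpace (X : Type*) [MetricSpace X] : Prop :=
  ∃ C : ℝ, 0 ≤ C ∧ ∀ x y : X, ∃ (b : ℝ) (γ : ℝ → X), 0 ≤ b ∧ γ 0 = x ∧ γ b = y ∧
    ∀ s ∈ Set.Icc (0:ℝ) b, ∀ t ∈ Set.Icc (0:ℝ) b, abs (dist (γ s) (γ t) - |s - t|) ≤ C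

/-- Bounded growth at some scale: there are `0 < r < R` and `N` such that every ball of
radius `R` is covered by at most `N` balls of radius `r`. -/
def HasBoundedGrowthAtSomeScale (X : Type*) [MetricSpace X] : Prop :=
  ∃ (r R : ℝ) (N : ℕ), 0 < r ∧ r < R ∧
    ∀ x : X, ∃ s : Finset X, s.card ≤ N ∧ Metric.ball x R ⊆ ⋃ y ∈ s, Metric.ball y r

/-! ### The Gromov boundary -/

/-- A sequence is divergent if it is Cauchy for the Gromov-product quasi-metric, i.e.
`(u n | u m)_o → ∞`. -/
def IsDivergent {X : Type*} [MetricSpace X] (o : X) (u : ℕ → X) : Prop :=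
  Tendsto (fun pr : ℕ × ℕ => gp o (u pr.1) (u pr.2)) atTop atTop

/-- The type of divergent sequences. -/
def DivSeq (X : Type*) [MetricSpace X] (o : X) : Type _ := {u : ℕ → X // IsDivergent o u}

/-- Two divergent sequences are equivalent when `(u n | v m)_o → ∞`. -/
def bndRel {X : Type*} [MetricSpace X] (o : X) (u v : DivSeq X o) : Prop :=
  Tendsto (fun pr : ℕ × ℕ => gp o (u.1 pr.1) (v.1 pr.2)) atTop atTop

/-- The Gromov boundary: equivalence classes of divergent sequences. -/
def Boundary (X : Type*) [MetricSpace X] (o : X) : Type _ := Quot (bndRel o)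

/-- The boundary point of a divergent sequence. -/
def mkB {X : Type*} [MetricSpace X] (o : X) (u : DivSeq X o) : Boundary X o :=
  Quot.mk _ u

/-- The extended Gromov product of two boundary points: the infimum over pairs of
representatives of the liminf of Gromov products. -/
def gpB {X : Type*} [MetricSpace X] (o : X) (ξ η : Boundary X o) : ℝ :=
  sInf {t : ℝ | ∃ u v : DivSeq X o, mkB o u = ξ ∧ mkB o v = η ∧
    t = Filter.liminf (fun pr : ℕ × ℕ => gp o (u.1 pr.1) (v.1 pr.2)) atTop}

/-- The quasi-metric `q(ξ,η) = exp(-(ξ|η)_o)` on the boundary (`0` on the diagonal). -/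
def qB {X : Type*} [MetricSpace X] (o : X) (ξ η : Boundary X o) : ℝ :=
  if ξ = η then 0 else Real.exp (-(gpB o ξ η))

/-- The extended Gromov product of an interior point with a boundary point. -/
def gpXB {X : Type*} [MetricSpace X] (o : X) (x : X) (ξ : Boundary X o) : ℝ :=
  sInf {t : ℝ | ∃ u : DivSeq X o, mkB o u = ξ ∧
    t = Filter.liminf (fun m : ℕ => gp o x (u.1 m)) atTop}

/-- Quasi-metric between an interior point and a boundary point. -/
def qXB {X : Type*} [MetricSpace X] (o : X) (x : X) (ξ : Boundary X o) : ℝ :=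
  Real.exp (-(gpXB o x ξ))

/-- The open ball of a quasi-metric. -/
def qball {A : Type*} (q : A → A → ℝ) (ξ : A) (r : ℝ) : Set A := {η | q ξ η < r}

/-- The max quasi-metric `q̄` on the product of two boundaries. -/
def qbb {X Xs : Type*} [MetricSpace X] [MetricSpace Xs] (o : X) (os : Xs)
    (ξ η : Boundary X o × Boundary Xs os) : ℝ :=
  max (qB o ξ.1 η.1) (qB os ξ.2 η.2)

/-- Boundaries are measurable spaces, with the σ-algebra generated by quasi-metric balls. -/
instance (X : Type*) [MetricSpace X] (o : X) : MeasurableSpace (Boundary X o) :=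
  MeasurableSpace.generateFrom {s | ∃ ξ r, s = qball (qB o) ξ r}

/-! ### The boundary action of isometries -/

lemma gp_isometry_le {X : Type*} [MetricSpace X] (o : X) (g : X ≃ᵢ X) (x y : X) :
    gp o x y - dist o (g o) ≤ gp o (g x) (g y) := by
  have e1 : dist (g x) (g o) = dist x o := g.dist_eq x o
  have e2 : dist (g o) (g y) = dist o y := g.dist_eq o y
  have e3 : dist (g x) (g y) = dist x y := g.dist_eq x y
  have e4 : dist (g o) o = dist o (g o) := dist_comm _ _
  have t1 : dist (g x) (g o) ≤ dist (g x) o + dist o (g o) := dist_triangle _ _ _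
  have t2 : dist (g o) (g y) ≤ dist (g o) o + dist o (g y) := dist_triangle _ _ _
  simp only [gp]
  linarith [t1, t2, e1, e2, e3, e4]

lemma isDivergent_comp {X : Type*} [MetricSpace X] (o : X) (g : X ≃ᵢ X) {u : ℕ → X}
    (h : IsDivergent o u) : IsDivergent o fun n => g (u n) := by
  have h' := tendsto_atTop_add_const_right atTop (-(dist o (g o)))
    (h : Tendsto (fun pr : ℕ × ℕ => gp o (u pr.1) (u pr.2)) atTop atTop)
  refine tendsto_atTop_mono (fun pr => ?_) h'
  have := gp_isometry_le o g (u pr.1) (u pr.2)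
  simpa [sub_eq_add_neg] using this

lemma bndRel_comp {X : Type*} [MetricSpace X] (o : X) (g : X ≃ᵢ X) {u v : DivSeq X o}
    (h : bndRel o u v) :
    bndRel o ⟨fun n => g (u.1 n), isDivergent_comp o g u.2⟩
      ⟨fun n => g (v.1 n), isDivergent_comp o g v.2⟩ := by
  have h' := tendsto_atTop_add_const_right atTop (-(dist o (g o)))
    (h : Tendsto (fun pr : ℕ × ℕ => gp o (u.1 pr.1) (v.1 pr.2)) atTop atTop)
  refine tendsto_atTop_mono (fun pr => ?_) h'
  have := gp_isometry_le o g (u.1 pr.1) (v.1 pr.2)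
  simpa [sub_eq_add_neg] using this

/-- The induced action of an isometry on the Gromov boundary. -/
def bAct {X : Type*} [MetricSpace X] (o : X) (g : X ≃ᵢ X) :
    Boundary X o → Boundary X o :=
  Quot.map (fun u : DivSeq X o =>
      (⟨fun n => g (u.1 n), isDivergent_comp o g u.2⟩ : DivSeq X o))
    (fun _ _ h => bndRel_comp o g h)

/-! ### Random walks on countable groups -/

/-- Convolution of two measures (as `ℝ≥0∞`-valued functions) on a group. -/
def conv {G : Type*} [Group G] (p q : G → ℝ≥0∞) : G → ℝ≥0∞ :=
  fun x => ∑' y : G, p y * q (y⁻¹ * x)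

/-- The `n`-fold convolution power `π_n` of `p`. -/
def piN {G : Type*} [Group G] (p : G → ℝ≥0∞) : ℕ → G → ℝ≥0∞
  | 0 => fun x => if x = 1 then 1 else 0
  | n + 1 => conv (piN p n) p

/-- The Shannon entropy `H(π_n)` of the `n`-th convolution power. -/
def entropySeq {G : Type*} [Group G] (p : G → ℝ≥0∞) (n : ℕ) : ℝ :=
  ∑' x : G, Real.negMulLog ((piN p n x).toReal)

/-- The first moment of `π_n` with respect to a displacement function `f`. -/
def momentSeq {G : Type*} [Group G] (p : G → ℝ≥0∞) (f : G → ℝ) (n : ℕ) : ℝ :=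
  ∑' x : G, (piN p n x).toReal * f x

/-- `h` is the asymptotic entropy of the `p`-random walk:
`h = lim (1/n) H(π_n)`. -/
def HasEntropy {G : Type*} [Group G] (p : G → ℝ≥0∞) (h : ℝ) : Prop :=
  Tendsto (fun n : ℕ => entropySeq p n / n) atTop (nhds h)

/-- `l` is the drift (rate of escape) of the `p`-random walk with respect to the
displacement `f`: `l = lim (1/n) Σ_x f(x) π_n(x)`. -/
def HasDrift {G : Type*} [Group G] (p : G → ℝ≥0∞) (f : G → ℝ) (l : ℝ) : Prop :=
  Tendsto (fun n : ℕ => momentSeq p f n / n) atTop (nhds l)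

/-- `p` is a probability distribution. -/
def IsProb {G : Type*} (p : G → ℝ≥0∞) : Prop := ∑' x : G, p x = 1

/-- Finite first moment with respect to a displacement function `f`. -/
def FiniteFirstMoment {G : Type*} (p : G → ℝ≥0∞) (f : G → ℝ) : Prop :=
  ∑' x : G, p x * ENNReal.ofReal (f x) ≠ ∞

/-- The pushforward of a distribution `p` by a map `f` (e.g. a marginal). -/
def marginalStar {G A : Type*} (p : G → ℝ≥0∞) (f : G → A) : A → ℝ≥0∞ :=
  fun a => ∑' x : G, if f x = a then p x else 0

/-- A subgroup is non-elementary (in the relevant sense) if it contains a free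
subgroup of rank 2. -/
def IsNonElementarySubgroup {G : Type*} [Group G] (H : Subgroup G) : Prop :=
  ∃ φ : FreeGroup (Fin 2) →* G, Function.Injective φ ∧ φ.range ≤ H

/-- A measure `p` on a group is non-elementary if the subgroup generated by its
support contains a free subgroup of rank 2. -/
def IsNonElemMeasure {G : Type*} [Group G] (p : G → ℝ≥0∞) : Prop :=
  IsNonElementarySubgroup (Subgroup.closure {x : G | p x ≠ 0})

/-- A group containing a free subgroup of rank 2 (a non-elementary group). -/
def HasFreeSubgroup (G : Type*) [Group G] : Prop :=
  ∃ φ : FreeGroup (Fin 2) →* G, Function.Injective φ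

/-! ### Path space -/

/-- The position `w_n = x_1 ⋯ x_n` of the random walk with increments `ω`. -/
def walk {G : Type*} [Group G] (ω : ℕ → G) (n : ℕ) : G := ((List.range n).map ω).prod

/-- The cylinder set `[w̄_0, …, w̄_n]` of trajectories whose positions agree with those
of `ω` up to time `n`. -/
def cyl {G : Type*} [Group G] (ω : ℕ → G) (n : ℕ) : Set (ℕ → G) :=
  {ω' | ∀ i ≤ n, walk ω' i = walk ω i}

/-- `P` is the distribution of the increments of the `p`-random walk: the product
measure `p^{⊗ℕ}` on the path space. -/
def IsRWMeasure {G : Type*} [Group G] [MeasurableSpace G] (p : G → ℝ≥0∞)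
    (P : Measure (ℕ → G)) : Prop :=
  IsProbabilityMeasure P ∧
    ∀ (n : ℕ) (g : ℕ → G), P {ω | ∀ i < n, ω i = g i} = ∏ i ∈ Finset.range n, p (g i)

/-- `ν` is the harmonic measure on the boundary of `X` for the random walk with path
measure `P` and orbit map `z`: the image of `P` under the a.s.-defined boundary map. -/
def IsHarmonic {Ω X : Type*} [MeasurableSpace Ω] [MetricSpace X] (o : X)
    (P : Measure Ω) (z : Ω → ℕ → X) (ν : Measure (Boundary X o)) : Prop :=
  ∃ bnd : Ω → Boundary X o, Measurable bnd ∧ ν = P.map bnd ∧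
    ∀ᵐ ω ∂P, ∃ h : IsDivergent o (z ω), bnd ω = mkB o ⟨z ω, h⟩

/-- `ν` is the harmonic measure on the product of the boundaries of `X` and `Xs` for
the random walk with path measure `P` and orbit maps `z`, `zs`. -/
def IsJointHarmonic {Ω X Xs : Type*} [MeasurableSpace Ω] [MetricSpace X] [MetricSpace Xs]
    (o : X) (os : Xs) (P : Measure Ω) (z : Ω → ℕ → X) (zs : Ω → ℕ → Xs)
    (ν : Measure (Boundary X o × Boundary Xs os)) : Prop :=
  ∃ bnd : Ω → Boundary X o × Boundary Xs os, Measurable bnd ∧ ν = P.map bnd ∧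
    ∀ᵐ ω ∂P, ∃ (h1 : IsDivergent o (z ω)) (h2 : IsDivergent os (zs ω)),
      bnd ω = (mkB o ⟨z ω, h1⟩, mkB os ⟨zs ω, h2⟩)

/-- `cond` is a disintegration (system of conditional measures) of `P` with respect to
the map `f`, over the pushforward `νB = f_* P`. -/
def IsDisintegration {A B : Type*} [MeasurableSpace A] [MeasurableSpace B]
    (P : Measure A) (f : A → B) (νB : Measure B) (cond : B → Measure A) : Prop :=
  νB = P.map f ∧ (∀ᵐ b ∂νB, IsProbabilityMeasure (cond b)) ∧
    (∀ᵐ b ∂νB, cond b (f ⁻¹' {b}) = 1) ∧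
    ∀ s : Set A, MeasurableSet s → P s = ∫⁻ b, cond b s ∂νB

/-! ### Hausdorff dimension for quasi-metrics -/

/-- Diameter of a set for a quasi-metric. -/
def qdiam {A : Type*} (q : A → A → ℝ) (E : Set A) : ℝ≥0∞ :=
  ⨆ x ∈ E, ⨆ y ∈ E, ENNReal.ofReal (q x y)

/-- Hausdorff pre-measure (content) at scale `Δ`. -/
def qHContent {A : Type*} (q : A → A → ℝ) (α Δ : ℝ) (E : Set A) : ℝ≥0∞ :=
  ⨅ (c : ℕ → Set A) (_ : E ⊆ ⋃ i, c i) (_ : ∀ i, qdiam q (c i) ≤ ENNReal.ofReal Δ),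
    ∑' i, qdiam q (c i) ^ α

/-- The `α`-dimensional Hausdorff measure of a set for a quasi-metric. -/
def qHMeasure {A : Type*} (q : A → A → ℝ) (α : ℝ) (E : Set A) : ℝ≥0∞ :=
  ⨆ (Δ : ℝ) (_ : 0 < Δ), qHContent q α Δ E

/-- The Hausdorff dimension of a set for a quasi-metric. -/
def qdimSet {A : Type*} (q : A → A → ℝ) (E : Set A) : ℝ :=
  sSup {α : ℝ | 0 ≤ α ∧ 0 < qHMeasure q α E}

/-- The upper Hausdorff dimension of a measure. -/
def qdimUpper {A : Type*} [MeasurableSpace A] (q : A → A → ℝ) (ν : Measure A) : ℝ :=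
  sInf {d : ℝ | ∃ E : Set A, MeasurableSet E ∧ ν Eᶜ = 0 ∧ d = qdimSet q E}

/-- The lower Hausdorff dimension of a measure. -/
def qdimLower {A : Type*} [MeasurableSpace A] (q : A → A → ℝ) (ν : Measure A) : ℝ :=
  sInf {d : ℝ | ∃ E : Set A, MeasurableSet E ∧ 0 < ν E ∧ d = qdimSet q E}

/-- The Hausdorff dimension of `ν` exists and equals `D`. -/
def HasDim {A : Type*} [MeasurableSpace A] (q : A → A → ℝ) (ν : Measure A) (D : ℝ) : Prop :=
  qdimUpper q ν = D ∧ qdimLower q ν = D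

/-- `ν` is exact dimensional with dimension `D` for the quasi-metric `q`:
`lim_{r→0} log ν(B(ξ,r))/log r = D` for `ν`-a.e. `ξ`. -/
def ExactDim {A : Type*} [MeasurableSpace A] (q : A → A → ℝ) (ν : Measure A) (D : ℝ) : Prop :=
  ∀ᵐ ξ ∂ν, Tendsto (fun r : ℝ => Real.log (ν (qball q ξ r)).toReal / Real.log r)
    (nhdsWithin 0 (Set.Ioi 0)) (nhds D)

/-! ### Differential entropy -/

/-- The differential entropy
`h(∂X*, μ*) = Σ_g μ*(g) ∫ log (d gν/dν) d(gν)` of a measure on the isometry group with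
respect to a boundary measure. -/
def diffEntropy {Xs : Type*} [MetricSpace Xs] (os : Xs) (pstar : (Xs ≃ᵢ Xs) → ℝ≥0∞)
    (νs : Measure (Boundary Xs os)) : ℝ :=
  ∑' g : (Xs ≃ᵢ Xs), (pstar g).toReal *
    ∫ η, Real.log ((Measure.rnDeriv (νs.map (bAct os g)) νs η).toReal)
      ∂(νs.map (bAct os g))

/-! ### Word metrics and hyperbolic groups -/

/-- The word length of `g` with respect to a (symmetrized) generating set `S`. -/
def wordLength {G : Type*} [Group G] (S : Set G) (g : G) : ℕ :=
  sInf {n : ℕ | ∃ f : Fin n → G, (∀ i, f i ∈ S ∨ (f i)⁻¹ ∈ S) ∧ g = (List.ofFn f).prod}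

/-- The metric of `G` is quasi-isometric to a word metric of a finite generating set. -/
def IsQIToWordMetric (G : Type*) [Group G] [MetricSpace G] : Prop :=
  ∃ S : Finset G, Subgroup.closure (S : Set G) = ⊤ ∧
    ∃ Λ c : ℝ, 1 ≤ Λ ∧ 0 ≤ c ∧ ∀ g : G,
      (wordLength (S : Set G) g : ℝ) / Λ - c ≤ dist (1 : G) g ∧
      dist (1 : G) g ≤ Λ * (wordLength (S : Set G) g) + c

/-- The metric of `G` is left invariant. -/
def LeftInvariantMetric (G : Type*) [Group G] [MetricSpace G] : Prop :=
  ∀ g x y : G, dist (g * x) (g * y) = dist x y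

/-- `G`, with its metric, is a hyperbolic group: the metric is left invariant,
hyperbolic and quasi-isometric to a word metric. -/
def IsHypGroupMetric (G : Type*) [Group G] [MetricSpace G] : Prop :=
  LeftInvariantMetric G ∧ IsHyperbolic G ∧ IsQIToWordMetric G

/-! ### Groups of isometries of a product -/

/-- First component of an element of a subgroup of `Isom X × Isom X*`. -/
def proj1 {X Xs : Type*} [MetricSpace X] [MetricSpace Xs]
    {Γb : Subgroup ((X ≃ᵢ X) × (Xs ≃ᵢ Xs))} (γ : Γb) : X ≃ᵢ X :=
  (γ : (X ≃ᵢ X) × (Xs ≃ᵢ Xs)).1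

/-- Second component of an element of a subgroup of `Isom X × Isom X*`. -/
def proj2 {X Xs : Type*} [MetricSpace X] [MetricSpace Xs]
    {Γb : Subgroup ((X ≃ᵢ X) × (Xs ≃ᵢ Xs))} (γ : Γb) : Xs ≃ᵢ Xs :=
  (γ : (X ≃ᵢ X) × (Xs ≃ᵢ Xs)).2

/-- Displacement `d̄(ō, γ·ō)` of the base point `ō = (o,o*)` (the metric of the product
is the max metric). -/
def disp {X Xs : Type*} [MetricSpace X] [MetricSpace Xs]
    {Γb : Subgroup ((X ≃ᵢ X) × (Xs ≃ᵢ Xs))} (o : X) (os : Xs) (γ : Γb) : ℝ :=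
  dist (o, os) (proj1 γ o, proj2 γ os)

/-- Finite exponential growth relative to a displacement function `f`:
`#{x : f(x) < r} ≤ c e^{c r}`. -/
def FinExpGrowth {G : Type*} (f : G → ℝ) : Prop :=
  ∃ c : ℝ, 0 < c ∧ ∀ r : ℝ, 0 < r →
    {x : G | f x < r}.Finite ∧ ({x : G | f x < r}.ncard : ℝ) ≤ c * Real.exp (c * r)

/-! ### The events of Lemmas `A` and `E_n(η)` -/

/-- The event `A_{ε,n} = ∩_{t ≥ n} {z̄_∞ exists and q̄(z̄_t, z̄_∞) ≤ e^{-(l*-ε)n}}`. -/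
def Aev {X Xs : Type*} [MetricSpace X] [MetricSpace Xs]
    (Γb : Subgroup ((X ≃ᵢ X) × (Xs ≃ᵢ Xs))) (o : X) (os : Xs) (ε lst : ℝ) (n : ℕ) :
    Set (ℕ → Γb) :=
  {ω | ∃ (h1 : IsDivergent o (fun t => proj1 (walk ω t) o))
        (h2 : IsDivergent os (fun t => proj2 (walk ω t) os)),
      ∀ t, n ≤ t →
        max (qXB o (proj1 (walk ω t) o) (mkB o ⟨_, h1⟩))
            (qXB os (proj2 (walk ω t) os) (mkB os ⟨_, h2⟩))
          ≤ Real.exp (-((lst - ε) * n))}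

/-- The event
`E_{ε,n}(η) = {P^η([w̄_0,…,w̄_n] ∩ A_{ε,n}) ≤ e^{n(h*+ε)} P([w̄_0,…,w̄_n] ∩ A_{ε,n})}`. -/
def Eev {X Xs : Type*} [MetricSpace X] [MetricSpace Xs]
    (Γb : Subgroup ((X ≃ᵢ X) × (Xs ≃ᵢ Xs))) [MeasurableSpace Γb] (o : X) (os : Xs)
    (P : Measure (ℕ → Γb)) (condP : Boundary Xs os → Measure (ℕ → Γb))
    (hst ε lst : ℝ) (η : Boundary Xs os) (n : ℕ) : Set (ℕ → Γb) :=
  {ω | condP η (cyl ω n ∩ Aev Γb o os ε lst n) ≤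
        ENNReal.ofReal (Real.exp (n * (hst + ε))) * P (cyl ω n ∩ Aev Γb o os ε lst n)}

/-! ### Special measures -/

/-- The measure `π^ρ = ρ μ×μ + (1-ρ) μ_diag` on `Γ × Γ`. -/
def pRho {Γ : Type*} (p : Γ → ℝ≥0∞) (ρ : ℝ) : Γ × Γ → ℝ≥0∞ :=
  fun g => ENNReal.ofReal ρ * (p g.1 * p g.2) +
    ENNReal.ofReal (1 - ρ) * (if g.1 = g.2 then p g.1 else 0)

/-- The uniform distribution on the symmetrized free basis of `F_{m+1}`. -/
def symFreeBasisUniform (m : ℕ) : FreeGroup (Fin (m + 1)) → ℝ≥0∞ :=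
  fun g => if ∃ i : Fin (m + 1), g = FreeGroup.of i ∨ g = (FreeGroup.of i)⁻¹
    then ENNReal.ofReal (1 / (2 * (m + 1))) else 0

/-- The homomorphism `F_{m+1} → F_m` sending `x_i ↦ y_i` for `i ≤ m` and `x_{m+1} ↦ 1`. -/
def projHom (m : ℕ) : FreeGroup (Fin (m + 1)) →* FreeGroup (Fin m) :=
  FreeGroup.lift (fun i => if h : (i : ℕ) < m then FreeGroup.of (⟨i, h⟩ : Fin m) else 1)

section ModA
/-! ### Elementary facts on Gromov products -/

section GP
variable {X : Type*} [MetricSpace X]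

lemma gp_comm (o x y : X) : gp o x y = gp o y x := by
  simp only [gp]; rw [dist_comm x y, dist_comm x o, dist_comm o y]; ring

lemma gp_nonneg (o x y : X) : 0 ≤ gp o x y := by
  simp only [gp]; have := dist_triangle x o y; linarith

lemma gp_le_left (o x y : X) : gp o x y ≤ dist o x := by
  simp only [gp]
  have := dist_triangle o x y
  have := dist_comm o x
  linarith

lemma gp_le_right (o x y : X) : gp o x y ≤ dist o y := by
  rw [gp_comm]; exact gp_le_left o y x

lemma gp_self (o x : X) : gp o x x = dist o x := by
  simp only [gp]; rw [dist_comm x o, dist_self]; ring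

lemma gp_ge_sub (o x y : X) : dist o x - dist x y ≤ gp o x y := by
  simp only [gp]
  have := dist_triangle o y x
  have := dist_comm o x
  have := dist_comm y x
  linarith

lemma dist_eq_gp (o x y : X) : dist x y = dist o x + dist o y - 2 * gp o x y := by
  simp only [gp]; rw [dist_comm x o]; ring

lemma gp_hyp {δ : ℝ} (h : IsHyperbolicWith X δ) (o x y z : X) {t : ℝ}
    (h1 : t ≤ gp o x z) (h2 : t ≤ gp o z y) : t - δ ≤ gp o x y := by
  have := h x y z o
  have h3 : t ≤ min (gp o x z) (gp o z y) := le_min h1 h2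
  linarith

/-- Tracking lemma: a sequence making linear progress with short steps has large Gromov
products along all later times. -/
lemma tracking {δ : ℝ} (hδ : 0 ≤ δ) (h : IsHyperbolicWith X δ) (o : X) {a : ℝ} (ha : 0 < a) :
    ∃ C : ℝ, 0 ≤ C ∧ ∀ (x : ℕ → X) (N M : ℕ),
      (∀ n, N ≤ n → n ≤ M → a * n ≤ dist o (x n)) →
      (∀ n, N ≤ n → n < M → a * n ≤ gp o (x n) (x (n + 1))) →
      ∀ n m, N ≤ n → n ≤ m → m ≤ M → a * n - C ≤ gp o (x n) (x m) := by
  obtain ⟨K, hK⟩ := exists_nat_gt (δ / a)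
  have hKδ : δ ≤ a * K := by
    rw [div_lt_iff₀ ha] at hK; linarith
  refine ⟨δ * (K + 1), by positivity, ?_⟩
  intro x N M h1 h2
  -- naive chain
  have naive : ∀ j n, N ≤ n → n + j ≤ M → a * n - δ * j ≤ gp o (x n) (x (n + j)) := by
    intro j
    induction j with
    | zero => intro n hn hm; simp only [add_zero, gp_self]; simpa using h1 n hn (by omega)
    | succ j ih =>
      intro n hn hm
      have e1 := ih n hn (by omega)
      have e2 := h2 (n + j) (by omega) (by omega)
      have e3 : a * n - δ * j ≤ gp o (x (n + j)) (x (n + j + 1)) := by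
        push_cast at e2
        have : 0 ≤ δ * j := by positivity
        have : 0 ≤ a * j := by positivity
        linarith
      have e4 := gp_hyp h o _ _ _ e1 e3
      push_cast
      rw [← add_assoc]
      linarith
  have main : ∀ k n, N ≤ n → n + k ≤ M → a * n - δ * (K + 1) ≤ gp o (x n) (x (n + k)) := by
    intro k
    induction k using Nat.strong_induction_on with
    | _ k ih =>
      intro n hn hm
      by_cases hk : k ≤ K
      · have := naive k n hn hm
        have h3 : (k : ℝ) ≤ K := by exact_mod_cast hk
        have h4 : δ * k ≤ δ * K := mul_le_mul_of_nonneg_left h3 hδ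
        linarith
      · push Not at hk
        by_cases hK0 : K = 0
        · -- δ = 0
          have hδ0 : δ = 0 := by
            subst hK0; simp at hKδ; linarith
          subst hδ0
          have := naive k n hn hm
          linarith
        have e1 := naive K n hn (by omega)
        have e2 := ih (k - K) (by omega) (n + K) (by omega) (by omega)
        have e3 : n + K + (k - K) = n + k := by omega
        rw [e3] at e2
        push_cast at e2
        have e4 : a * n - δ * K ≤ gp o (x (n + K)) (x (n + k)) := by linarith
        have := gp_hyp h o _ _ _ e1 e4
        linarith
  intro n m hn hnm hm
  obtain ⟨k, rfl⟩ := Nat.exists_eq_add_of_le hnm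
  exact main k n hn hm

end GP

/-! ### Growth of the group -/

section Growth
variable {G : Type*} [Group G]

lemma wordLength_set_nonempty (S : Set G) (hS : Subgroup.closure S = ⊤) (g : G) :
    {n : ℕ | ∃ f : Fin n → G, (∀ i, f i ∈ S ∨ (f i)⁻¹ ∈ S) ∧ g = (List.ofFn f).prod}.Nonempty := by
  have hg : g ∈ Subgroup.closure S := by rw [hS]; trivial
  have hg' : g ∈ Submonoid.closure (S ∪ S⁻¹) := by
    rw [← Subgroup.closure_toSubmonoid]; exact hg
  obtain ⟨L, hL', rfl⟩ := Submonoid.exists_list_of_mem_closure hg'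
  have hL : ∀ x ∈ L, x ∈ S ∨ x⁻¹ ∈ S := fun x hx => hL' x hx
  refine ⟨L.length, fun i => L.get i, fun i => hL _ (List.get_mem L i), ?_⟩
  rw [List.ofFn_get]

lemma wordLength_spec (S : Set G) (hS : Subgroup.closure S = ⊤) (g : G) :
    ∃ f : Fin (wordLength S g) → G, (∀ i, f i ∈ S ∨ (f i)⁻¹ ∈ S) ∧ g = (List.ofFn f).prod :=
  Nat.sInf_mem (wordLength_set_nonempty S hS g)

lemma wordLength_le_of {S : Set G} {n : ℕ} (L : List G) (hL : ∀ x ∈ L, x ∈ S ∨ x⁻¹ ∈ S)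
    (hn : L.length = n) : wordLength S L.prod ≤ n := by
  subst hn
  refine Nat.sInf_le ⟨fun i => L.get i, fun i => hL _ (List.get_mem L i), ?_⟩
  rw [List.ofFn_get]

/-- elements of word length at most `n` -/
lemma wordBall (S : Finset G) (hS : Subgroup.closure (S : Set G) = ⊤) (n : ℕ) :
    {g : G | wordLength (S : Set G) g ≤ n}.Finite ∧
      {g : G | wordLength (S : Set G) g ≤ n}.ncard ≤ (2 * S.card + 1) ^ n := by
  let T : Finset G := insert 1 (S ∪ S.image (fun x => x⁻¹))
  have hT : T.card ≤ 2 * S.card + 1 := by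
    refine (Finset.card_insert_le _ _).trans ?_
    have := Finset.card_union_le S (S.image (fun x => x⁻¹))
    have := Finset.card_image_le (s := S) (f := fun x => x⁻¹)
    omega
  let F : Finset (Fin n → G) := Fintype.piFinset (fun _ => T)
  let I : Finset G := F.image (fun f => (List.ofFn f).prod)
  have hsub : {g : G | wordLength (S : Set G) g ≤ n} ⊆ (I : Set G) := by
    intro g hg
    obtain ⟨f, hf, hfg⟩ := wordLength_spec (S : Set G) hS g
    simp only [mem_ofPred_eq] at hg
    obtain ⟨k, hk⟩ := Nat.exists_eq_add_of_le hg
    simp only [I, F, Finset.coe_image, Set.mem_image]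
    have : ∃ L : List G, L.length = n ∧ L.prod = g ∧ ∀ x ∈ L, x ∈ T := by
      refine ⟨List.ofFn f ++ List.replicate k 1, by simp [hk], by simp [← hfg], ?_⟩
      intro x hx
      rw [List.mem_append] at hx
      rcases hx with hx | hx
      · rw [List.mem_ofFn] at hx
        obtain ⟨i, rfl⟩ := hx
        rcases hf i with h | h
        · simp [T]; right; left; exact_mod_cast h
        · simp [T]; right; right; exact ⟨_, h, inv_inv _⟩
      · rw [List.mem_replicate] at hx
        simp [T, hx.2]
    obtain ⟨L, hL, hLp, hLT⟩ := this
    refine ⟨fun i => L.get (i.cast hL.symm), ?_, ?_⟩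
    · simp only [Finset.mem_coe, Fintype.mem_piFinset]
      intro i; exact hLT _ (List.get_mem L _)
    · subst hL
      simpa using hLp
  have hfin := I.finite_toSet.subset hsub
  refine ⟨hfin, ?_⟩
  calc _ ≤ (I : Set G).ncard := Set.ncard_le_ncard hsub I.finite_toSet
    _ = I.card := Set.ncard_coe_finset I
    _ ≤ F.card := Finset.card_image_le
    _ = T.card ^ n := by simp [F]
    _ ≤ _ := Nat.pow_le_pow_left hT n

/-- Exponential growth of balls. -/
lemma growth [MetricSpace G] (h : IsQIToWordMetric G) :
    ∃ c : ℝ, 1 ≤ c ∧ ∀ R : ℝ, 0 ≤ R → {g : G | dist (1 : G) g ≤ R}.Finite ∧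
      ({g : G | dist (1 : G) g ≤ R}.ncard : ℝ) ≤ c * Real.exp (c * R) := by
  obtain ⟨S, hS, Λ, c, hΛ, hc, hq⟩ := h
  set b : ℝ := ((2 * S.card + 1 : ℕ) : ℝ) with hb
  have hb1 : 1 ≤ b := by simp [hb]
  have hlb : 0 ≤ Real.log b := Real.log_nonneg hb1
  set c1 : ℝ := max (Real.exp (Real.log b * (Λ * c + 1))) (max 1 (Real.log b * Λ)) with hc1
  refine ⟨c1, (le_max_left _ _).trans (le_max_right _ _), fun R hR => ?_⟩
  have hsub : {g : G | dist (1 : G) g ≤ R} ⊆ {g : G | wordLength (S : Set G) g ≤ ⌈Λ * (R + c)⌉₊} := by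
    intro g hg
    simp only [mem_ofPred_eq] at hg ⊢
    have h1 := (hq g).1
    have h2 : (wordLength (S : Set G) g : ℝ) / Λ ≤ R + c := by linarith
    rw [div_le_iff₀ (by linarith)] at h2
    have h3 : (wordLength (S : Set G) g : ℝ) ≤ ⌈Λ * (R + c)⌉₊ :=
      (by linarith : (wordLength (S : Set G) g : ℝ) ≤ Λ * (R + c)).trans (Nat.le_ceil _)
    exact_mod_cast h3
  obtain ⟨w1, w2⟩ := wordBall S hS ⌈Λ * (R + c)⌉₊
  refine ⟨w1.subset hsub, ?_⟩
  have h4 : ({g : G | dist (1 : G) g ≤ R}.ncard : ℝ) ≤ b ^ ⌈Λ * (R + c)⌉₊ := by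
    have := (Set.ncard_le_ncard hsub w1).trans w2
    rw [hb]
    exact_mod_cast this
  have h5 : b ^ ⌈Λ * (R + c)⌉₊ = Real.exp (Real.log b * ⌈Λ * (R + c)⌉₊) := by
    rw [← Real.rpow_natCast, Real.rpow_def_of_pos (by linarith)]
  have h6 : (⌈Λ * (R + c)⌉₊ : ℝ) ≤ Λ * (R + c) + 1 := (Nat.ceil_lt_add_one (by positivity)).le
  calc ({g : G | dist (1 : G) g ≤ R}.ncard : ℝ) ≤ _ := h4
    _ = _ := h5
    _ ≤ Real.exp (Real.log b * (Λ * c + 1) + Real.log b * Λ * R) := by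
      apply Real.exp_le_exp.mpr
      have := mul_le_mul_of_nonneg_left h6 hlb
      linarith
    _ = Real.exp (Real.log b * (Λ * c + 1)) * Real.exp (Real.log b * Λ * R) := Real.exp_add _ _
    _ ≤ c1 * Real.exp (c1 * R) := by
      have : Real.log b * Λ * R ≤ c1 * R :=
        mul_le_mul_of_nonneg_right ((le_max_right _ _).trans (le_max_right _ _)) hR
      gcongr
      · exact le_max_left _ _

end Growth

end ModA

section ModB
/-! ### The boundary of a hyperbolic space -/

section Bnd
variable {X : Type*} [MetricSpace X]

lemma ev_prod {p : ℕ × ℕ → Prop} :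
    (∀ᶠ pr in (atTop : Filter (ℕ × ℕ)), p pr) ↔ ∃ N, ∀ n, N ≤ n → ∀ m, N ≤ m → p (n, m) := by
  rw [eventually_atTop]
  constructor
  · rintro ⟨⟨a, b⟩, h⟩
    exact ⟨max a b, fun n hn m hm => h (n, m) ⟨(le_max_left _ _).trans hn, (le_max_right _ _).trans hm⟩⟩
  · rintro ⟨N, h⟩
    exact ⟨(N, N), fun pr hpr => h pr.1 hpr.1 pr.2 hpr.2⟩

lemma bndRel_iff {o : X} {u v : DivSeq X o} : bndRel o u v ↔
    ∀ t : ℝ, ∃ N, ∀ n, N ≤ n → ∀ m, N ≤ m → t ≤ gp o (u.1 n) (v.1 m) := by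
  unfold bndRel
  rw [Filter.tendsto_atTop]
  exact forall_congr' fun t => ev_prod

lemma bndRel_refl {o : X} (u : DivSeq X o) : bndRel o u u := u.2

lemma bndRel_symm {o : X} {u v : DivSeq X o} (h : bndRel o u v) : bndRel o v u := by
  rw [bndRel_iff] at *
  intro t
  obtain ⟨N, hN⟩ := h t
  exact ⟨N, fun n hn m hm => by rw [gp_comm]; exact hN m hm n hn⟩

lemma bndRel_trans {δ : ℝ} (hX : IsHyperbolicWith X δ) {o : X} {u v w : DivSeq X o}
    (h : bndRel o u v) (h' : bndRel o v w) : bndRel o u w := by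
  rw [bndRel_iff] at *
  intro t
  obtain ⟨N, hN⟩ := h (t + δ)
  obtain ⟨N', hN'⟩ := h' (t + δ)
  refine ⟨max N N', fun n hn m hm => ?_⟩
  have := gp_hyp hX o _ _ _ (hN n ((le_max_left _ _).trans hn) (max N N') (le_max_left _ _))
    (hN' (max N N') (le_max_right _ _) m ((le_max_right _ _).trans hm))
  linarith

lemma mkB_eq {δ : ℝ} (hX : IsHyperbolicWith X δ) {o : X} {u v : DivSeq X o} :
    mkB o u = mkB o v ↔ bndRel o u v := by
  have e : Equivalence (bndRel o) :=
    ⟨bndRel_refl, bndRel_symm, bndRel_trans hX⟩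
  exact e.quot_mk_eq_iff u v

lemma mkB_surj (o : X) (ξ : Boundary X o) : ∃ u, mkB o u = ξ := Quot.exists_rep ξ

/-- Shadows. -/
def Sh (o g : X) (t : ℝ) : Set (Boundary X o) :=
  {ξ | ∃ u : DivSeq X o, mkB o u = ξ ∧ ∀ᶠ n in atTop, t ≤ gp o g (u.1 n)}

lemma Sh_mono {o g : X} {s t : ℝ} (h : s ≤ t) : Sh o g t ⊆ Sh o g s := by
  rintro ξ ⟨u, hu, h1⟩
  exact ⟨u, hu, h1.mono fun n hn => h.trans hn⟩

lemma Sh_all {δ : ℝ} (hX : IsHyperbolicWith X δ) {o g : X} {t : ℝ} {ξ : Boundary X o}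
    (h : ξ ∈ Sh o g t) {v : DivSeq X o} (hv : mkB o v = ξ) :
    ∀ᶠ n in atTop, t - δ ≤ gp o g (v.1 n) := by
  obtain ⟨u, hu, h1⟩ := h
  have h2 : bndRel o u v := (mkB_eq hX).1 (hu.trans hv.symm)
  obtain ⟨N, hN⟩ := bndRel_iff.1 h2 t
  obtain ⟨N', hN'⟩ := eventually_atTop.1 h1
  rw [eventually_atTop]
  refine ⟨N, fun m hm => ?_⟩
  exact gp_hyp hX o _ _ _ (hN' (max N N') (le_max_right _ _)) (hN _ (le_max_left _ _) m hm)

lemma gpB_bddBelow (o : X) (ξ η : Boundary X o) :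
    ∀ t ∈ {t : ℝ | ∃ u v : DivSeq X o, mkB o u = ξ ∧ mkB o v = η ∧
    t = Filter.liminf (fun pr : ℕ × ℕ => gp o (u.1 pr.1) (v.1 pr.2)) atTop}, 0 ≤ t := by
  rintro t ⟨u, v, -, -, rfl⟩
  by_cases hc : IsCoboundedUnder (· ≥ ·) (atTop : Filter (ℕ × ℕ))
      (fun pr : ℕ × ℕ => gp o (u.1 pr.1) (v.1 pr.2))
  · exact le_liminf_of_le hc (Eventually.of_forall fun pr => gp_nonneg _ _ _)
  · rw [liminf_eq]
    refine (Real.sSup_of_not_bddAbove ?_).ge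
    intro hb
    apply hc
    obtain ⟨b, hb⟩ := hb
    exact ⟨b, fun a ha => hb ha⟩

lemma qB_nonneg (o : X) (ξ η : Boundary X o) : 0 ≤ qB o ξ η := by
  unfold qB; split_ifs
  · exact le_rfl
  · positivity

lemma qB_self (o : X) (ξ : Boundary X o) : qB o ξ ξ = 0 := by simp [qB]

lemma qB_pos {o : X} {ξ η : Boundary X o} (h : ξ ≠ η) : 0 < qB o ξ η := by
  simp only [qB, h, if_false]; positivity

lemma qB_le_exp {δ : ℝ} (hX : IsHyperbolicWith X δ) {o : X} {ξ η : Boundary X o} {t : ℝ}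
    (h : ∀ u v : DivSeq X o, mkB o u = ξ → mkB o v = η →
      ∀ᶠ pr in (atTop : Filter (ℕ × ℕ)), t ≤ gp o (u.1 pr.1) (v.1 pr.2)) :
    qB o ξ η ≤ Real.exp (-t) := by
  unfold qB
  split_ifs with hne
  · positivity
  · apply Real.exp_le_exp.2
    apply neg_le_neg
    unfold gpB
    apply le_csInf
    · obtain ⟨u, hu⟩ := mkB_surj o ξ
      obtain ⟨v, hv⟩ := mkB_surj o η
      exact ⟨_, u, v, hu, hv, rfl⟩
    · rintro s ⟨u, v, hu, hv, rfl⟩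
      refine le_liminf_of_le ?_ (h u v hu hv)
      have hnr : ¬ bndRel o u v := by
        intro hr
        exact hne (hu.symm.trans (((mkB_eq hX).2 hr).trans hv))
      rw [bndRel_iff] at hnr
      push Not at hnr
      obtain ⟨T, hT⟩ := hnr
      refine ⟨T, fun a ha => ?_⟩
      rw [eventually_map, ev_prod] at ha
      obtain ⟨N, hN⟩ := ha
      obtain ⟨n, hn, m, hm, hlt⟩ := hT N
      exact (hN n hn m hm).trans hlt.le

lemma gp_of_qB_lt {δ : ℝ} (hX : IsHyperbolicWith X δ) {o : X} {ξ η : Boundary X o} {t : ℝ}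
    (h : qB o ξ η < Real.exp (-t)) {u v : DivSeq X o} (hu : mkB o u = ξ) (hv : mkB o v = η) :
      ∀ᶠ pr in (atTop : Filter (ℕ × ℕ)), t ≤ gp o (u.1 pr.1) (v.1 pr.2) := by
  by_cases hne : ξ = η
  · subst hne
    exact ev_prod.2 (bndRel_iff.1 ((mkB_eq hX).1 (hu.trans hv.symm)) t)
  · simp only [qB, hne, if_false, Real.exp_lt_exp, neg_lt_neg_iff] at h
    have h2 : t < liminf (fun pr : ℕ × ℕ => gp o (u.1 pr.1) (v.1 pr.2)) atTop :=
      h.trans_le (csInf_le ⟨0, fun s hs => gpB_bddBelow o ξ η s hs⟩ ⟨u, v, hu, hv, rfl⟩)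
    have h3 := eventually_lt_of_lt_liminf h2
      ⟨0, eventually_map.2 (Eventually.of_forall fun pr => gp_nonneg _ _ _)⟩
    exact h3.mono fun pr hpr => hpr.le

lemma exists_exp_eq {r : ℝ} (hr : 0 < r) : ∃ t, r = Real.exp (-t) :=
  ⟨-Real.log r, by simp [Real.exp_log hr]⟩

lemma qB_comm {δ : ℝ} (hX : IsHyperbolicWith X δ) {o : X} (ξ η : Boundary X o) :
    qB o ξ η = qB o η ξ := by
  have key : ∀ ξ η : Boundary X o, qB o η ξ ≤ qB o ξ η := by
    intro ξ η
    refine le_of_forall_gt_imp_ge_of_dense fun r hr => ?_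
    obtain ⟨t, rfl⟩ := exists_exp_eq ((qB_nonneg o ξ η).trans_lt hr)
    refine qB_le_exp hX fun u v hu hv => ?_
    have := ev_prod.1 (gp_of_qB_lt hX hr hv hu)
    rw [ev_prod]
    obtain ⟨N, hN⟩ := this
    exact ⟨N, fun n hn m hm => by rw [gp_comm]; exact hN m hm n hn⟩
  exact le_antisymm (key _ _) (key _ _)

lemma qB_quasi {δ : ℝ} (hX : IsHyperbolicWith X δ) {o : X} {ξ η ζ : Boundary X o} {r : ℝ}
    (h1 : qB o ξ η < r) (h2 : qB o η ζ < r) : qB o ξ ζ ≤ Real.exp δ * r := by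
  obtain ⟨t, rfl⟩ := exists_exp_eq ((qB_nonneg o ξ η).trans_lt h1)
  rw [← Real.exp_add, show δ + -t = -(t - δ) by ring]
  refine qB_le_exp hX fun u v hu hv => ?_
  obtain ⟨w, hw⟩ := mkB_surj o η
  obtain ⟨N, hN⟩ := ev_prod.1 (gp_of_qB_lt hX h1 hu hw)
  obtain ⟨N', hN'⟩ := ev_prod.1 (gp_of_qB_lt hX h2 hw hv)
  rw [ev_prod]
  refine ⟨max N N', fun n hn m hm => ?_⟩
  exact gp_hyp hX o _ _ _ (hN n ((le_max_left _ _).trans hn) (max N N') (le_max_left _ _))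
    (hN' (max N N') (le_max_right _ _) m ((le_max_right _ _).trans hm))

lemma qB_of_Sh {δ : ℝ} (hX : IsHyperbolicWith X δ) {o g : X} {ξ η : Boundary X o} {t : ℝ}
    (h1 : ξ ∈ Sh o g t) (h2 : η ∈ Sh o g t) : qB o ξ η ≤ Real.exp (-(t - 2 * δ)) := by
  refine qB_le_exp hX fun u v hu hv => ?_
  obtain ⟨N, hN⟩ := eventually_atTop.1 (Sh_all hX h1 hu)
  obtain ⟨N', hN'⟩ := eventually_atTop.1 (Sh_all hX h2 hv)
  rw [ev_prod]
  refine ⟨max N N', fun n hn m hm => ?_⟩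
  have := gp_hyp hX o (u.1 n) (v.1 m) g (by rw [gp_comm]; exact hN n ((le_max_left _ _).trans hn))
    (hN' m ((le_max_right _ _).trans hm))
  dsimp only
  linarith

lemma Sh_of_qB {δ : ℝ} (hX : IsHyperbolicWith X δ) {o g : X} {ξ η : Boundary X o} {t : ℝ}
    (h1 : ξ ∈ Sh o g t) (h2 : qB o ξ η < Real.exp (-t)) : η ∈ Sh o g (t - δ) := by
  obtain ⟨u, hu, h1⟩ := h1
  obtain ⟨v, hv⟩ := mkB_surj o η
  refine ⟨v, hv, ?_⟩
  obtain ⟨N, hN⟩ := eventually_atTop.1 h1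
  obtain ⟨N', hN'⟩ := ev_prod.1 (gp_of_qB_lt hX h2 hu hv)
  rw [eventually_atTop]
  refine ⟨N', fun m hm => ?_⟩
  exact gp_hyp hX o _ _ _ (hN (max N N') (le_max_left _ _)) (hN' _ (le_max_right _ _) m hm)

lemma gp_of_Sh {δ : ℝ} (hX : IsHyperbolicWith X δ) {o g g' : X} {ξ : Boundary X o} {t : ℝ}
    (h1 : ξ ∈ Sh o g t) (h2 : ξ ∈ Sh o g' t) : t - 2 * δ ≤ gp o g g' := by
  obtain ⟨u, hu⟩ := mkB_surj o ξ
  obtain ⟨n, h3, h4⟩ := ((Sh_all hX h1 hu).and (Sh_all hX h2 hu)).exists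
  rw [gp_comm] at h4
  have := gp_hyp hX o _ _ _ h3 h4
  linarith

end Bnd

section Cover
variable {G : Type*} [Group G] [MetricSpace G]

lemma dist_mul_right_self (h : LeftInvariantMetric G) (x s : G) : dist x (x * s) = dist 1 s := by
  have := h x 1 s
  rwa [mul_one] at this

/-- The boundary is covered by exponentially many shadows. -/
lemma cover_Sh (hG : IsHypGroupMetric G) :
    ∃ c : ℝ, 1 ≤ c ∧ ∀ t : ℝ, 0 ≤ t → ∃ F : Finset G, (F.card : ℝ) ≤ c * Real.exp (c * t) ∧
      ∀ ξ : Boundary G 1, ∃ g ∈ F, ξ ∈ Sh 1 g t := by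
  obtain ⟨hinv, ⟨δ, hδ, hX⟩, S, hS, Λ, c, hΛ, hc, hq⟩ := hG
  have ha : (0:ℝ) < 1 / (2 * Λ) := by positivity
  set a := 1 / (2 * Λ) with haa
  have haΛ : 2 * Λ * a = 1 := by rw [haa]; field_simp
  obtain ⟨C, hC, hT⟩ := tracking hδ hX (1 : G) ha
  obtain ⟨N, hN⟩ := exists_nat_gt (2 * Λ * (c + (Λ + c)))
  set b : ℝ := ((2 * S.card + 1 : ℕ) : ℝ) with hb
  have hb1 : 1 ≤ b := by simp [hb]
  have hlb : 0 ≤ Real.log b := Real.log_nonneg hb1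
  set c1 : ℝ := max (Real.exp (Real.log b * (2 * Λ * (δ + C) + 1 + N))) (max 1 (Real.log b * (2 * Λ)))
    with hc1
  refine ⟨c1, (le_max_left _ _).trans (le_max_right _ _), fun t ht => ?_⟩
  set k := ⌈2 * Λ * (t + δ + C)⌉₊ + N with hk
  obtain ⟨w1, w2⟩ := wordBall S hS k
  have hkle : (k : ℝ) ≤ 2 * Λ * (t + δ + C) + 1 + N := by
    rw [hk]; push_cast
    have := (Nat.ceil_lt_add_one (a := 2 * Λ * (t + δ + C)) (by positivity)).le
    linarith
  have hkge : 2 * Λ * (t + δ + C) ≤ k := by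
    rw [hk]; push_cast
    have := Nat.le_ceil (2 * Λ * (t + δ + C))
    have : (0:ℝ) ≤ N := by positivity
    linarith
  refine ⟨w1.toFinset, ?_, ?_⟩
  · rw [← Set.ncard_eq_toFinset_card _ w1]
    have h4 : ({g : G | wordLength (S : Set G) g ≤ k}.ncard : ℝ) ≤ b ^ k := by
      rw [hb]; exact_mod_cast w2
    have h5 : b ^ k = Real.exp (Real.log b * k) := by
      rw [← Real.rpow_natCast, Real.rpow_def_of_pos (by linarith)]
    calc _ ≤ _ := h4
      _ = _ := h5
      _ ≤ Real.exp (Real.log b * (2 * Λ * (δ + C) + 1 + N) + Real.log b * (2 * Λ) * t) := by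
        apply Real.exp_le_exp.mpr
        have := mul_le_mul_of_nonneg_left hkle hlb
        linarith
      _ = Real.exp (Real.log b * (2 * Λ * (δ + C) + 1 + N)) * Real.exp (Real.log b * (2 * Λ) * t) :=
        Real.exp_add _ _
      _ ≤ c1 * Real.exp (c1 * t) := by
        have : Real.log b * (2 * Λ) * t ≤ c1 * t :=
          mul_le_mul_of_nonneg_right ((le_max_right _ _).trans (le_max_right _ _)) ht
        gcongr
        · exact le_max_left _ _
  · -- key claim on elements of large word length
    have key : ∀ y : G, k ≤ wordLength (S : Set G) y →
        ∃ g ∈ w1.toFinset, t + δ ≤ gp 1 g y := by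
      intro y hy
      obtain ⟨L, hLlen, hLS, hfy⟩ : ∃ L : List G, L.length = wordLength (S : Set G) y ∧
          (∀ s ∈ L, s ∈ (S : Set G) ∨ s⁻¹ ∈ (S : Set G)) ∧ y = L.prod := by
        obtain ⟨f, hf, hfy⟩ := wordLength_spec (S : Set G) hS y
        refine ⟨List.ofFn f, by simp, ?_, hfy⟩
        intro s hs
        rw [List.mem_ofFn] at hs
        obtain ⟨i, rfl⟩ := hs
        exact hf i
      set M := wordLength (S : Set G) y with hM
      let x : ℕ → G := fun i => (L.take i).prod
      have hxM : x M = y := by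
        simp only [x]; rw [← hLlen, List.take_length, hfy]
      have hxle : ∀ i ≤ M, wordLength (S : Set G) (x i) ≤ i := by
        intro i hi
        refine wordLength_le_of (L.take i) (fun s hs => hLS s (List.mem_of_mem_take hs)) ?_
        simp [hLlen, hi]
      have hxge : ∀ i ≤ M, i ≤ wordLength (S : Set G) (x i) := by
        intro i hi
        obtain ⟨f', hf', hx'⟩ := wordLength_spec (S : Set G) hS (x i)
        have e : y = (List.ofFn f' ++ L.drop i).prod := by
          rw [List.prod_append, ← hx', hfy]
          exact (List.prod_take_mul_prod_drop L i).symm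
        have := wordLength_le_of (S := (S : Set G)) (List.ofFn f' ++ L.drop i) (by
          intro s hs
          rw [List.mem_append] at hs
          rcases hs with hs | hs
          · rw [List.mem_ofFn] at hs
            obtain ⟨i, rfl⟩ := hs
            exact hf' i
          · exact hLS s (List.mem_of_mem_drop hs)) rfl
        rw [← e, List.length_append, List.length_ofFn, List.length_drop, hLlen, ← hM] at this
        omega
      have hd : ∀ i ≤ M, (i : ℝ) / Λ - c ≤ dist 1 (x i) := by
        intro i hi
        have h1 := (hq (x i)).1
        rw [le_antisymm (hxle i hi) (hxge i hi)] at h1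
        exact h1
      have hlow : ∀ i : ℕ, N ≤ i → a * i + (Λ + c) ≤ (i : ℝ) / Λ - c := by
        intro i hi
        have : (N : ℝ) ≤ i := by exact_mod_cast hi
        have e : (i : ℝ) / Λ = 2 * (a * i) := by rw [haa]; field_simp
        have : 2 * Λ * (c + (Λ + c)) ≤ i := by linarith
        have := mul_le_mul_of_nonneg_left this ha.le
        have e2 : a * (2 * Λ * (c + (Λ + c))) = c + (Λ + c) := by
          rw [← mul_assoc, mul_comm a, haΛ, one_mul]
        rw [e2] at this
        linarith
      have hstep : ∀ i < M, dist (x i) (x (i + 1)) ≤ Λ + c := by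
        intro i hi
        have e : x (i + 1) = x i * L[i]'(by omega) := by
          simp only [x]; rw [List.prod_take_succ]
        rw [e, dist_mul_right_self hinv]
        have h1 := (hq (L[i]'(by omega))).2
        have h2 := wordLength_le_of (S := (S : Set G)) [L[i]'(by omega)] (by
          intro s hs
          rw [List.mem_singleton] at hs
          rw [hs]; exact hLS _ (List.getElem_mem _)) rfl
        simp only [List.prod_singleton, List.length_singleton] at h2
        have h3 : (wordLength (S : Set G) (L[i]'(by omega)) : ℝ) ≤ 1 := by exact_mod_cast h2
        have : Λ * (wordLength (S : Set G) (L[i]'(by omega)) : ℝ) ≤ Λ * 1 :=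
          mul_le_mul_of_nonneg_left h3 (by linarith)
        linarith
      have h1 := hT x N M (fun n hn hm => by
          have := hd n hm; have := hlow n hn; linarith)
        (fun n hn hm => by
          have e1 := hd n hm.le; have e2 := hlow n hn; have e3 := hstep n hm
          have e4 := gp_ge_sub 1 (x n) (x (n + 1))
          linarith) k M (by omega) hy le_rfl
      refine ⟨x k, ?_, ?_⟩
      · simp only [Set.Finite.mem_toFinset, mem_ofPred_eq]; exact hxle k hy
      · rw [hxM] at h1
        have := mul_le_mul_of_nonneg_left hkge ha.le
        have e2 : a * (2 * Λ * (t + δ + C)) = t + δ + C := by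
          rw [← mul_assoc, mul_comm a, haΛ, one_mul]
        linarith
    intro ξ
    obtain ⟨u, hu⟩ := mkB_surj 1 ξ
    have hu2 : ∀ T : ℝ, ∃ N, ∀ n, N ≤ n → ∀ m, N ≤ m → T ≤ gp 1 (u.1 n) (u.1 m) :=
      bndRel_iff.1 (bndRel_refl u)
    obtain ⟨N1, hN1⟩ := hu2 (Λ * k + c)
    have hev : ∀ n, N1 ≤ n → ∃ g ∈ w1.toFinset, t + δ ≤ gp 1 g (u.1 n) := by
      intro n hn
      apply key
      have h1 := hN1 n hn n hn
      rw [gp_self] at h1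
      have h2 := (hq (u.1 n)).2
      have h3 : Λ * (k : ℝ) ≤ Λ * wordLength (S : Set G) (u.1 n) := by linarith
      have h4 := le_of_mul_le_mul_left h3 (by linarith)
      exact_mod_cast h4
    have hfreq : ∃ᶠ n in atTop, ∃ g ∈ w1.toFinset, t + δ ≤ gp 1 g (u.1 n) :=
      (eventually_atTop.2 ⟨N1, hev⟩).frequently
    have hfreq2 : ∃ g ∈ w1.toFinset, ∃ᶠ n in atTop, t + δ ≤ gp 1 g (u.1 n) := by
      by_contra hcon
      push Not at hcon
      have h1 : ∀ᶠ n in atTop, ∀ g ∈ w1.toFinset, ¬ (t + δ ≤ gp 1 g (u.1 n)) := by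
        rw [Filter.eventually_all_finset]
        intro g hg
        simpa [Filter.not_frequently] using hcon g hg
      obtain ⟨n, ⟨g, hg, h2⟩, h3⟩ := (hfreq.and_eventually h1).exists
      exact h3 g hg h2
    obtain ⟨g, hg, hgf⟩ := hfreq2
    refine ⟨g, hg, u, hu, ?_⟩
    obtain ⟨N2, hN2⟩ := hu2 (t + δ)
    obtain ⟨n, hn, hgn⟩ := Filter.frequently_atTop.1 hgf N2
    rw [eventually_atTop]
    refine ⟨N2, fun m hm => ?_⟩
    have := gp_hyp hX 1 _ _ _ hgn (hN2 n hn m hm)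
    linarith

end Cover

end ModB

section ModC
/-! ### Hausdorff dimension of exact dimensional measures -/

section Billingsley
variable {A : Type*}

lemma qdiam_empty (q : A → A → ℝ) : qdiam q ∅ = 0 := by simp [qdiam]

lemma qdiam_le {q : A → A → ℝ} {E : Set A} {r : ℝ} (h : ∀ x ∈ E, ∀ y ∈ E, q x y ≤ r) :
    qdiam q E ≤ ENNReal.ofReal r := by
  unfold qdiam
  exact iSup₂_le fun x hx => iSup₂_le fun y hy => ENNReal.ofReal_le_ofReal (h x hx y hy)

lemma le_qdiam {q : A → A → ℝ} {E : Set A} {x y : A} (hx : x ∈ E) (hy : y ∈ E) :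
    ENNReal.ofReal (q x y) ≤ qdiam q E :=
  (le_iSup₂ (f := fun y (_ : y ∈ E) => ENNReal.ofReal (q x y)) y hy).trans
    (le_iSup₂ (f := fun x (_ : x ∈ E) => ⨆ y ∈ E, ENNReal.ofReal (q x y)) x hx)

lemma content_le_of_cover {q : A → A → ℝ} {α Δ : ℝ} {E : Set A} (c : ℕ → Set A)
    (h1 : E ⊆ ⋃ i, c i) (h2 : ∀ i, qdiam q (c i) ≤ ENNReal.ofReal Δ) :
    qHContent q α Δ E ≤ ∑' i, qdiam q (c i) ^ α := by
  unfold qHContent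
  exact iInf_le_of_le c (iInf_le_of_le h1 (iInf_le_of_le h2 le_rfl))

lemma content_le_of_finset {q : A → A → ℝ} {α Δ r : ℝ} (hα : 0 < α) {ι : Type*}
    (s : Finset ι) (c : ι → Set A) {E : Set A} (hE : E ⊆ ⋃ i ∈ s, c i)
    (hc : ∀ i ∈ s, qdiam q (c i) ≤ ENNReal.ofReal r) (hr : r ≤ Δ) :
    qHContent q α Δ E ≤ s.card * ENNReal.ofReal r ^ α := by
  let e := s.equivFin.symm
  let c' : ℕ → Set A := fun n => if h : n < s.card then c (e ⟨n, h⟩).1 else ∅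
  have h1 : E ⊆ ⋃ i, c' i := by
    intro x hx
    obtain ⟨i, hi, hxi⟩ := mem_iUnion₂.1 (hE hx)
    refine mem_iUnion.2 ⟨(s.equivFin ⟨i, hi⟩).1, ?_⟩
    simp only [c', (s.equivFin ⟨i, hi⟩).2, dif_pos, e, Fin.eta, Equiv.symm_apply_apply]
    exact hxi
  have h2 : ∀ i, qdiam q (c' i) ≤ ENNReal.ofReal r := by
    intro n
    by_cases h : n < s.card
    · simp only [c', h, dif_pos]; exact hc _ (e ⟨n, h⟩).2
    · simp only [c', h]; simp [qdiam_empty]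
  refine (content_le_of_cover c' h1
    (fun i => (h2 i).trans (ENNReal.ofReal_le_ofReal hr))).trans ?_
  rw [tsum_eq_sum (s := Finset.range s.card)]
  · refine (Finset.sum_le_card_nsmul _ _ (ENNReal.ofReal r ^ α) fun i _ =>
      ENNReal.rpow_le_rpow (h2 i) hα.le).trans ?_
    simp
  · intro n hn
    have h : ¬ n < s.card := by simpa using hn
    simp only [c', h]; simp [qdiam_empty, hα]

lemma content_iUnion_le {q : A → A → ℝ} {α Δ : ℝ} (E : ℕ → Set A) (a : ℕ → ℝ≥0∞)
    (h : ∀ k, qHContent q α Δ (E k) < a k) : qHContent q α Δ (⋃ k, E k) ≤ ∑' k, a k := by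
  have h' : ∀ k, ∃ c : ℕ → Set A, E k ⊆ ⋃ i, c i ∧ (∀ i, qdiam q (c i) ≤ ENNReal.ofReal Δ) ∧
      ∑' i, qdiam q (c i) ^ α < a k := by
    intro k
    have := h k
    unfold qHContent at this
    simp only [iInf_lt_iff] at this
    obtain ⟨c, h1, h2, h3⟩ := this
    exact ⟨c, h1, h2, h3⟩
  choose c h1 h2 h3 using h'
  refine (content_le_of_cover (fun n => c (Nat.unpair n).1 (Nat.unpair n).2) ?_
    (fun i => h2 _ _)).trans ?_
  · intro x hx
    obtain ⟨k, hk⟩ := mem_iUnion.1 hx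
    obtain ⟨i, hi⟩ := mem_iUnion.1 (h1 k hk)
    refine mem_iUnion.2 ⟨Nat.pair k i, ?_⟩
    simpa using hi
  · have e : ∑' n : ℕ, qdiam q (c (Nat.unpair n).1 (Nat.unpair n).2) ^ α =
        ∑' pr : ℕ × ℕ, qdiam q (c pr.1 pr.2) ^ α :=
      Nat.pairEquiv.symm.tsum_eq (fun pr : ℕ × ℕ => qdiam q (c pr.1 pr.2) ^ α)
    rw [e, ENNReal.tsum_prod (f := fun a b => qdiam q (c a b) ^ α)]
    exact ENNReal.tsum_le_tsum fun k => (h3 k).le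

lemma content_mono {q : A → A → ℝ} {α Δ : ℝ} {E F : Set A} (h : E ⊆ F) :
    qHContent q α Δ E ≤ qHContent q α Δ F := by
  unfold qHContent
  refine iInf_mono fun c => ?_
  exact le_iInf fun h1 => iInf_le_of_le (h.trans h1) le_rfl

lemma qHMeasure_eq_zero {q : A → A → ℝ} {α : ℝ} {E : Set A}
    (h : ∀ Δ : ℝ, 0 < Δ → qHContent q α Δ E = 0) : qHMeasure q α E = 0 := by
  unfold qHMeasure
  simp only [ENNReal.iSup_eq_zero]
  exact h

/-- exponent comparison -/
lemma tendsto_count {B a α K : ℝ} (h : a < α) :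
    Tendsto (fun r : ℝ => B * r ^ (-a) * (K * r) ^ α) (𝓝[>] 0) (𝓝 0) := by
  have h1 : Tendsto (fun r : ℝ => B * K ^ α * r ^ (α - a)) (𝓝[>] 0) (𝓝 0) := by
    have h2 : ContinuousAt (fun r : ℝ => r ^ (α - a)) 0 :=
      Real.continuousAt_rpow_const _ _ (Or.inr (by linarith))
    have h3 : Tendsto (fun r : ℝ => r ^ (α - a)) (𝓝[>] 0) (𝓝 0) := by
      have := h2.tendsto
      rw [Real.zero_rpow (by linarith)] at this
      exact this.mono_left nhdsWithin_le_nhds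
    simpa using h3.const_mul (B * K ^ α)
  by_cases hK : 0 ≤ K
  · refine h1.congr' ?_
    filter_upwards [self_mem_nhdsWithin] with r hr
    have hr : 0 < r := hr
    rw [Real.mul_rpow hK hr.le, show α - a = -a + α by ring, Real.rpow_add hr]
    ring
  · have h2 : Tendsto (fun r : ℝ => |B| * |K| ^ α * r ^ (α - a)) (𝓝[>] 0) (𝓝 0) := by
      have h2 : ContinuousAt (fun r : ℝ => r ^ (α - a)) 0 :=
        Real.continuousAt_rpow_const _ _ (Or.inr (by linarith))
      have h3 : Tendsto (fun r : ℝ => r ^ (α - a)) (𝓝[>] 0) (𝓝 0) := by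
        have := h2.tendsto
        rw [Real.zero_rpow (by linarith)] at this
        exact this.mono_left nhdsWithin_le_nhds
      simpa using h3.const_mul (|B| * |K| ^ α)
    refine squeeze_zero_norm' ?_ h2
    filter_upwards [self_mem_nhdsWithin] with r hr
    have hr : 0 < r := hr
    rw [norm_mul, norm_mul, Real.norm_eq_abs, Real.norm_eq_abs, Real.norm_eq_abs,
      abs_of_pos (Real.rpow_pos_of_pos hr _), show α - a = -a + α by ring, Real.rpow_add hr]
    have : |(K * r) ^ α| ≤ |K| ^ α * r ^ α := by
      refine (Real.abs_rpow_le_abs_rpow _ _).trans ?_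
      rw [abs_mul, abs_of_pos hr, Real.mul_rpow (abs_nonneg _) hr.le]
    calc _ ≤ |B| * r ^ (-a) * (|K| ^ α * r ^ α) := by gcongr
      _ = _ := by ring

/-- if for all small `r`, `E` is covered by `B r^{-a}` sets of diameter `≤ K r`, then
the Hausdorff contents vanish for `α > a`. -/
lemma content_zero_of_covers {q : A → A → ℝ} {α a B K Δ : ℝ} (hK : 0 ≤ K) (hB : 0 ≤ B)
    (hα : 0 < α) (ha : a < α) {E : Set A} (hΔ : 0 < Δ)
    (h : ∀ᶠ r in 𝓝[>] (0:ℝ), ∃ (s : Finset (Set A)), E ⊆ (⋃ i ∈ s, i) ∧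
      (∀ i ∈ s, qdiam q i ≤ ENNReal.ofReal (K * r)) ∧ (s.card : ℝ) ≤ B * r ^ (-a)) :
    qHContent q α Δ E = 0 := by
  have h1 : ∀ᶠ r in 𝓝[>] (0:ℝ), qHContent q α Δ E ≤
      ENNReal.ofReal (B * r ^ (-a) * (K * r) ^ α) := by
    have h2 : ∀ᶠ r in 𝓝[>] (0:ℝ), K * r ≤ Δ := by
      have : Tendsto (fun r : ℝ => K * r) (𝓝[>] 0) (𝓝 0) := by
        have : Tendsto (fun r : ℝ => K * r) (𝓝 0) (𝓝 (K * 0)) := (continuous_const.mul continuous_id).tendsto 0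
        rw [mul_zero] at this
        exact this.mono_left nhdsWithin_le_nhds
      exact (this.eventually (gt_mem_nhds hΔ)).mono fun r hr => hr.le
    filter_upwards [h, h2, self_mem_nhdsWithin] with r hr hr2 hr3
    have hr3 : 0 < r := hr3
    obtain ⟨s, e1, e2, e3⟩ := hr
    refine (content_le_of_finset hα s (fun i => i) e1 e2 hr2).trans ?_
    rw [ENNReal.ofReal_rpow_of_nonneg (by positivity) hα.le, ENNReal.ofReal_mul (by positivity)]
    gcongr
    rw [← ENNReal.ofReal_natCast]
    exact ENNReal.ofReal_le_ofReal e3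
  have h2 := ENNReal.tendsto_ofReal (tendsto_count (B := B) (K := K) ha)
  rw [ENNReal.ofReal_zero] at h2
  exact le_antisymm (ge_of_tendsto h2 h1) bot_le

/-- A quasi-metric. -/
structure IsQuasi (q : A → A → ℝ) (K : ℝ) : Prop where
  one_le : 1 ≤ K
  nonneg : ∀ x y, 0 ≤ q x y
  self : ∀ x, q x x = 0
  symm : ∀ x y, q x y = q y x
  quasi : ∀ x y z r, q x y < r → q y z < r → q x z ≤ K * r

variable [MeasurableSpace A]

/-- finite covers of sets where balls have large mass -/
lemma cover_of_mass {q : A → A → ℝ} {K : ℝ} (hq : IsQuasi q K)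
    (hm : ∀ x r, MeasurableSet (qball q x r)) (ν : Measure A) [IsProbabilityMeasure ν]
    {E : Set A} {r M : ℝ} (hr : 0 < r) (hM : 0 < M)
    (h : ∀ x ∈ E, ENNReal.ofReal M ≤ ν (qball q x r)) :
    ∃ s : Finset A, (s.card : ℝ) ≤ M⁻¹ ∧ E ⊆ ⋃ i ∈ s, qball q i (2 * K * r) := by
  let Good : Finset A → Prop := fun s => (↑s ⊆ E) ∧ ∀ x ∈ s, ∀ y ∈ s, x ≠ y → 2 * K * r ≤ q x y
  have hK := hq.one_le
  have hcard : ∀ s, Good s → (s.card : ℝ) ≤ M⁻¹ := by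
    rintro s ⟨h1, h2⟩
    have hd : (s : Set A).PairwiseDisjoint (fun x => qball q x r) := by
      intro x hx y hy hxy
      rw [Function.onFun, Set.disjoint_left]
      intro z hz1 hz2
      have := hq.quasi x z y r hz1 (by rw [hq.symm]; exact hz2)
      have h3 := h2 x hx y hy hxy
      have : 0 < K * r := by positivity
      nlinarith
    have h3 : ∑ x ∈ s, ν (qball q x r) ≤ 1 := by
      rw [← measure_biUnion_finset hd (fun x _ => hm x r)]
      exact prob_le_one
    have h4 : (s.card : ℝ≥0∞) * ENNReal.ofReal M ≤ 1 := by
      refine le_trans ?_ h3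
      have := Finset.card_nsmul_le_sum s (fun x => ν (qball q x r)) (ENNReal.ofReal M)
        (fun x hx => h x (h1 hx))
      simpa using this
    rw [← ENNReal.ofReal_natCast, ← ENNReal.ofReal_mul (by positivity), ENNReal.ofReal_le_one] at h4
    rw [← one_div, le_div_iff₀ hM]
    exact h4
  have hex : ∃ s, Good s ∧ ∀ t, Good t → t.card ≤ s.card := by
    have hne : ∃ n, ∃ s, Good s ∧ s.card = n := ⟨0, ∅, ⟨by simp, by simp⟩, rfl⟩
    have hb : ∀ n, (∃ s, Good s ∧ s.card = n) → n ≤ ⌊M⁻¹⌋₊ := by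
      rintro n ⟨s, hs, rfl⟩
      exact Nat.le_floor (hcard s hs)
    obtain ⟨s, hs, hs2⟩ := Nat.findGreatest_spec (P := fun n => ∃ s, Good s ∧ s.card = n)
      (Nat.zero_le ⌊M⁻¹⌋₊) ⟨∅, ⟨by simp, by simp⟩, rfl⟩
    refine ⟨s, hs, fun t ht => ?_⟩
    rw [hs2]
    exact Nat.le_findGreatest (hb _ ⟨t, ht, rfl⟩) ⟨t, ht, rfl⟩
  obtain ⟨s, hs, hmax⟩ := hex
  refine ⟨s, hcard s hs, fun x hx => ?_⟩
  by_contra hcon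
  simp only [mem_iUnion, exists_prop, not_exists, not_and] at hcon
  have hfar : ∀ y ∈ s, 2 * K * r ≤ q y x := fun y hy => not_lt.1 (hcon y hy)
  have hxs : x ∉ s := by
    intro hxs
    have := hfar x hxs
    rw [hq.self] at this
    have : 0 < K * r := by positivity
    nlinarith
  have hg : Good (insert x s) := by
    refine ⟨?_, ?_⟩
    · rw [Finset.coe_insert]; exact Set.insert_subset hx hs.1
    · intro y hy z hz hyz
      rw [Finset.mem_insert] at hy hz
      rcases hy with rfl | hy <;> rcases hz with rfl | hz
      · exact absurd rfl hyz
      · rw [hq.symm]; exact hfar z hz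
      · exact hfar y hy
      · exact hs.2 y hy z hz hyz
  have := hmax _ hg
  rw [Finset.card_insert_of_notMem hxs] at this
  omega

end Billingsley

end ModC

section ModC2
section Billingsley2
variable {A : Type*} [MeasurableSpace A]

lemma ev_Ioo {p : ℝ → Prop} (h : ∀ᶠ r in 𝓝[>] (0:ℝ), p r) :
    ∃ k : ℕ, ∀ r, 0 < r → r < 1 / ((k : ℝ) + 1) → p r := by
  rw [eventually_nhdsWithin_iff, Metric.eventually_nhds_iff] at h
  obtain ⟨ε, hε, h⟩ := h
  obtain ⟨k, hk⟩ := exists_nat_one_div_lt hε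
  refine ⟨k, fun r hr hr2 => h ?_ hr⟩
  rw [Real.dist_eq, sub_zero, abs_of_pos hr]
  exact hr2.trans hk

lemma mass_ge {ν : Measure A} [IsProbabilityMeasure ν] {f : ℝ → Set A} {D β : ℝ} (hβ : D < β)
    (h : Tendsto (fun r : ℝ => Real.log (ν (f r)).toReal / Real.log r) (𝓝[>] 0) (𝓝 D))
    (hpos : ∀ r, 0 < r → 0 < ν (f r)) :
    ∀ᶠ r in 𝓝[>] (0:ℝ), ENNReal.ofReal (r ^ β) ≤ ν (f r) := by
  have h1 : ∀ᶠ r in 𝓝[>] (0:ℝ), r < 1 :=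
    (nhdsWithin_le_nhds : 𝓝[>] (0:ℝ) ≤ 𝓝 0) (gt_mem_nhds one_pos)
  filter_upwards [h.eventually (gt_mem_nhds hβ), h1, self_mem_nhdsWithin] with r hr hr1 hr0
  have hr0 : 0 < r := hr0
  have hl : Real.log r < 0 := Real.log_neg hr0 hr1
  rw [div_lt_iff_of_neg hl] at hr
  rw [← ENNReal.ofReal_toReal (measure_ne_top ν (f r))]
  apply ENNReal.ofReal_le_ofReal
  have hp : 0 < (ν (f r)).toReal := ENNReal.toReal_pos (hpos r hr0).ne' (measure_ne_top _ _)
  rw [Real.rpow_def_of_pos hr0, ← Real.exp_log hp]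
  apply Real.exp_le_exp.2
  linarith

lemma mass_le {ν : Measure A} [IsProbabilityMeasure ν] {f : ℝ → Set A} {D β : ℝ} (hβ : β < D)
    (h : Tendsto (fun r : ℝ => Real.log (ν (f r)).toReal / Real.log r) (𝓝[>] 0) (𝓝 D)) :
    ∀ᶠ r in 𝓝[>] (0:ℝ), ν (f r) ≤ ENNReal.ofReal (r ^ β) := by
  have h1 : ∀ᶠ r in 𝓝[>] (0:ℝ), r < 1 :=
    (nhdsWithin_le_nhds : 𝓝[>] (0:ℝ) ≤ 𝓝 0) (gt_mem_nhds one_pos)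
  filter_upwards [h.eventually (lt_mem_nhds hβ), h1, self_mem_nhdsWithin] with r hr hr1 hr0
  have hr0 : 0 < r := hr0
  have hl : Real.log r < 0 := Real.log_neg hr0 hr1
  rw [lt_div_iff_of_neg hl] at hr
  rw [← ENNReal.ofReal_toReal (measure_ne_top ν (f r))]
  apply ENNReal.ofReal_le_ofReal
  rcases (ENNReal.toReal_nonneg (a := ν (f r))).eq_or_lt with h0 | hp
  · rw [← h0]; positivity
  · rw [Real.rpow_def_of_pos hr0, ← Real.exp_log hp]
    apply Real.exp_le_exp.2
    linarith

lemma exactDim_nonneg {q : A → A → ℝ} {ν : Measure A} [IsProbabilityMeasure ν] {D : ℝ}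
    (h : ExactDim q ν D) : 0 ≤ D := by
  obtain ⟨ξ, hξ⟩ := h.exists
  refine ge_of_tendsto hξ ?_
  have h1 : ∀ᶠ r in 𝓝[>] (0:ℝ), r < 1 :=
    (nhdsWithin_le_nhds : 𝓝[>] (0:ℝ) ≤ 𝓝 0) (gt_mem_nhds one_pos)
  filter_upwards [h1, self_mem_nhdsWithin] with r hr1 hr0
  have hr0 : 0 < r := hr0
  apply div_nonneg_of_nonpos
  · exact Real.log_nonpos ENNReal.toReal_nonneg (ENNReal.toReal_le_of_le_ofReal zero_le_one (by simpa using prob_le_one))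
  · exact (Real.log_neg hr0 hr1).le

lemma hMeasure_pos {q : A → A → ℝ}
    (ν : Measure A) [IsProbabilityMeasure ν] {D α : ℝ} (hα : 0 ≤ α) (hαD : α < D)
    (hex : ExactDim q ν D) {E : Set A} (hE : 0 < ν E) : 0 < qHMeasure q α E := by
  let Ek : ℕ → Set A := fun k => {x ∈ E | ∀ r, 0 < r → r < 1 / ((k : ℝ) + 1) →
    ν (qball q x r) ≤ ENNReal.ofReal (r ^ α)}
  obtain ⟨k, hk⟩ : ∃ k, 0 < ν (Ek k) := by
    by_contra hcon
    push Not at hcon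
    have h1 : ν (⋃ k, Ek k) = 0 := measure_iUnion_null fun k => le_antisymm (hcon k) bot_le
    have h2 : ν (E \ ⋃ k, Ek k) = 0 := by
      refine measure_mono_null ?_ hex
      rintro x ⟨hx, hx2⟩ hx3
      apply hx2
      obtain ⟨k, hk⟩ := ev_Ioo (mass_le hαD hx3)
      exact mem_iUnion.2 ⟨k, hx, hk⟩
    have h3 : ν E ≤ ν (⋃ k, Ek k) + ν (E \ ⋃ k, Ek k) :=
      (measure_mono (by intro x hx; by_cases h : x ∈ ⋃ k, Ek k; exact Or.inl h; exact Or.inr ⟨hx, h⟩)).trans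
        (measure_union_le _ _)
    rw [h1, h2, add_zero] at h3
    exact absurd h3 (not_le.2 hE)
  have hkpos : (0:ℝ) < 1 / ((k : ℝ) + 1) := by positivity
  set Δ : ℝ := 1 / ((k : ℝ) + 1) / 4 with hΔ
  have hΔ0 : 0 < Δ := by positivity
  have key : ν (Ek k) / ENNReal.ofReal (2 ^ α) ≤ qHContent q α Δ E := by
    unfold qHContent
    refine le_iInf fun c => le_iInf fun h1 => le_iInf fun h2 => ?_
    have h3 : ∀ i, ν (Ek k ∩ c i) ≤ ENNReal.ofReal (2 ^ α) * qdiam q (c i) ^ α := by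
      intro i
      rcases (Ek k ∩ c i).eq_empty_or_nonempty with he | ⟨x, hx1, hx2⟩
      · rw [he]; simp
      have hfin : qdiam q (c i) ≠ ∞ := ne_top_of_le_ne_top ENNReal.ofReal_ne_top (h2 i)
      set d := (qdiam q (c i)).toReal with hd
      have hdd : qdiam q (c i) = ENNReal.ofReal d := (ENNReal.ofReal_toReal hfin).symm
      have hd0 : 0 ≤ d := ENNReal.toReal_nonneg
      have hdΔ : d ≤ Δ := by
        have := h2 i
        rw [hdd] at this
        exact (ENNReal.ofReal_le_ofReal_iff hΔ0.le).1 this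
      have hsub : ∀ r, d < r → Ek k ∩ c i ⊆ qball q x r := by
        intro r hr y hy
        have := le_qdiam (q := q) hx2 hy.2
        rw [hdd, ENNReal.ofReal_le_ofReal_iff hd0] at this
        exact this.trans_lt hr
      have hb : ∀ r, d < r → r < 1 / ((k : ℝ) + 1) → ν (Ek k ∩ c i) ≤ ENNReal.ofReal (r ^ α) :=
        fun r hr hr2 => (measure_mono (hsub r hr)).trans (hx1.2 r (hd0.trans_lt hr) hr2)
      rw [hdd, ENNReal.ofReal_rpow_of_nonneg hd0 hα, ← ENNReal.ofReal_mul (by positivity),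
        ← Real.mul_rpow (by norm_num) hd0]
      have ht : Tendsto (fun r : ℝ => ENNReal.ofReal (r ^ α)) (𝓝[>] d) (𝓝 (ENNReal.ofReal (d ^ α))) := by
        apply ENNReal.tendsto_ofReal
        have : ContinuousAt (fun r : ℝ => r ^ α) d := by
          rcases hα.eq_or_lt with h0 | h0
          · rw [← h0]; simp only [Real.rpow_zero]; exact continuousAt_const
          · exact Real.continuousAt_rpow_const _ _ (Or.inr h0.le)
        exact this.tendsto.mono_left nhdsWithin_le_nhds
      have hle : ν (Ek k ∩ c i) ≤ ENNReal.ofReal (d ^ α) := by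
        refine ge_of_tendsto ht ?_
        have : d < 1 / ((k : ℝ) + 1) := by linarith
        filter_upwards [Ioo_mem_nhdsGT this] with r hr
        exact hb r hr.1 hr.2
      refine hle.trans (ENNReal.ofReal_le_ofReal (Real.rpow_le_rpow hd0 (by linarith) hα))
    have h4 : ν (Ek k) ≤ ENNReal.ofReal (2 ^ α) * ∑' i, qdiam q (c i) ^ α := by
      calc ν (Ek k) ≤ ν (⋃ i, Ek k ∩ c i) := by
            apply measure_mono
            rw [← inter_iUnion]
            exact fun x hx => ⟨hx, h1 hx.1⟩
        _ ≤ ∑' i, ν (Ek k ∩ c i) := measure_iUnion_le _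
        _ ≤ ∑' i, ENNReal.ofReal (2 ^ α) * qdiam q (c i) ^ α := ENNReal.tsum_le_tsum h3
        _ = _ := ENNReal.tsum_mul_left
    exact ENNReal.div_le_of_le_mul' h4
  refine lt_of_lt_of_le ?_ (le_iSup₂_of_le (f := fun Δ (_ : 0 < Δ) => qHContent q α Δ E) Δ hΔ0 key)
  exact ENNReal.div_pos hk.ne' ENNReal.ofReal_ne_top

lemma hMeasure_zero {q : A → A → ℝ} {K : ℝ} (hq : IsQuasi q K)
    (hm : ∀ x r, MeasurableSet (qball q x r)) (ν : Measure A) [IsProbabilityMeasure ν]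
    {D α : ℝ} (hD : 0 ≤ D) (hα : D < α) {E : Set A}
    (hE : ∀ x ∈ E, Tendsto (fun r : ℝ => Real.log (ν (qball q x r)).toReal / Real.log r)
      (𝓝[>] 0) (𝓝 D) ∧ ∀ r, 0 < r → 0 < ν (qball q x r)) : qHMeasure q α E = 0 := by
  obtain ⟨β, hβ1, hβ2⟩ := exists_between hα
  apply qHMeasure_eq_zero
  intro Δ hΔ
  let Ek : ℕ → Set A := fun k => {x ∈ E | ∀ r, 0 < r → r < 1 / ((k : ℝ) + 1) →
    ENNReal.ofReal (r ^ β) ≤ ν (qball q x r)}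
  have hK := hq.one_le
  have h1 : ∀ k, qHContent q α Δ (Ek k) = 0 := by
    intro k
    refine content_zero_of_covers (a := β) (B := 1) (K := K * (4 * K)) (by positivity) zero_le_one
      (by linarith) hβ2 hΔ ?_
    have hkpos : (0:ℝ) < 1 / ((k : ℝ) + 1) := by positivity
    filter_upwards [Ioo_mem_nhdsGT hkpos] with r hr
    obtain ⟨s, hs1, hs2⟩ := cover_of_mass hq hm ν (E := Ek k) hr.1
      (Real.rpow_pos_of_pos hr.1 β) (fun x hx => hx.2 r hr.1 hr.2)
    refine ⟨s.image fun i => qball q i (2 * K * r), by simpa using hs2, ?_, ?_⟩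
    · intro c hc
      obtain ⟨i, -, rfl⟩ := Finset.mem_image.1 hc
      apply qdiam_le
      intro x hx y hy
      have := hq.quasi x i y (2 * K * r) (by rw [hq.symm]; exact hx) hy
      have h0 := hr.1
      have : 0 ≤ K * K * r := by positivity
      nlinarith
    · rw [one_mul, Real.rpow_neg hr.1.le]
      exact (Nat.cast_le.2 Finset.card_image_le).trans hs1
  have h2 : E ⊆ ⋃ k, Ek k := by
    intro x hx
    obtain ⟨k, hk⟩ := ev_Ioo (mass_ge hβ1 (hE x hx).1 (hE x hx).2)
    exact mem_iUnion.2 ⟨k, hx, hk⟩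
  refine le_antisymm ?_ bot_le
  refine ENNReal.le_of_forall_pos_le_add fun ε hε _ => ?_
  obtain ⟨a, ha, hsum⟩ := ENNReal.exists_pos_sum_of_countable (ε := (ε : ℝ≥0∞)) (by exact_mod_cast hε.ne') ℕ
  refine (content_mono h2).trans ((content_iUnion_le Ek (fun k => (a k : ℝ≥0∞)) fun k => ?_).trans ?_)
  · rw [h1 k]; exact_mod_cast ha k
  · simpa using hsum.le

/-- Exact dimensionality implies the existence of the Hausdorff dimension. -/
lemma hasDim_of_exactDim {q : A → A → ℝ} {K : ℝ} (hq : IsQuasi q K)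
    (hm : ∀ x r, MeasurableSet (qball q x r)) (ν : Measure A) [IsProbabilityMeasure ν]
    {D : ℝ} (hex : ExactDim q ν D)
    (hpos : ∀ᵐ x ∂ν, ∀ r, 0 < r → 0 < ν (qball q x r))
    {a B : ℝ} (hB : 0 ≤ B)
    (hcov : ∀ᶠ r in 𝓝[>] (0:ℝ), ∃ (s : Finset (Set A)), Set.univ ⊆ (⋃ i ∈ s, i) ∧
      (∀ i ∈ s, qdiam q i ≤ ENNReal.ofReal (1 * r)) ∧ (s.card : ℝ) ≤ B * r ^ (-a)) :
    HasDim q ν D := by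
  have hD := exactDim_nonneg hex
  have hbdd : ∀ E : Set A, BddAbove {α : ℝ | 0 ≤ α ∧ 0 < qHMeasure q α E} := by
    intro E
    refine ⟨max a 0, fun α hα => ?_⟩
    by_contra hcon
    push Not at hcon
    refine hα.2.ne' (qHMeasure_eq_zero fun Δ hΔ => ?_)
    refine le_antisymm ?_ bot_le
    refine (content_mono (subset_univ E)).trans_eq ?_
    exact content_zero_of_covers zero_le_one hB ((le_max_right _ _).trans_lt hcon)
      ((le_max_left _ _).trans_lt hcon) hΔ hcov
  have hlow : ∀ E : Set A, 0 < ν E → D ≤ qdimSet q E := by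
    intro E hE
    refine le_of_forall_lt_imp_le_of_dense fun α hα => ?_
    rcases lt_or_ge α 0 with h0 | h0
    · exact h0.le.trans (Real.sSup_nonneg fun x hx => hx.1)
    · exact le_csSup (hbdd E) ⟨h0, hMeasure_pos ν h0 hα hex hE⟩
  obtain ⟨E, hEsub, hEm, hE0⟩ : ∃ E : Set A, E ⊆ {x | Tendsto (fun r : ℝ =>
      Real.log (ν (qball q x r)).toReal / Real.log r) (𝓝[>] 0) (𝓝 D) ∧
      ∀ r, 0 < r → 0 < ν (qball q x r)} ∧ MeasurableSet E ∧ ν Eᶜ = 0 := by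
    have h0 := ae_iff.1 (hex.and hpos)
    obtain ⟨t, ht, htm, ht0⟩ := exists_measurable_superset_of_null h0
    refine ⟨tᶜ, ?_, htm.compl, by rwa [compl_compl]⟩
    intro x hx
    by_contra hcon
    exact hx (ht hcon)
  have hEpos : 0 < ν E := by
    have : ν E = 1 := by rw [prob_compl_eq_zero_iff hEm] at hE0; exact hE0
    rw [this]; exact one_pos
  have hup : qdimSet q E = D := by
    refine le_antisymm ?_ (hlow E hEpos)
    refine Real.sSup_le (fun α hα => ?_) hD
    by_contra hcon
    push Not at hcon
    exact hα.2.ne' (hMeasure_zero hq hm ν hD hcon hEsub)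
  constructor
  · refine le_antisymm (csInf_le ⟨D, ?_⟩ ⟨E, hEm, hE0, hup.symm⟩) (le_csInf ⟨D, E, hEm, hE0, hup.symm⟩ ?_)
    all_goals
      rintro d ⟨F, hF, hF0, rfl⟩
      apply hlow
      rw [(prob_compl_eq_zero_iff hF).1 hF0]; exact one_pos
  · refine le_antisymm (csInf_le ⟨D, ?_⟩ ⟨E, hEm, hEpos, hup.symm⟩)
      (le_csInf ⟨D, E, hEm, hEpos, hup.symm⟩ ?_)
    all_goals
      rintro d ⟨F, hF, hF0, rfl⟩
      exact hlow F hF0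

end Billingsley2

end ModC2

section ModD1
section Pair
variable {G : Type*} [Group G] [MetricSpace G]

lemma qbb_quasi {δ : ℝ} (hδ : 0 ≤ δ) (hX : IsHyperbolicWith G δ) :
    IsQuasi (qbb (1 : G) (1 : G)) (Real.exp δ) where
  one_le := Real.one_le_exp hδ
  nonneg x y := (qB_nonneg _ _ _).trans (le_max_left _ _)
  self x := by simp [qbb, qB_self]
  symm x y := by simp only [qbb]; rw [qB_comm hX x.1, qB_comm hX x.2]
  quasi x y z r h1 h2 := by
    simp only [qbb, max_lt_iff] at h1 h2
    exact max_le (qB_quasi hX h1.1 h2.1) (qB_quasi hX h1.2 h2.2)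

lemma qball_qbb (x : Boundary G (1 : G) × Boundary G (1 : G)) (r : ℝ) :
    qball (qbb (1 : G) (1 : G)) x r = qball (qB 1) x.1 r ×ˢ qball (qB 1) x.2 r := by
  ext y
  simp [qball, qbb]

lemma meas_qball (x : Boundary G (1 : G)) (r : ℝ) : MeasurableSet (qball (qB 1) x r) :=
  MeasurableSpace.measurableSet_generateFrom ⟨x, r, rfl⟩

lemma meas_qball_qbb (x : Boundary G (1 : G) × Boundary G (1 : G)) (r : ℝ) :
    MeasurableSet (qball (qbb (1 : G) (1 : G)) x r) := by
  rw [qball_qbb]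
  exact (meas_qball _ _).prod (meas_qball _ _)

/-- polynomial covers of the product of the boundaries -/
lemma cover_pair (hG : IsHypGroupMetric G) :
    ∃ a B : ℝ, 0 ≤ B ∧ ∀ᶠ r in 𝓝[>] (0:ℝ),
      ∃ (s : Finset (Set (Boundary G (1 : G) × Boundary G (1 : G)))),
      Set.univ ⊆ (⋃ i ∈ s, i) ∧
      (∀ i ∈ s, qdiam (qbb (1 : G) (1 : G)) i ≤ ENNReal.ofReal (1 * r)) ∧
      (s.card : ℝ) ≤ B * r ^ (-a) := by
  obtain ⟨c, hc, hcov⟩ := cover_Sh hG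
  obtain ⟨hinv, ⟨δ, hδ, hX⟩, -⟩ := hG
  refine ⟨2 * c, (c * Real.exp (c * (2 * δ))) ^ 2, by positivity, ?_⟩
  filter_upwards [Ioo_mem_nhdsGT (zero_lt_one' ℝ)] with r hr
  set t := -Real.log r + 2 * δ with ht
  have hlr : Real.log r < 0 := Real.log_neg hr.1 hr.2
  obtain ⟨F, hF, hFc⟩ := hcov t (by linarith)
  refine ⟨(F ×ˢ F).image fun g => Sh 1 g.1 t ×ˢ Sh 1 g.2 t, ?_, ?_, ?_⟩
  · rintro ⟨x, y⟩ -
    obtain ⟨g, hg, hx⟩ := hFc x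
    obtain ⟨g', hg', hy⟩ := hFc y
    refine mem_iUnion₂.2 ⟨_, Finset.mem_image.2 ⟨(g, g'), Finset.mem_product.2 ⟨hg, hg'⟩, rfl⟩, hx, hy⟩
  · intro c hc
    obtain ⟨g, -, rfl⟩ := Finset.mem_image.1 hc
    apply qdiam_le
    rintro x hx y hy
    have e : 1 * r = Real.exp (-(t - 2 * δ)) := by
      rw [ht, one_mul]; simp [Real.exp_log hr.1]
    rw [e]
    exact max_le (qB_of_Sh hX hx.1 hy.1) (qB_of_Sh hX hx.2 hy.2)
  · have h1 : (((F ×ˢ F).image fun g => Sh (1:G) g.1 t ×ˢ Sh (1:G) g.2 t).card : ℝ) ≤ (F.card : ℝ) * F.card := by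
      rw [← Nat.cast_mul, ← Finset.card_product]
      exact Nat.cast_le.2 Finset.card_image_le
    refine h1.trans ?_
    calc (F.card : ℝ) * F.card ≤ (c * Real.exp (c * t)) * (c * Real.exp (c * t)) := by gcongr
      _ = _ := by
        rw [Real.rpow_def_of_pos hr.1, ht, mul_pow, ← Real.exp_nat_mul]
        have : Real.exp (c * (-Real.log r + 2 * δ)) * Real.exp (c * (-Real.log r + 2 * δ)) =
          Real.exp ((2:ℕ) * (c * (2 * δ))) * Real.exp (Real.log r * -(2 * c)) := by
          rw [← Real.exp_add, ← Real.exp_add]; congr 1; push_cast; ring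
        linear_combination c ^ 2 * this

/-- A countable family of measurable sets separating the points of the boundary. -/
lemma separating (hG : IsHypGroupMetric G) : ∃ U : ℕ → Set (Boundary G (1 : G)),
    (∀ n, MeasurableSet (U n)) ∧ ∀ x y, (∀ n, x ∈ U n ↔ y ∈ U n) → x = y := by
  obtain ⟨c, hc, hcov⟩ := cover_Sh hG
  obtain ⟨hinv, ⟨δ, hδ, hX⟩, -⟩ := hG
  choose F hF hFc using fun n : ℕ => hcov n (Nat.cast_nonneg n)
  let rr : ℕ → ℝ := fun n => Real.exp (-((n : ℝ) - 2 * δ - 1))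
  let T : Set (Set (Boundary G (1 : G))) := ⋃ n : ℕ, ⋃ g ∈ F n,
    {u | ∃ h : (Sh (1:G) g n).Nonempty, u = qball (qB 1) h.some (rr n)}
  have hTc : T.Countable := by
    refine countable_iUnion fun n => (F n).countable_toSet.biUnion fun g _ => ?_
    refine Set.Subsingleton.countable ?_
    rintro u ⟨h, rfl⟩ v ⟨h', rfl⟩
    rfl
  have hTm : ∀ u ∈ T, MeasurableSet u := by
    intro u hu
    obtain ⟨n, hu⟩ := mem_iUnion.1 hu
    obtain ⟨g, hg, h, rfl⟩ := mem_iUnion₂.1 hu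
    exact meas_qball _ _
  have hsep : ∀ x y, (∀ u ∈ T, x ∈ u ↔ y ∈ u) → x = y := by
    intro x y h
    by_contra hne
    have hpos := qB_pos (o := (1:G)) hne
    have hlim : Tendsto (fun n : ℕ => Real.exp δ * rr n) atTop (𝓝 0) := by
      have h1 : Tendsto (fun n : ℕ => -((n : ℝ) - 2 * δ - 1)) atTop atBot := by
        apply Filter.tendsto_neg_atTop_atBot.comp
        exact tendsto_atTop_add_const_right _ _ (tendsto_atTop_add_const_right _ _ tendsto_natCast_atTop_atTop)
      have h2 := (Real.tendsto_exp_atBot.comp h1).const_mul (Real.exp δ)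
      rw [mul_zero] at h2
      exact h2
    obtain ⟨n, hn⟩ := (hlim.eventually (gt_mem_nhds hpos)).exists
    obtain ⟨g, hg, hx⟩ := hFc n x
    have hne' : (Sh (1:G) g n).Nonempty := ⟨x, hx⟩
    have hxb : qB 1 hne'.some x < rr n := by
      refine (qB_of_Sh hX hne'.some_mem hx).trans_lt ?_
      apply Real.exp_lt_exp.2; linarith
    have hyb : qB 1 hne'.some y < rr n := (h (qball (qB 1) hne'.some (rr n))
      (mem_iUnion.2 ⟨n, mem_iUnion₂.2 ⟨g, hg, hne', rfl⟩⟩)).1 hxb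
    have := qB_quasi hX (by rw [qB_comm hX]; exact hxb) hyb
    linarith
  by_cases hTe : T.Nonempty
  · obtain ⟨U, hU⟩ := hTc.exists_eq_range hTe
    refine ⟨U, fun n => hTm _ (hU ▸ mem_range_self n), fun x y h => hsep x y fun u hu => ?_⟩
    rw [hU] at hu
    obtain ⟨n, rfl⟩ := hu
    exact h n
  · refine ⟨fun _ => ∅, fun _ => MeasurableSet.empty, fun x y _ => hsep x y fun u hu => ?_⟩
    exact absurd ⟨u, hu⟩ hTe

lemma meas_graph (hG : IsHypGroupMetric G) :
    MeasurableSet {z : (Boundary G (1 : G) × Boundary G (1 : G)) × (Boundary G (1 : G) × Boundary G (1 : G)) |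
      z.1 = z.2} := by
  obtain ⟨U, hU, hs⟩ := separating hG
  have : {z : (Boundary G (1 : G) × Boundary G (1 : G)) × (Boundary G (1 : G) × Boundary G (1 : G)) |
      z.1 = z.2} = ⋂ n, {z | (z.1.1 ∈ U n ↔ z.2.1 ∈ U n) ∧ (z.1.2 ∈ U n ↔ z.2.2 ∈ U n)} := by
    ext ⟨⟨a, b⟩, ⟨c, d⟩⟩
    simp only [mem_ofPred_eq, mem_iInter, Prod.mk.injEq]
    constructor
    · rintro ⟨rfl, rfl⟩ n; simp
    · intro h
      exact ⟨hs _ _ fun n => (h n).1, hs _ _ fun n => (h n).2⟩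
  rw [this]
  refine MeasurableSet.iInter fun n => ?_
  have m1 : MeasurableSet {z : (Boundary G (1 : G) × Boundary G (1 : G)) ×
      (Boundary G (1 : G) × Boundary G (1 : G)) | z.1.1 ∈ U n} := (measurable_fst.fst) (hU n)
  have m2 : MeasurableSet {z : (Boundary G (1 : G) × Boundary G (1 : G)) ×
      (Boundary G (1 : G) × Boundary G (1 : G)) | z.2.1 ∈ U n} := (measurable_snd.fst) (hU n)
  have m3 : MeasurableSet {z : (Boundary G (1 : G) × Boundary G (1 : G)) ×
      (Boundary G (1 : G) × Boundary G (1 : G)) | z.1.2 ∈ U n} := (measurable_fst.snd) (hU n)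
  have m4 : MeasurableSet {z : (Boundary G (1 : G) × Boundary G (1 : G)) ×
      (Boundary G (1 : G) × Boundary G (1 : G)) | z.2.2 ∈ U n} := (measurable_snd.snd) (hU n)
  exact (m1.iff m2).inter (m3.iff m4)

end Pair

end ModD1

section ModE1
set_option linter.unusedSectionVars false

lemma tendsto_affine_div (a b : ℝ) : Tendsto (fun s : ℝ => (a * s + b) / s) atTop (𝓝 a) := by
  have h1 : Tendsto (fun s : ℝ => a + b * s⁻¹) atTop (𝓝 (a + b * 0)) :=
    tendsto_const_nhds.add (tendsto_inv_atTop_zero.const_mul b)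
  rw [mul_zero, add_zero] at h1
  refine h1.congr' ?_
  filter_upwards [eventually_gt_atTop 0] with s hs
  field_simp

lemma interp {φ : ℝ → ℝ} (hφ : Monotone φ) {l D C' : ℝ} (hl : 0 < l) (hD : 0 ≤ D) (hC' : 0 ≤ C')
    (h : ∀ ε, 0 < ε → ε < l → ∃ lam C, |lam - l| ≤ ε ∧ ∀ᶠ n : ℕ in atTop,
      φ (lam * n - C) ≤ n * (D + C' * ε) + C ∧ n * (D - C' * ε) - C ≤ φ (lam * n + C)) :
    Tendsto (fun s => φ s / s) atTop (𝓝 (D / l)) := by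
  have hεl : ∀ᶠ ε in 𝓝[>] (0:ℝ), 0 < ε ∧ ε < l :=
    (Ioo_mem_nhdsGT hl)
  rw [tendsto_order]
  constructor
  · intro a ha
    have c1 : Tendsto (fun ε : ℝ => (D - C' * ε) / (l + ε)) (𝓝[>] 0) (𝓝 (D / l)) := by
      have : ContinuousAt (fun ε : ℝ => (D - C' * ε) / (l + ε)) 0 := by
        apply ContinuousAt.div <;> first | fun_prop | (simp; exact hl.ne')
      have := this.tendsto.mono_left (nhdsWithin_le_nhds (s := Ioi 0)); simpa using this
    have c2 : Tendsto (fun ε : ℝ => (D - C' * ε) / (l - ε)) (𝓝[>] 0) (𝓝 (D / l)) := by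
      have : ContinuousAt (fun ε : ℝ => (D - C' * ε) / (l - ε)) 0 := by
        apply ContinuousAt.div <;> first | fun_prop | (simp; exact hl.ne')
      have := this.tendsto.mono_left (nhdsWithin_le_nhds (s := Ioi 0)); simpa using this
    obtain ⟨ε, ⟨hε0, hεl⟩, h1, h2⟩ :=
      (hεl.and ((c1.eventually (lt_mem_nhds ha)).and (c2.eventually (lt_mem_nhds ha)))).exists
    obtain ⟨lam, C, hlam, hn⟩ := h ε hε0 hεl
    rw [abs_le] at hlam
    have hlam0 : 0 < lam := by linarith
    have hlim : a < (D - C' * ε) / lam := by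
      rw [lt_div_iff₀ (by linarith)] at h1 h2
      rw [lt_div_iff₀ hlam0]
      rcases le_or_gt 0 a with h0 | h0
      · nlinarith
      · nlinarith
    have t1 := tendsto_affine_div ((D - C' * ε) / lam) (-(C / lam) * (D - C' * ε) - D - C)
    obtain ⟨N, hN⟩ := eventually_atTop.1 hn
    filter_upwards [t1.eventually (lt_mem_nhds hlim), eventually_gt_atTop 0,
      eventually_ge_atTop (C + lam * (N + 1))] with s h1 hs0 hs
    refine h1.trans_le ?_
    rw [div_le_div_iff_of_pos_right hs0]
    set x := (s - C) / lam with hx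
    have hxN : (N : ℝ) + 1 ≤ x := by rw [hx, le_div_iff₀ hlam0]; linarith
    have hx0 : 0 ≤ x := by have : (0:ℝ) ≤ N := by positivity
                           linarith
    have e1 : (⌊x⌋₊ : ℝ) ≤ x := Nat.floor_le hx0
    have e2 : x < ⌊x⌋₊ + 1 := Nat.lt_floor_add_one x
    have e3 : N ≤ ⌊x⌋₊ := Nat.le_floor (by linarith)
    have e4 := (hN _ e3).2
    have e5 : lam * ⌊x⌋₊ + C ≤ s := by
      have : lam * ⌊x⌋₊ ≤ lam * x := by gcongr
      have e : lam * x = s - C := by rw [hx]; field_simp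
      linarith
    have e6 := hφ e5
    have e7 : (D - C' * ε) / lam * s + (-(C / lam) * (D - C' * ε) - D - C) =
        x * (D - C' * ε) - D - C := by rw [hx]; ring
    rw [e7]
    have : 0 ≤ C' * ε := by positivity
    nlinarith
  · intro a ha
    have c2 : Tendsto (fun ε : ℝ => (D + C' * ε) / (l - ε)) (𝓝[>] 0) (𝓝 (D / l)) := by
      have : ContinuousAt (fun ε : ℝ => (D + C' * ε) / (l - ε)) 0 := by
        apply ContinuousAt.div <;> first | fun_prop | (simp; exact hl.ne')
      have := this.tendsto.mono_left (nhdsWithin_le_nhds (s := Ioi 0)); simpa using this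
    obtain ⟨ε, ⟨hε0, hεl⟩, h2⟩ := (hεl.and (c2.eventually (gt_mem_nhds ha))).exists
    obtain ⟨lam, C, hlam, hn⟩ := h ε hε0 hεl
    rw [abs_le] at hlam
    have hlam0 : 0 < lam := by linarith
    have hp : 0 ≤ D + C' * ε := by positivity
    have hlim : (D + C' * ε) / lam < a := by
      refine lt_of_le_of_lt ?_ h2
      apply div_le_div_of_nonneg_left hp <;> linarith
    have t1 := tendsto_affine_div ((D + C' * ε) / lam) ((C / lam + 1) * (D + C' * ε) + C)
    obtain ⟨N, hN⟩ := eventually_atTop.1 hn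
    filter_upwards [t1.eventually (gt_mem_nhds hlim), eventually_gt_atTop 0,
      eventually_ge_atTop (-C + lam * (N + 1))] with s h1 hs0 hs
    refine lt_of_le_of_lt ?_ h1
    rw [div_le_div_iff_of_pos_right hs0]
    set x := (s + C) / lam with hx
    have hxN : (N : ℝ) + 1 ≤ x := by rw [hx, le_div_iff₀ hlam0]; linarith
    have hx0 : 0 ≤ x := by have : (0:ℝ) ≤ N := by positivity
                           linarith
    have e1 : x ≤ (⌈x⌉₊ : ℝ) := Nat.le_ceil x
    have e2 : (⌈x⌉₊ : ℝ) < x + 1 := Nat.ceil_lt_add_one hx0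
    have e3 : N ≤ ⌈x⌉₊ := by
      have : (N : ℝ) ≤ ⌈x⌉₊ := by linarith
      exact_mod_cast this
    have e4 := (hN _ e3).1
    have e5 : s ≤ lam * ⌈x⌉₊ - C := by
      have : lam * x ≤ lam * ⌈x⌉₊ := by gcongr
      have e : lam * x = s + C := by rw [hx]; field_simp
      linarith
    have e6 := hφ e5
    have e7 : (D + C' * ε) / lam * s + ((C / lam + 1) * (D + C' * ε) + C) =
        (x + 1) * (D + C' * ε) + C := by rw [hx]; ring
    rw [e7]
    nlinarith

/-- log-mass profile -/
def phi {A : Type*} [MeasurableSpace A] (q : A → A → ℝ) (ν : Measure A) (x : A) (s : ℝ) : ℝ :=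
  -Real.log (ν (qball q x (Real.exp (-s)))).toReal

section
variable {A : Type*} [MeasurableSpace A] {q : A → A → ℝ} {ν : Measure A} [IsProbabilityMeasure ν]

lemma qball_mono {x : A} {r s : ℝ} (h : r ≤ s) : qball q x r ⊆ qball q x s :=
  fun _ hy => lt_of_lt_of_le hy h

lemma neg_log_anti {a b : ℝ≥0∞} (ha : 0 < a) (hab : a ≤ b) (hb : b ≤ 1) :
    -Real.log b.toReal ≤ -Real.log a.toReal := by
  have hbt : b ≠ ∞ := ne_top_of_le_ne_top ENNReal.one_ne_top hb
  have hat : a ≠ ∞ := ne_top_of_le_ne_top hbt hab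
  apply neg_le_neg
  apply Real.log_le_log (ENNReal.toReal_pos ha.ne' hat)
  exact ENNReal.toReal_mono hbt hab

lemma phi_mono {x : A} (hpos : ∀ r, 0 < r → 0 < ν (qball q x r)) : Monotone (phi q ν x) := by
  intro s t hst
  unfold phi
  refine neg_log_anti (hpos _ (Real.exp_pos _)) (measure_mono (qball_mono ?_)) prob_le_one
  apply Real.exp_le_exp.2; linarith

lemma tendsto_ratio_of_phi {x : A} {L : ℝ} (h : Tendsto (fun s => phi q ν x s / s) atTop (𝓝 L)) :
    Tendsto (fun r : ℝ => Real.log (ν (qball q x r)).toReal / Real.log r) (𝓝[>] 0) (𝓝 L) := by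
  have h1 : Tendsto (fun r : ℝ => -Real.log r) (𝓝[>] 0) atTop :=
    Filter.tendsto_neg_atBot_atTop.comp Real.tendsto_log_nhdsGT_zero
  refine (h.comp h1).congr' ?_
  filter_upwards [self_mem_nhdsWithin] with r hr
  have hr : 0 < r := hr
  simp only [Function.comp, phi, neg_neg, Real.exp_log hr, neg_div_neg_eq]

end

section Core
variable {G : Type*} [Group G] [MetricSpace G]

/-- measurable approximations of ball masses -/
lemma approx_mass (hG : IsHypGroupMetric G)
    (m : Measure (Boundary G (1 : G) × Boundary G (1 : G))) :
    ∃ C : ℝ, 0 ≤ C ∧ ∃ H : ℕ → Boundary G (1 : G) × Boundary G (1 : G) → ℝ≥0∞,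
      (∀ n, Measurable (H n)) ∧ ∀ (n : ℕ) x,
        m (qball (qbb 1 1) x (Real.exp (-((n:ℝ) + C)))) ≤ H n x ∧
        H n x ≤ m (qball (qbb 1 1) x (Real.exp (-((n:ℝ) - C)))) := by
  obtain ⟨c, hc, hcov⟩ := cover_Sh hG
  obtain ⟨hinv, ⟨δ, hδ, hX⟩, -⟩ := hG
  have hq := qbb_quasi hδ hX
  choose F hF hFc using fun n : ℕ => hcov n (Nat.cast_nonneg n)
  let S : ℕ → G × G → Set (Boundary G (1 : G) × Boundary G (1 : G)) :=
    fun n g => Sh 1 g.1 n ×ˢ Sh 1 g.2 n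
  -- neighbourhoods of the shadows
  let rr : ℕ → ℝ := fun n => Real.exp (-((n : ℝ) - 4 * δ - 2))
  let U : ℕ → G × G → Set (Boundary G (1 : G) × Boundary G (1 : G)) :=
    fun n g => if h : (S n g).Nonempty then qball (qbb 1 1) h.some (rr n) else ∅
  have hUm : ∀ n g, MeasurableSet (U n g) := by
    intro n g
    by_cases h : (S n g).Nonempty
    · simp only [U, h, dif_pos]; exact meas_qball_qbb _ _
    · simp only [U, h]; exact MeasurableSet.empty
  refine ⟨5 * δ + 3, by positivity, fun n x => (F n ×ˢ F n).sup fun g =>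
    (U n g).indicator (fun _ => m (U n g)) x, ?_, ?_⟩
  · intro n
    have : (fun x => (F n ×ˢ F n).sup fun g => (U n g).indicator (fun _ => m (U n g)) x) =
        ((F n ×ˢ F n).sup fun g => (U n g).indicator (fun _ => m (U n g))) := by
      funext x; rw [Finset.sup_apply]
    show Measurable (fun x => (F n ×ˢ F n).sup fun g => (U n g).indicator (fun _ => m (U n g)) x)
    rw [this]
    exact Finset.sup_induction (p := fun f : Boundary G (1 : G) × Boundary G (1 : G) → ℝ≥0∞ =>
      Measurable f) measurable_const (fun _ h _ h' => h.sup h')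
      fun g _ => measurable_const.indicator (hUm n g)
  · intro n x
    constructor
    · obtain ⟨g, hg, hx⟩ := hFc n x.1
      obtain ⟨g', hg', hx'⟩ := hFc n x.2
      have hne : (S n (g, g')).Nonempty := ⟨x, hx, hx'⟩
      have hd : qbb 1 1 hne.some x < Real.exp (-((n : ℝ) - 2 * δ - 1)) := by
        refine lt_of_le_of_lt (max_le (qB_of_Sh hX hne.some_mem.1 hx)
          (qB_of_Sh hX hne.some_mem.2 hx')) ?_
        apply Real.exp_lt_exp.2; linarith
      have hU : U n (g, g') = qball (qbb 1 1) hne.some (rr n) := by simp only [U, hne, dif_pos]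
      have hxU : x ∈ U n (g, g') := by
        rw [hU]; refine hd.trans_le (Real.exp_le_exp.2 (by linarith))
      have hsub : qball (qbb 1 1) x (Real.exp (-(n + (5 * δ + 3)))) ⊆ U n (g, g') := by
        intro y hy
        rw [hU]
        have hy' : qbb 1 1 x y < Real.exp (-((n : ℝ) - 2 * δ - 1)) :=
          lt_of_lt_of_le hy (Real.exp_le_exp.2 (by linarith))
        have := hq.quasi _ _ _ _ hd hy'
        refine this.trans_lt ?_
        rw [← Real.exp_add]
        apply Real.exp_lt_exp.2; linarith
      refine (measure_mono hsub).trans ?_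
      have := Finset.le_sup (f := fun g => (U n g).indicator (fun _ => m (U n g)) x)
        (Finset.mem_product.2 ⟨hg, hg'⟩ : (g, g') ∈ F n ×ˢ F n)
      simpa [Set.indicator_of_mem hxU] using this
    · refine Finset.sup_le fun g _ => ?_
      by_cases hx : x ∈ U n g
      · rw [Set.indicator_of_mem hx]
        apply measure_mono
        intro y hy
        by_cases h : (S n g).Nonempty
        · simp only [U, h, dif_pos] at hx hy
          have := hq.quasi x h.some y _ (by rw [hq.symm]; exact hx) hy
          refine lt_of_le_of_lt this ?_
          rw [← Real.exp_add]
          apply Real.exp_lt_exp.2; linarith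
        · simp only [U, h] at hx; exact absurd hx (by simp)
      · rw [Set.indicator_of_notMem hx]; exact bot_le

/-- Transfer of exact dimensionality from the source. -/
lemma exactDim_map (hG : IsHypGroupMetric G) {Ω : Type*} [MeasurableSpace Ω] (M : Measure Ω)
    [IsProbabilityMeasure M] (b : Ω → Boundary G (1 : G) × Boundary G (1 : G)) (hb : Measurable b)
    {L : ℝ} (hL : 0 ≤ L)
    (h : ∀ᵐ ω ∂M, (∀ r, 0 < r → 0 < (M.map b) (qball (qbb 1 1) (b ω) r)) ∧
      Tendsto (fun s => phi (qbb 1 1) (M.map b) (b ω) s / s) atTop (𝓝 L)) :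
    ExactDim (qbb (1 : G) (1 : G)) (M.map b) L ∧
      ∀ᵐ x ∂(M.map b), ∀ r, 0 < r → 0 < (M.map b) (qball (qbb 1 1) x r) := by
  have hprob : IsProbabilityMeasure (M.map b) := Measure.isProbabilityMeasure_map hb.aemeasurable
  obtain ⟨C, hC, H, hHm, hH⟩ := approx_mass hG (M.map b)
  set m := M.map b with hm
  have hH1 : ∀ n x, H n x ≤ 1 := fun n x => (hH n x).2.trans prob_le_one
  -- the measurable event
  have hev : ∀ᵐ x ∂m, (∀ n, 0 < H n x) ∧
      Tendsto (fun n : ℕ => -Real.log (H n x).toReal / n) atTop (𝓝 L) := by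
    rw [hm, ae_map_iff hb.aemeasurable]
    · filter_upwards [h] with ω hω
      obtain ⟨hpos, hlim⟩ := hω
      have hHp : ∀ n, 0 < H n (b ω) := fun n => (hpos _ (Real.exp_pos _)).trans_le (hH n _).1
      refine ⟨hHp, ?_⟩
      have hsh : ∀ C : ℝ, Tendsto (fun n : ℕ => phi (qbb 1 1) m (b ω) (n + C) / n) atTop (𝓝 L) := by
        intro C
        have h1 : Tendsto (fun n : ℕ => (n : ℝ) + C) atTop atTop :=
          tendsto_atTop_add_const_right _ _ tendsto_natCast_atTop_atTop
        have h2 := (hlim.comp h1).mul ((tendsto_affine_div 1 C).comp tendsto_natCast_atTop_atTop)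
        rw [mul_one] at h2
        refine h2.congr' ?_
        filter_upwards [h1.eventually (eventually_gt_atTop 0), eventually_gt_atTop 0] with n hn hn0
        have : (0:ℝ) < n := by exact_mod_cast hn0
        simp only [Function.comp, one_mul]
        field_simp
      refine tendsto_of_tendsto_of_tendsto_of_le_of_le (hsh (-C)) (hsh C) ?_ ?_
      · intro n
        dsimp only
        gcongr
        exact neg_log_anti (hHp n) (by simpa [sub_eq_add_neg] using (hH n (b ω)).2) prob_le_one
      · intro n
        dsimp only
        gcongr
        exact neg_log_anti (hpos _ (Real.exp_pos _)) (hH n (b ω)).1 (hH1 _ _)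
    · have m1 : MeasurableSet {x | ∀ n, 0 < H n x} := by
        rw [Set.ofPred_forall]
        exact MeasurableSet.iInter fun n => measurableSet_lt measurable_const (hHm n)
      have m2 : MeasurableSet {x | Tendsto (fun n : ℕ => -Real.log (H n x).toReal / n) atTop (𝓝 L)} :=
        measurableSet_tendsto (f := fun (n : ℕ) x => -Real.log (H n x).toReal / (n : ℝ)) (𝓝 L)
          fun n => ((Real.measurable_log.comp (hHm n).ennreal_toReal).neg.div_const _)
      exact m1.inter m2
  have hboth : ∀ᵐ x ∂m, (∀ r, 0 < r → 0 < m (qball (qbb 1 1) x r)) ∧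
      Tendsto (fun s => phi (qbb 1 1) m x s / s) atTop (𝓝 L) := by
    filter_upwards [hev] with x hx
    obtain ⟨hHp, hlim⟩ := hx
    have hpos : ∀ r, 0 < r → 0 < m (qball (qbb 1 1) x r) := by
      intro r hr
      obtain ⟨n, hn⟩ := exists_nat_gt (C - Real.log r)
      refine (hHp n).trans_le ((hH n x).2.trans (measure_mono (qball_mono ?_)))
      rw [← Real.le_log_iff_exp_le hr]
      linarith
    refine ⟨hpos, ?_⟩
    have := interp (phi_mono hpos) (l := 1) (D := L) (C' := 1) one_pos hL zero_le_one (by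
      intro ε hε _
      refine ⟨1, C, by simpa using hε.le, ?_⟩
      have h1 := hlim.eventually (gt_mem_nhds (show L < L + ε by linarith))
      have h2 := hlim.eventually (lt_mem_nhds (show L - ε < L by linarith))
      filter_upwards [h1, h2, eventually_gt_atTop 0] with n h1 h2 hn0
      have hn0 : (0:ℝ) < n := by exact_mod_cast hn0
      rw [div_lt_iff₀ hn0] at h1
      rw [lt_div_iff₀ hn0] at h2
      have e1 : phi (qbb 1 1) m x (n - C) ≤ -Real.log (H n x).toReal :=
        neg_log_anti (hHp n) (hH n x).2 prob_le_one
      have e2 : -Real.log (H n x).toReal ≤ phi (qbb 1 1) m x (n + C) :=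
        neg_log_anti (hpos _ (Real.exp_pos _)) (hH n x).1 (hH1 _ _)
      rw [one_mul, one_mul]
      constructor <;> nlinarith)
    rwa [div_one] at this
  exact ⟨hboth.mono fun x hx => tendsto_ratio_of_phi hx.2, hboth.mono fun x hx => hx.1⟩

end Core

end ModE1

section ModE2
set_option linter.unusedSectionVars false

lemma borel_cantelli_exp {Ω : Type*} [MeasurableSpace Ω] (M : Measure Ω) {B : ℕ → Set Ω} {ε : ℝ}
    (hε : 0 < ε) (h : ∀ n : ℕ, M (B n) ≤ ENNReal.ofReal (Real.exp (-(n * ε)))) :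
    ∀ᵐ ω ∂M, ∀ᶠ n in atTop, ω ∉ B n := by
  apply ae_eventually_notMem
  refine ne_top_of_le_ne_top ?_ (ENNReal.tsum_le_tsum h)
  have : Summable fun n : ℕ => Real.exp (-(n * ε)) := by
    have := Real.summable_exp_nat_mul_iff.2 (neg_lt_zero.2 hε)
    simpa [mul_neg] using this
  rw [← ENNReal.ofReal_tsum_of_nonneg (fun n => (Real.exp_pos _).le) this]
  exact ENNReal.ofReal_ne_top

section
variable {G : Type*} [Group G] [MetricSpace G]

lemma pairball (hG : IsHypGroupMetric G) : ∃ c : ℝ, 1 ≤ c ∧ ∀ R : ℝ, 0 ≤ R → ∀ g : G × G,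
    ∃ F : Finset (G × G), (F.card : ℝ) ≤ c * Real.exp (c * R) ∧
      ∀ h : G × G, dist g.1 h.1 ≤ R → dist g.2 h.2 ≤ R → h ∈ F := by
  obtain ⟨hinv, -, hqi⟩ := hG
  obtain ⟨c, hc, hgr⟩ := growth hqi
  refine ⟨2 * c ^ 2, by nlinarith, fun R hR g => ?_⟩
  obtain ⟨hfin, hcard⟩ := hgr R hR
  let F0 := hfin.toFinset
  have hF0 : (F0.card : ℝ) ≤ c * Real.exp (c * R) := by
    rwa [Set.ncard_eq_toFinset_card _ hfin] at hcard
  refine ⟨(F0.image (g.1 * ·)) ×ˢ (F0.image (g.2 * ·)), ?_, ?_⟩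
  · rw [Finset.card_product]
    push_cast
    have h1 : ((F0.image (g.1 * ·)).card : ℝ) ≤ c * Real.exp (c * R) :=
      le_trans (by exact_mod_cast Finset.card_image_le) hF0
    have h2 : ((F0.image (g.2 * ·)).card : ℝ) ≤ c * Real.exp (c * R) :=
      le_trans (by exact_mod_cast Finset.card_image_le) hF0
    calc _ ≤ (c * Real.exp (c * R)) * (c * Real.exp (c * R)) := by gcongr
      _ = c ^ 2 * Real.exp (c * R + c * R) := by rw [Real.exp_add]; ring
      _ ≤ 2 * c ^ 2 * Real.exp (2 * c ^ 2 * R) := by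
        gcongr
        · nlinarith
        · have : c * R ≤ c ^ 2 * R := by gcongr; nlinarith
          nlinarith
  · intro h h1 h2
    have key : ∀ x y : G, dist x y ≤ R → y ∈ F0.image (x * ·) := by
      intro x y hxy
      rw [Finset.mem_image]
      refine ⟨x⁻¹ * y, ?_, by simp⟩
      simp only [F0, Set.Finite.mem_toFinset, Set.mem_ofPred_eq]
      have := hinv x⁻¹ x y
      simp only [inv_mul_cancel] at this
      rw [this]; exact hxy
    exact Finset.mem_product.2 ⟨key _ _ h1, key _ _ h2⟩

/-- Good event for one coordinate. -/
def GoodAt {Ω : Type*} [MeasurableSpace Ω] (M : Measure Ω)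
    (b : Ω → Boundary G (1 : G) × Boundary G (1 : G)) (w : ℕ → Ω → G × G) (l D ε : ℝ) (n : ℕ)
    (ω : Ω) : Prop :=
  ((b ω).1 ∈ Sh 1 (w n ω).1 ((l - ε) * n) ∧ (b ω).2 ∈ Sh 1 (w n ω).2 ((l - ε) * n)) ∧
  (dist 1 (w n ω).1 ≤ (l + ε) * n ∧ dist 1 (w n ω).2 ≤ (l + ε) * n) ∧
  (ENNReal.ofReal (Real.exp (-(n * (D + ε)))) ≤ M {ω' | w n ω' = w n ω} ∧
    M {ω' | w n ω' = w n ω} ≤ ENNReal.ofReal (Real.exp (-(n * (D - ε)))))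

lemma measure_fiber_sum {Ω β : Type*} [MeasurableSpace Ω] [Countable β] (M : Measure Ω)
    (w : Ω → β) (hw : ∀ g, MeasurableSet {ω | w ω = g}) : ∑' g, M {ω | w ω = g} = M univ := by
  rw [← measure_iUnion]
  · congr 1; ext ω; simp
  · intro g h hgh
    rw [Function.onFun, Set.disjoint_left]
    intro ω h1 h2
    exact hgh (h1.symm.trans h2)
  · exact hw

lemma measure_le_fiber_sum {Ω β : Type*} [MeasurableSpace Ω] [Countable β] (M : Measure Ω)
    (w : Ω → β) (B : Set Ω) : M B ≤ ∑' g, M (B ∩ {ω | w ω = g}) := by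
  refine le_trans (measure_mono ?_) (measure_iUnion_le _)
  intro ω hω; simp [hω]

lemma core_step [Countable G] (hG : IsHypGroupMetric G) : ∃ C₀ c₀ : ℝ, 0 ≤ C₀ ∧ 0 ≤ c₀ ∧
    ∀ {Ω : Type*} [MeasurableSpace Ω] (M : Measure Ω)
    [IsProbabilityMeasure M] (b : Ω → Boundary G (1 : G) × Boundary G (1 : G)) (_ : Measurable b)
    (w : ℕ → Ω → G × G) (_ : ∀ n g, MeasurableSet {ω | w n ω = g}) (l D ε : ℝ) (_ : 0 < ε)
    (_ : ∀ᵐ ω ∂M, ∀ᶠ n in atTop, GoodAt M b w l D ε n ω),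
    ∀ᵐ ω ∂M, ∀ᶠ n : ℕ in atTop,
      ENNReal.ofReal (Real.exp (-(n * (D + 2 * ε)))) ≤
        (M.map b) (qball (qbb 1 1) (b ω) (Real.exp (-((l - ε) * n - C₀)))) ∧
      (M.map b) (qball (qbb 1 1) (b ω) (Real.exp (-((l - ε) * n - C₀)))) ≤
        ENNReal.ofReal (Real.exp (-(n * (D - c₀ * ε) - c₀))) := by
  obtain ⟨c, hc, hpb⟩ := pairball hG
  obtain ⟨hinv, ⟨δ, hδ, hX⟩, -⟩ := hG
  refine ⟨2 * δ + 1, 2 + 8 * c + 2 * c + 2 * c * (10 * δ + 2), by positivity, by positivity, ?_⟩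
  intro Ω _ M _ b hb w hw l D ε hε hgood
  set S : ℕ → Set Ω := fun n => {ω | GoodAt M b w l D ε n ω} with hS
  set r : ℕ → ℝ := fun n => Real.exp (-((l - ε) * n - (2 * δ + 1))) with hr
  set R : ℕ → ℝ := fun n => 4 * ε * n + (10 * δ + 2) with hR
  have hR0 : ∀ n, 0 ≤ R n := fun n => by simp only [hR]; positivity
  choose F hFc hF using fun n => hpb (R n) (hR0 n)
  set m := M.map b with hm
  have hmb : ∀ x ρ, m (qball (qbb 1 1) x ρ) = M (b ⁻¹' qball (qbb 1 1) x ρ) := fun x ρ =>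
    Measure.map_apply hb (meas_qball_qbb _ _)
  -- same fibre => close
  have hclose : ∀ n ω ω', ω ∈ S n → ω' ∈ S n → w n ω' = w n ω →
      b ω' ∈ qball (qbb 1 1) (b ω) (r n) := by
    intro n ω ω' h1 h2 he
    have h2' := h2.1
    rw [he] at h2'
    refine lt_of_le_of_lt (max_le (qB_of_Sh hX h1.1.1 h2'.1) (qB_of_Sh hX h1.1.2 h2'.2)) ?_
    apply Real.exp_lt_exp.2; linarith
  have hshad : ∀ n ω y, ω ∈ S n → y ∈ qball (qbb 1 1) (b ω) (r n) →
      y.1 ∈ Sh 1 (w n ω).1 ((l - ε) * n - (3 * δ + 1)) ∧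
      y.2 ∈ Sh 1 (w n ω).2 ((l - ε) * n - (3 * δ + 1)) := by
    intro n ω y h1 hy
    have hy : max _ _ < r n := hy
    rw [max_lt_iff] at hy
    constructor
    · refine Sh_mono ?_ (Sh_of_qB hX (Sh_mono ?_ h1.1.1) hy.1) <;> linarith
    · refine Sh_mono ?_ (Sh_of_qB hX (Sh_mono ?_ h1.1.2) hy.2) <;> linarith
  have hFmem : ∀ n ω ω' (y : Boundary G (1 : G) × Boundary G (1 : G)), ω ∈ S n → ω' ∈ S n →
      (y.1 ∈ Sh 1 (w n ω).1 ((l - ε) * n - (3 * δ + 1)) ∧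
      y.2 ∈ Sh 1 (w n ω).2 ((l - ε) * n - (3 * δ + 1))) →
      (y.1 ∈ Sh 1 (w n ω').1 ((l - ε) * n - (3 * δ + 1)) ∧
      y.2 ∈ Sh 1 (w n ω').2 ((l - ε) * n - (3 * δ + 1))) → w n ω' ∈ F n (w n ω) := by
    intro n ω ω' y h1 h2 hy hy'
    have g1 := gp_of_Sh hX hy.1 hy'.1
    have g2 := gp_of_Sh hX hy.2 hy'.2
    have d1 := dist_eq_gp (1 : G) (w n ω).1 (w n ω').1
    have d2 := dist_eq_gp (1 : G) (w n ω).2 (w n ω').2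
    have := h1.2.1; have := h2.2.1
    apply hF
    · simp only [hR]; rw [d1]; nlinarith
    · simp only [hR]; rw [d2]; nlinarith
  -- lower bound
  let B1 : ℕ → Set Ω := fun n => {ω | ω ∈ S n ∧ M (S n ∩ {ω' | w n ω' = w n ω}) <
    ENNReal.ofReal (Real.exp (-(n * ε))) * M {ω' | w n ω' = w n ω}}
  have hB1 : ∀ n, M (B1 n) ≤ ENNReal.ofReal (Real.exp (-(n * ε))) := by
    intro n
    refine (measure_le_fiber_sum M (w n) _).trans ?_
    have : ∀ g, M (B1 n ∩ {ω | w n ω = g}) ≤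
        ENNReal.ofReal (Real.exp (-(n * ε))) * M {ω' | w n ω' = g} := by
      intro g
      rcases Set.eq_empty_or_nonempty (B1 n ∩ {ω | w n ω = g}) with h | ⟨ω, ⟨hω, hlt⟩, he⟩
      · rw [h]; simp
      · have he : w n ω = g := he
        rw [he] at hlt
        refine le_trans (measure_mono ?_) hlt.le
        rintro ω' ⟨h1, h2⟩
        exact ⟨h1.1, h2⟩
    refine (ENNReal.tsum_le_tsum this).trans ?_
    rw [ENNReal.tsum_mul_left, measure_fiber_sum M (w n) (hw n), measure_univ, mul_one]
  -- upper bound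
  set N : ℕ → ℝ := fun n => c * Real.exp (c * R n) with hN
  have hN0 : ∀ n, 0 < N n := fun n => by simp only [hN]; positivity
  have hs : ∀ n ω, ω ∈ S n → M (S n ∩ b ⁻¹' qball (qbb 1 1) (b ω) (r n)) ≤
      ENNReal.ofReal (N n * Real.exp (-(n * (D - ε)))) := by
    intro n ω hω
    have hsub : S n ∩ b ⁻¹' qball (qbb 1 1) (b ω) (r n) ⊆
        ⋃ h ∈ F n (w n ω), (S n ∩ {ω' | w n ω' = h}) := by
      rintro ω' ⟨h1, h2⟩
      simp only [Set.mem_iUnion]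
      refine ⟨w n ω', ?_, h1, rfl⟩
      refine hFmem n ω ω' (b ω') hω h1 (hshad n ω _ hω h2) ⟨Sh_mono ?_ h1.1.1, Sh_mono ?_ h1.1.2⟩ <;>
        linarith
    refine (measure_mono hsub).trans ((measure_biUnion_finset_le _ _).trans ?_)
    have : ∀ h ∈ F n (w n ω), M (S n ∩ {ω' | w n ω' = h}) ≤
        ENNReal.ofReal (Real.exp (-(n * (D - ε)))) := by
      intro h _
      rcases Set.eq_empty_or_nonempty (S n ∩ {ω' | w n ω' = h}) with h' | ⟨ω', h1, h2⟩
      · rw [h']; simp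
      · have h2 : w n ω' = h := h2
        refine (measure_mono inter_subset_right).trans ?_
        rw [← h2]; exact h1.2.2.2
    refine (Finset.sum_le_sum this).trans ?_
    rw [Finset.sum_const, nsmul_eq_mul, ENNReal.ofReal_mul (hN0 n).le]
    gcongr
    rw [← ENNReal.ofReal_natCast]
    exact ENNReal.ofReal_le_ofReal (hFc n _)
  let B2 : ℕ → Set Ω := fun n => {ω | ω ∈ S n ∧ M (S n ∩ b ⁻¹' qball (qbb 1 1) (b ω) (r n)) <
    ENNReal.ofReal (Real.exp (-(n * ε)) / N n) * m (qball (qbb 1 1) (b ω) (r n))}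
  have hB2 : ∀ n, M (B2 n) ≤ ENNReal.ofReal (Real.exp (-(n * ε))) := by
    intro n
    refine (measure_le_fiber_sum M (w n) _).trans ?_
    let U : G × G → Set (Boundary G (1 : G) × Boundary G (1 : G)) := fun g =>
      if h : (B2 n ∩ {ω | w n ω = g}).Nonempty then qball (qbb 1 1) (b h.some) (r n) else ∅
    have hU : ∀ g (h : (B2 n ∩ {ω | w n ω = g}).Nonempty),
        U g = qball (qbb 1 1) (b h.some) (r n) := fun g h => by simp only [U, h, dif_pos]
    have hUm : ∀ g, MeasurableSet (U g) := by
      intro g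
      by_cases h : (B2 n ∩ {ω | w n ω = g}).Nonempty
      · rw [hU g h]; exact meas_qball_qbb _ _
      · simp only [U, h]; exact MeasurableSet.empty
    have h1 : ∀ g, M (B2 n ∩ {ω | w n ω = g}) ≤
        ENNReal.ofReal (Real.exp (-(n * ε)) / N n) * m (U g) := by
      intro g
      rcases Set.eq_empty_or_nonempty (B2 n ∩ {ω | w n ω = g}) with h | h
      · rw [h]; simp
      · rw [hU g h]
        have hω := h.some_mem
        refine le_trans (measure_mono ?_) hω.1.2.le
        rintro ω' ⟨h1, h2⟩
        exact ⟨h1.1, hclose n _ _ hω.1.1 h1.1 (h2.trans hω.2.symm)⟩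
    refine (ENNReal.tsum_le_tsum h1).trans ?_
    rw [ENNReal.tsum_mul_left]
    have h2 : ∑' g, m (U g) ≤ ENNReal.ofReal (N n) := by
      have e : ∀ g, m (U g) = ∫⁻ y, (U g).indicator 1 y ∂m := fun g =>
        (lintegral_indicator_one (hUm g)).symm
      simp_rw [e]
      rw [← lintegral_tsum fun g => (measurable_one.indicator (hUm g)).aemeasurable]
      have hmp : IsProbabilityMeasure m := Measure.isProbabilityMeasure_map hb.aemeasurable
      calc _ ≤ ∫⁻ _, ENNReal.ofReal (N n) ∂m := by
            apply lintegral_mono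
            intro y
            dsimp only
            by_cases hex : ∃ g, y ∈ U g
            · obtain ⟨g, hg⟩ := hex
              have hne : ∀ g, y ∈ U g → (B2 n ∩ {ω | w n ω = g}).Nonempty := by
                intro g hg
                by_contra h
                simp only [U, h, dite_false] at hg
                exact hg
              have hsupp : ∀ g', g' ∉ F n g → (U g').indicator (1 : Boundary G (1 : G) × Boundary G (1 : G) → ℝ≥0∞) y = 0 := by
                intro g' hg'
                apply Set.indicator_of_notMem
                intro hy'
                apply hg'
                have n1 := hne g hg
                have n2 := hne g' hy'
                rw [hU g n1] at hg
                rw [hU g' n2] at hy'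
                have := hFmem n n1.some n2.some y n1.some_mem.1.1 n2.some_mem.1.1
                  (hshad n _ _ n1.some_mem.1.1 hg) (hshad n _ _ n2.some_mem.1.1 hy')
                rwa [show w n n1.some = g from n1.some_mem.2,
                  show w n n2.some = g' from n2.some_mem.2] at this
              rw [tsum_eq_sum (s := F n g) fun g' hg' => hsupp g' hg']
              calc _ ≤ ∑ g' ∈ F n g, (1 : ℝ≥0∞) := by
                    apply Finset.sum_le_sum
                    intro g' _
                    exact Set.indicator_le_self' (fun _ _ => zero_le) y
                _ ≤ _ := by
                    rw [Finset.sum_const, nsmul_eq_mul, mul_one, ← ENNReal.ofReal_natCast]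
                    exact ENNReal.ofReal_le_ofReal (hFc n _)
            · push Not at hex
              rw [ENNReal.tsum_eq_zero.2]
              · exact zero_le
              · intro g; exact Set.indicator_of_notMem (hex g) _
        _ = _ := by simp
    refine (mul_le_mul_right h2 _).trans ?_
    rw [← ENNReal.ofReal_mul (by have := hN0 n; positivity)]
    rw [div_mul_cancel₀ _ (hN0 n).ne']
  filter_upwards [hgood, borel_cantelli_exp M hε hB1, borel_cantelli_exp M hε hB2] with ω h0 h1 h2
  filter_upwards [h0, h1, h2] with n h0 h1 h2
  constructor
  · have h1 : ENNReal.ofReal (Real.exp (-(n * ε))) * M {ω' | w n ω' = w n ω} ≤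
        M (S n ∩ {ω' | w n ω' = w n ω}) := by
      by_contra h; exact h1 ⟨h0, not_le.1 h⟩
    calc ENNReal.ofReal (Real.exp (-(n * (D + 2 * ε))))
        = ENNReal.ofReal (Real.exp (-(n * ε))) * ENNReal.ofReal (Real.exp (-(n * (D + ε)))) := by
          rw [← ENNReal.ofReal_mul (Real.exp_pos _).le, ← Real.exp_add]; ring_nf
      _ ≤ _ := mul_le_mul_right h0.2.2.1 _
      _ ≤ _ := h1
      _ ≤ _ := by
        rw [hmb]
        apply measure_mono
        rintro ω' ⟨h3, h4⟩
        exact hclose n ω ω' h0 h3 h4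
  · have h2 : ENNReal.ofReal (Real.exp (-(n * ε)) / N n) * m (qball (qbb 1 1) (b ω) (r n)) ≤
        M (S n ∩ b ⁻¹' qball (qbb 1 1) (b ω) (r n)) := by
      by_contra h; exact h2 ⟨h0, not_le.1 h⟩
    have h3 := h2.trans (hs n ω h0)
    have hx0 : 0 < Real.exp (-(n * ε)) / N n := div_pos (Real.exp_pos _) (hN0 n)
    rw [mul_comm, ← ENNReal.le_div_iff_mul_le (Or.inl (by simpa using hx0))
      (Or.inl ENNReal.ofReal_ne_top), ← ENNReal.ofReal_div_of_pos hx0] at h3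
    refine h3.trans (ENNReal.ofReal_le_ofReal ?_)
    have hcle : c ≤ Real.exp c := by linarith [Real.add_one_le_exp c]
    calc N n * Real.exp (-(n * (D - ε))) / (Real.exp (-(n * ε)) / N n)
        = c ^ 2 * Real.exp (c * R n + c * R n + -(n * (D - ε)) + n * ε) := by
          simp only [hN]
          rw [Real.exp_add, Real.exp_add, Real.exp_add, Real.exp_neg (n * ε)]
          field_simp
      _ ≤ (Real.exp c) ^ 2 * Real.exp (c * R n + c * R n + -(n * (D - ε)) + n * ε) := by gcongr
      _ = Real.exp (2 * c + (c * R n + c * R n + -(n * (D - ε)) + n * ε)) := by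
          rw [Real.exp_add (2 * c), ← Real.exp_nat_mul]; norm_num
      _ ≤ _ := by
          apply Real.exp_le_exp.2
          simp only [hR]
          have : 0 ≤ (n : ℝ) * ε := by positivity
          have e1 : 0 ≤ (2 * c + 2 * c * (10 * δ + 2)) * (n * ε) := by positivity
          nlinarith

lemma core [Countable G] (hG : IsHypGroupMetric G)
    {Ω : Type*} [MeasurableSpace Ω] (M : Measure Ω)
    [IsProbabilityMeasure M] (b : Ω → Boundary G (1 : G) × Boundary G (1 : G)) (hb : Measurable b)
    (w : ℕ → Ω → G × G) (hw : ∀ n g, MeasurableSet {ω | w n ω = g}) (l D : ℝ) (hl : 0 < l)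
    (hgood : ∀ ε, 0 < ε → ∀ᵐ ω ∂M, ∀ᶠ n in atTop, GoodAt M b w l D ε n ω) :
    0 ≤ D ∧ ExactDim (qbb (1 : G) (1 : G)) (M.map b) (D / l) ∧
      ∀ᵐ x ∂(M.map b), ∀ r, 0 < r → 0 < (M.map b) (qball (qbb 1 1) x r) := by
  have hD : 0 ≤ D := by
    refine le_of_forall_pos_le_add fun ε hε => ?_
    obtain ⟨ω, hω⟩ := (hgood ε hε).exists
    obtain ⟨n, hn, hn0⟩ := (hω.and (eventually_gt_atTop 0)).exists
    have h1 := hn.2.2.1.trans prob_le_one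
    rw [← ENNReal.ofReal_one, ENNReal.ofReal_le_ofReal_iff zero_le_one, Real.exp_le_one_iff] at h1
    have hn0 : (0:ℝ) < n := by exact_mod_cast hn0
    nlinarith
  refine ⟨hD, ?_⟩
  obtain ⟨C₀, c₀, hC₀, hc₀, hstep⟩ := core_step.{_, u_2} hG
  have hprob : IsProbabilityMeasure (M.map b) := Measure.isProbabilityMeasure_map hb.aemeasurable
  apply exactDim_map hG M b hb (div_nonneg hD hl.le)
  have hall := ae_all_iff.2 fun k : ℕ => hstep M b hb w hw l D (1 / (k + 1)) (by positivity)
    (hgood (1 / (k + 1)) (by positivity))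
  filter_upwards [hall] with ω hω
  have hpos : ∀ r, 0 < r → 0 < (M.map b) (qball (qbb 1 1) (b ω) r) := by
    intro r hr
    obtain ⟨k, hk⟩ := exists_nat_one_div_lt hl
    have hlk : 0 < l - 1 / (k + 1) := by linarith
    have : Tendsto (fun n : ℕ => (l - 1 / (k + 1)) * (n : ℝ)) atTop atTop :=
      tendsto_natCast_atTop_atTop.const_mul_atTop hlk
    obtain ⟨n, hn, hn'⟩ := ((hω k).and (this.eventually_ge_atTop (C₀ - Real.log r))).exists
    refine lt_of_lt_of_le ?_ (hn.1.trans (measure_mono (qball_mono ?_)))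
    · rw [ENNReal.ofReal_pos]; exact Real.exp_pos _
    · rw [← Real.le_log_iff_exp_le hr]; linarith
  refine ⟨hpos, ?_⟩
  have hmono := phi_mono hpos
  apply interp hmono hl hD (show 0 ≤ c₀ + 2 by positivity)
  intro ε hε hεl
  obtain ⟨k, hk⟩ := exists_nat_one_div_lt hε
  set ε' : ℝ := 1 / (k + 1) with hε'
  have hε'0 : 0 < ε' := by positivity
  refine ⟨l - ε', C₀ + c₀, by rw [show l - ε' - l = -ε' by ring, abs_neg, abs_of_pos hε'0]; exact hk.le, ?_⟩
  filter_upwards [hω k] with n hn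
  obtain ⟨h1, h2⟩ := hn
  rw [← hε'] at h1 h2
  have e1 : phi (qbb 1 1) (M.map b) (b ω) ((l - ε') * n - C₀) ≤ n * (D + 2 * ε') := by
    have := neg_log_anti (by rw [ENNReal.ofReal_pos]; exact Real.exp_pos _) h1 prob_le_one
    rw [ENNReal.toReal_ofReal (Real.exp_pos _).le, Real.log_exp, neg_neg] at this
    exact this
  have e2 : n * (D - c₀ * ε') - c₀ ≤ phi (qbb 1 1) (M.map b) (b ω) ((l - ε') * n - C₀) := by
    have h3 := ENNReal.toReal_mono ENNReal.ofReal_ne_top h2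
    rw [ENNReal.toReal_ofReal (Real.exp_pos _).le] at h3
    have h4 : 0 < ((M.map b) (qball (qbb 1 1) (b ω) (Real.exp (-((l - ε') * n - C₀))))).toReal :=
      ENNReal.toReal_pos (hpos _ (Real.exp_pos _)).ne' (measure_ne_top _ _)
    have := Real.log_le_log h4 h3
    rw [Real.log_exp] at this
    unfold phi
    linarith
  have hn0 : (0:ℝ) ≤ n := Nat.cast_nonneg n
  have hnε : n * ε' ≤ n * ε := by gcongr
  constructor
  · refine (hmono (show (l - ε') * n - (C₀ + c₀) ≤ (l - ε') * n - C₀ by linarith)).trans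
      (e1.trans ?_)
    have : 0 ≤ c₀ * (n * ε) := by positivity
    nlinarith
  · refine le_trans ?_ (e2.trans (hmono (show (l - ε') * n - C₀ ≤ (l - ε') * n + (C₀ + c₀) by linarith)))
    have h1 : c₀ * (n * ε') ≤ c₀ * (n * ε) := by gcongr
    have h2 : 0 ≤ n * ε := by positivity
    nlinarith
end

end ModE2

section ModF1
set_option linter.unusedSectionVars false

section RW
variable {H : Type*} [Group H] [Countable H] [MeasurableSpace H] [DiscreteMeasurableSpace H]
  {p : H → ℝ≥0∞} {P : Measure (ℕ → H)}

lemma meas_pcyl (n : ℕ) (g : ℕ → H) : MeasurableSet {ω : ℕ → H | ∀ i < n, ω i = g i} := by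
  have : {ω : ℕ → H | ∀ i < n, ω i = g i} = ⋂ i, ⋂ (_ : i < n), (fun ω => ω i) ⁻¹' {g i} := by
    ext ω; simp
  rw [this]
  exact MeasurableSet.iInter fun i => MeasurableSet.iInter fun _ =>
    measurable_pi_apply i (MeasurableSet.of_discrete)

lemma ext_pcyl {P Q : Measure (ℕ → H)} [IsFiniteMeasure P]
    (h : ∀ (n : ℕ) (g : ℕ → H), P {ω | ∀ i < n, ω i = g i} = Q {ω | ∀ i < n, ω i = g i}) :
    P = Q := by
  let S : Set (Set (ℕ → H)) := {s | ∃ (n : ℕ) (g : ℕ → H), s = {ω : ℕ → H | ∀ i < n, ω i = g i}}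
  have hgen : (MeasurableSpace.pi : MeasurableSpace (ℕ → H)) = MeasurableSpace.generateFrom S := by
    apply le_antisymm
    · refine iSup_le fun i => ?_
      rw [← measurable_iff_comap_le]
      have : ∀ g, MeasurableSet[MeasurableSpace.generateFrom S] ((fun ω : ℕ → H => ω i) ⁻¹' {g}) := by
        intro g
        have e : ((fun ω : ℕ → H => ω i) ⁻¹' {g}) = ⋃ y : Fin (i + 1) → H,
            ⋃ (_ : y (Fin.last i) = g), {ω : ℕ → H | ∀ j < i + 1, ω j = (fun k => if h : k < i + 1 then y ⟨k, h⟩ else 1) j} := by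
          ext ω
          simp only [Set.mem_preimage, Set.mem_singleton_iff, Set.mem_iUnion, Set.mem_ofPred_eq]
          constructor
          · intro h
            refine ⟨fun k => ω k, by simpa using h, fun j hj => by simp [hj]⟩
          · rintro ⟨y, hy, h⟩
            have := h i (by omega)
            rw [this]; simp only [lt_add_iff_pos_right, Nat.lt_one_iff, pos_of_gt, dite_true]
            exact hy
        rw [e]
        exact MeasurableSet.iUnion fun y => MeasurableSet.iUnion fun _ =>
          MeasurableSpace.measurableSet_generateFrom ⟨_, _, rfl⟩
      exact @measurable_to_countable' _ _ _ _ (MeasurableSpace.generateFrom S) _ this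
    · apply MeasurableSpace.generateFrom_le
      rintro s ⟨n, g, rfl⟩
      exact meas_pcyl n g
  have hpi : IsPiSystem S := by
    rintro s ⟨n, g, rfl⟩ t ⟨m, h, rfl⟩ hne
    obtain ⟨ω, h1, h2⟩ := hne
    refine ⟨max n m, ω, ?_⟩
    ext ω'
    simp only [Set.mem_inter_iff, Set.mem_ofPred_eq] at *
    constructor
    · rintro ⟨h3, h4⟩ i hi
      rcases lt_max_iff.1 hi with hi | hi
      · rw [h3 i hi, h1 i hi]
      · rw [h4 i hi, h2 i hi]
    · intro h3
      exact ⟨fun i hi => by rw [h3 i (lt_max_of_lt_left hi), h1 i hi],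
        fun i hi => by rw [h3 i (lt_max_of_lt_right hi), h2 i hi]⟩
  refine ext_of_generate_finite S hgen hpi ?_ (by simpa using h 0 (fun _ => 1))
  rintro s ⟨n, g, rfl⟩
  exact h n g

lemma rw_unique {Q : Measure (ℕ → H)} (hP : IsRWMeasure p P) (hQ : IsRWMeasure p Q) : P = Q := by
  have := hP.1
  exact ext_pcyl fun n g => by rw [hP.2, hQ.2]


/-- first `n` letters from `z.1`, then `z.2` -/
def cat (n : ℕ) (z : (ℕ → H) × (ℕ → H)) : ℕ → H := fun i => if i < n then z.1 i else z.2 (i - n)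

def shift (n : ℕ) (ω : ℕ → H) : ℕ → H := fun i => ω (i + n)

lemma meas_cat (n : ℕ) : Measurable (cat (H := H) n) := by
  refine measurable_pi_iff.2 fun i => ?_
  by_cases h : i < n
  · simp only [cat, h, if_true]; fun_prop
  · simp only [cat, h, if_false]; fun_prop

lemma meas_shift (n : ℕ) : Measurable (shift (H := H) n) :=
  measurable_pi_iff.2 fun i => measurable_pi_apply _

lemma shift_cat (n : ℕ) (z : (ℕ → H) × (ℕ → H)) : shift n (cat n z) = z.2 := by
  funext i; simp [shift, cat]

lemma cat_map (hP : IsRWMeasure p P) (n : ℕ) : (P.prod P).map (cat n) = P := by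
  have := hP.1
  refine rw_unique (p := p) ⟨Measure.isProbabilityMeasure_map (meas_cat n).aemeasurable, ?_⟩ hP
  intro N g
  rw [Measure.map_apply (meas_cat n) (meas_pcyl N g)]
  have : cat n ⁻¹' {ω : ℕ → H | ∀ i < N, ω i = g i} =
      {ω | ∀ i < min n N, ω i = g i} ×ˢ {ω | ∀ i < N - n, ω i = g (n + i)} := by
    ext ⟨ω', ω⟩
    simp only [Set.mem_preimage, Set.mem_ofPred_eq, Set.mem_prod, cat]
    constructor
    · intro h
      refine ⟨fun i hi => ?_, fun i hi => ?_⟩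
      · have := h i (by omega)
        rwa [if_pos (by omega)] at this
      · have := h (n + i) (by omega)
        rwa [if_neg (by omega), Nat.add_sub_cancel_left] at this
    · rintro ⟨h1, h2⟩ i hi
      by_cases hin : i < n
      · rw [if_pos hin]; exact h1 i (by omega)
      · rw [if_neg hin, h2 _ (by omega), Nat.add_sub_cancel' (by omega)]
  rw [this, Measure.prod_prod, hP.2, hP.2 (N - n) (fun i => g (n + i))]
  rcases le_total N n with h | h
  · rw [min_eq_right h, Nat.sub_eq_zero_of_le h]; simp
  · rw [min_eq_left h]
    conv_rhs => rw [show N = n + (N - n) by omega]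
    rw [Finset.prod_range_add]

lemma shift_map (hP : IsRWMeasure p P) (n : ℕ) : P.map (shift n) = P := by
  have := hP.1
  conv_lhs => rw [← cat_map hP n]
  rw [Measure.map_map (meas_shift n) (meas_cat n)]
  have : shift (H := H) n ∘ cat n = Prod.snd := funext fun z => shift_cat n z
  rw [this, Measure.map_snd_prod]; simp

lemma shift_mp (hP : IsRWMeasure p P) (n : ℕ) : MeasurePreserving (shift n) P P :=
  ⟨meas_shift n, shift_map hP n⟩

lemma walk_zero (ω : ℕ → H) : walk ω 0 = 1 := by simp [walk]
lemma walk_succ (ω : ℕ → H) (n : ℕ) : walk ω (n + 1) = walk ω n * ω n := by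
  simp [walk, List.range_succ]
lemma walk_add (ω : ℕ → H) (n m : ℕ) : walk ω (n + m) = walk ω n * walk (shift n ω) m := by
  induction m with
  | zero => simp [walk_zero]
  | succ m ih => rw [← add_assoc, walk_succ, ih, walk_succ, mul_assoc]; simp [shift, add_comm]
lemma walk_one (ω : ℕ → H) : walk ω 1 = ω 0 := by rw [walk_succ, walk_zero, one_mul]
lemma walk_congr {ω ω' : ℕ → H} {n : ℕ} (h : ∀ i < n, ω i = ω' i) : walk ω n = walk ω' n := by
  induction n with
  | zero => simp [walk_zero]
  | succ n ih => rw [walk_succ, walk_succ, ih fun i hi => h i (by omega), h n (by omega)]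
lemma walk_cat {n k : ℕ} (h : k ≤ n) (z : (ℕ → H) × (ℕ → H)) : walk (cat n z) k = walk z.1 k :=
  walk_congr fun i hi => by simp [cat, show i < n by omega]

lemma meas_walk (n : ℕ) : Measurable fun ω : ℕ → H => walk ω n := by
  induction n with
  | zero => simp only [walk_zero]; exact measurable_const
  | succ n ih =>
    simp only [walk_succ]
    have : Measurable fun z : H × H => z.1 * z.2 := Measurable.of_discrete
    exact this.comp (ih.prodMk (measurable_pi_apply n))

lemma meas_walk_eq (n : ℕ) (g : H) : MeasurableSet {ω : ℕ → H | walk ω n = g} :=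
  meas_walk n (MeasurableSet.of_discrete (s := {g}))

/-- independence of past and future -/
lemma past_future (hP : IsRWMeasure p P) (n : ℕ) (g : H) {B : Set (ℕ → H)} (hB : MeasurableSet B) :
    P ({ω | walk ω n = g} ∩ shift n ⁻¹' B) = P {ω | walk ω n = g} * P B := by
  have := hP.1
  conv_lhs => rw [← cat_map hP n]
  rw [Measure.map_apply (meas_cat n) ((meas_walk_eq n g).inter (meas_shift n hB)), ← Measure.prod_prod]
  congr 1
  ext z
  simp [shift_cat, walk_cat le_rfl]

lemma meas_zero_eq (g : H) : MeasurableSet {ω : ℕ → H | ω 0 = g} :=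
  (measurable_pi_apply (X := fun _ : ℕ => H) 0) (MeasurableSet.of_discrete (s := ({g} : Set H)))

lemma law_one (hP : IsRWMeasure p P) (g : H) : P {ω | ω 0 = g} = p g := by
  have := hP.2 1 (fun _ => g)
  simpa using this

lemma law_walk (hP : IsRWMeasure p P) (n : ℕ) (g : H) : P {ω | walk ω n = g} = piN p n g := by
  have := hP.1
  induction n generalizing g with
  | zero =>
    simp only [walk_zero, piN]
    split_ifs with h
    · simp [h]
    · have : ¬ (1 : H) = g := fun h' => h h'.symm
      simp [this]
  | succ n ih =>
    simp only [piN, conv]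
    have : {ω : ℕ → H | walk ω (n + 1) = g} =
        ⋃ y : H, ({ω | walk ω n = y} ∩ shift n ⁻¹' {ω | ω 0 = y⁻¹ * g}) := by
      ext ω
      simp only [Set.mem_ofPred_eq, walk_succ, Set.mem_iUnion, Set.mem_inter_iff, Set.mem_preimage,
        shift, zero_add, exists_eq_left', eq_inv_mul_iff_mul_eq]
    rw [this, measure_iUnion]
    · refine tsum_congr fun y => ?_
      rw [past_future hP n y (meas_zero_eq _), ih, law_one hP]
    · intro y y' hyy'
      rw [Function.onFun, Set.disjoint_left]
      rintro ω ⟨h1, -⟩ ⟨h2, -⟩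
      exact hyy' (h1.symm.trans h2)
    · intro y
      exact (meas_walk_eq n y).inter (meas_shift n (meas_zero_eq _))

lemma lintegral_walk (hP : IsRWMeasure p P) (n : ℕ) (f : H → ℝ≥0∞) :
    ∫⁻ ω, f (walk ω n) ∂P = ∑' g, piN p n g * f g := by
  rw [← lintegral_map (f := f) Measurable.of_discrete (meas_walk n), lintegral_countable']
  refine tsum_congr fun g => ?_
  rw [Measure.map_apply (meas_walk n) MeasurableSet.of_discrete, mul_comm]
  congr 1
  exact law_walk hP n g

lemma block_indep (hP : IsRWMeasure p P) (m : ℕ) {j k : ℕ} (hjk : j < k) (f : H → ℝ) :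
    ProbabilityTheory.IndepFun (fun ω => f (walk (shift (j * m) ω) m))
      (fun ω => f (walk (shift (k * m) ω) m)) P := by
  have := hP.1
  have hf : Measurable f := Measurable.of_discrete
  have mW : ∀ j, Measurable (fun ω : ℕ → H => f (walk (shift (j * m) ω) m)) := fun j =>
    hf.comp ((meas_walk m).comp (meas_shift _))
  rw [ProbabilityTheory.indepFun_iff_measure_inter_preimage_eq_mul]
  intro s t hs ht
  have key : P ((fun ω => f (walk (shift (j * m) ω) m)) ⁻¹' s ∩
      (fun ω => f (walk (shift (k * m) ω) m)) ⁻¹' t) =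
      P ((fun ω => f (walk (shift (j * m) ω) m)) ⁻¹' s) * P ((fun ω => f (walk ω m)) ⁻¹' t) := by
    conv_lhs => rw [← cat_map hP (k * m)]
    rw [Measure.map_apply (meas_cat _) ((mW j hs).inter (mW k ht)), ← Measure.prod_prod]
    congr 1
    ext z
    simp only [Set.mem_preimage, Set.mem_inter_iff, shift_cat, Set.mem_prod]
    have : walk (shift (j * m) (cat (k * m) z)) m = walk (shift (j * m) z.1) m := by
      apply walk_congr
      intro i hi
      have : i + j * m < k * m := by
        have : (j + 1) * m ≤ k * m := Nat.mul_le_mul_right _ hjk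
        rw [add_mul, one_mul] at this; omega
      simp [shift, cat, this]
    rw [this]
  rw [key]
  congr 1
  have h2 := (shift_mp hP (k * m)).measure_preimage (s := (fun ω => f (walk ω m)) ⁻¹' t)
    ((hf.comp (meas_walk m)) ht).nullMeasurableSet
  rw [← h2]; rfl
end RW

end ModF1

section ModF2
set_option linter.unusedSectionVars false

section RW
variable {H : Type*} [Group H] [Countable H] [MeasurableSpace H] [DiscreteMeasurableSpace H]
  {p : H → ℝ≥0∞} {P : Measure (ℕ → H)}

lemma shift_shift (n m : ℕ) (ω : ℕ → H) : shift n (shift m ω) = shift (n + m) ω := by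
  funext i; simp [shift, add_assoc]

/-- zero-one law for almost invariant sets -/
lemma zero_one (hP : IsRWMeasure p P) {E : Set (ℕ → H)} (hE : MeasurableSet E)
    (hinv : ∀ᵐ ω ∂P, shift 1 ω ∈ E → ω ∈ E) : P E = 0 ∨ P E = 1 := by
  have := hP.1
  have h1 : (shift 1 ⁻¹' E : Set (ℕ → H)) =ᵐ[P] E := by
    refine ae_eq_of_ae_subset_of_measure_ge hinv ?_
      (meas_shift 1 hE).nullMeasurableSet (measure_ne_top _ _)
    rw [(shift_mp hP 1).measure_preimage hE.nullMeasurableSet]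
  have hn : ∀ n, (shift n ⁻¹' E : Set (ℕ → H)) =ᵐ[P] E := by
    intro n
    induction n with
    | zero => exact Filter.EventuallyEq.rfl
    | succ n ih =>
      have := (shift_mp hP n).quasiMeasurePreserving.preimage_ae_eq h1
      refine Filter.EventuallyEq.trans ?_ (this.trans ih)
      refine Filter.EventuallyEq.of_eq ?_
      ext ω
      show shift (n+1) ω ∈ E ↔ shift 1 (shift n ω) ∈ E
      rw [shift_shift, add_comm]
  have hind : P.restrict E = P E • P := by
    apply ext_pcyl
    intro n g
    rw [Measure.restrict_apply (meas_pcyl n g), Measure.smul_apply, smul_eq_mul]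
    rw [measure_congr ((Filter.EventuallyEq.refl _ {ω : ℕ → H | ∀ i < n, ω i = g i}).inter (hn n).symm)]
    conv_lhs => rw [← cat_map hP n]
    rw [Measure.map_apply (meas_cat n) ((meas_pcyl n g).inter (meas_shift n hE)), mul_comm,
      ← Measure.prod_prod]
    congr 1
    ext z
    simp only [Set.mem_preimage, Set.mem_inter_iff, shift_cat, Set.mem_prod, Set.mem_ofPred_eq]
    refine and_congr_left' (forall₂_congr fun i hi => ?_)
    simp [cat, hi]
  have h2 : P E = P E * P E := by
    have := congrArg (fun μ : Measure _ => μ E) hind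
    simpa [Measure.restrict_apply hE] using this
  by_cases h0 : P E = 0
  · exact Or.inl h0
  · right
    have : P E * 1 = P E * P E := by rw [mul_one]; exact h2
    exact ((ENNReal.mul_right_inj h0 (measure_ne_top _ _)).1 this).symm

/-- data of a subadditive process -/
structure Subadd (hP : IsRWMeasure p P) (Φ : ℕ → H → ℝ≥0∞) : Prop where
  zero : Φ 0 1 = 0
  sub : ∀ n m g h, Φ (n + m) (g * h) ≤ Φ n g + Φ m h
  fin : ∫⁻ ω, Φ 1 (walk ω 1) ∂P ≠ ∞

variable {hP : IsRWMeasure p P} {Φ : ℕ → H → ℝ≥0∞}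

lemma Subadd.step (hΦ : Subadd hP Φ) (n m : ℕ) (ω : ℕ → H) :
    Φ (n + m) (walk ω (n + m)) ≤ Φ n (walk ω n) + Φ m (walk (shift n ω) m) := by
  rw [walk_add]; exact hΦ.sub _ _ _ _

lemma meas_Φ (n : ℕ) (Φ : ℕ → H → ℝ≥0∞) : Measurable fun ω : ℕ → H => Φ n (walk ω n) :=
  (Measurable.of_discrete (f := Φ n)).comp (meas_walk n)

lemma lint_shift (hP : IsRWMeasure p P) (k : ℕ) {f : (ℕ → H) → ℝ≥0∞} (hf : Measurable f) :
    ∫⁻ ω, f (shift k ω) ∂P = ∫⁻ ω, f ω ∂P := (shift_mp hP k).lintegral_comp hf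

lemma Subadd.chain (hΦ : Subadd hP Φ) (m j : ℕ) (ω : ℕ → H) :
    Φ (j * m) (walk ω (j * m)) ≤ ∑ k ∈ Finset.range j, Φ m (walk (shift (k * m) ω) m) := by
  induction j with
  | zero => simp [walk_zero, hΦ.zero]
  | succ j ih =>
    rw [Finset.sum_range_succ, add_mul, one_mul]
    exact (hΦ.step _ _ _).trans (add_le_add_left ih _)

lemma Subadd.chain1 (hΦ : Subadd hP Φ) (n : ℕ) (ω : ℕ → H) :
    Φ n (walk ω n) ≤ ∑ k ∈ Finset.range n, Φ 1 (walk (shift k ω) 1) := by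
  simpa using hΦ.chain 1 n ω

lemma Subadd.int_ne_top (hΦ : Subadd hP Φ) (n : ℕ) : ∫⁻ ω, Φ n (walk ω n) ∂P ≠ ∞ := by
  refine ne_top_of_le_ne_top ?_ (lintegral_mono fun ω => hΦ.chain1 n ω)
  rw [lintegral_finsetSum (f := fun k ω => Φ 1 (walk (shift k ω) 1)) _ fun k _ => (meas_Φ 1 Φ).comp (meas_shift k)]
  refine ENNReal.sum_ne_top.2 fun k _ => ?_
  rw [lint_shift hP k (f := fun ω => Φ 1 (walk ω 1)) (meas_Φ 1 Φ)]
  exact hΦ.fin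

lemma Subadd.ae_fin (hΦ : Subadd hP Φ) : ∀ᵐ ω ∂P, ∀ n k, Φ n (walk (shift k ω) n) ≠ ∞ := by
  refine ae_all_iff.2 fun n => ae_all_iff.2 fun k => ?_
  have : ∀ᵐ ω ∂P, Φ n (walk (shift k ω) n) < ∞ := by
    refine ae_lt_top ((meas_Φ n Φ).comp (meas_shift k)) ?_
    rw [lint_shift hP k (f := fun ω => Φ n (walk ω n)) (meas_Φ n Φ)]
    exact hΦ.int_ne_top n
  filter_upwards [this] with ω h using h.ne

lemma Subadd.slln (hΦ : Subadd hP Φ) (m : ℕ) : ∀ᵐ ω ∂P,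
    Tendsto (fun j : ℕ => (∑ k ∈ Finset.range j, (Φ m (walk (shift (k * m) ω) m)).toReal) / j) atTop
      (𝓝 (∫⁻ ω, Φ m (walk ω m) ∂P).toReal) := by
  have := hP.1
  have hmr : Measurable fun ω : ℕ → H => (Φ m (walk ω m)).toReal := (meas_Φ m Φ).ennreal_toReal
  have := ProbabilityTheory.strong_law_ae_real (μ := P)
    (fun k ω => (Φ m (walk (shift (k * m) ω) m)).toReal) (by
      have : Integrable (fun ω => (Φ m (walk ω m)).toReal) P :=
        integrable_toReal_of_lintegral_ne_top (meas_Φ m Φ).aemeasurable (hΦ.int_ne_top m)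
      exact (shift_mp hP (0 * m)).integrable_comp_of_integrable this) (by
      intro j k hjk
      rcases lt_or_gt_of_ne hjk with h | h
      · exact block_indep hP m h (fun g => (Φ m g).toReal)
      · exact (block_indep hP m h (fun g => (Φ m g).toReal)).symm) (by
      intro k
      have h1 : ∀ k, Measure.map (fun ω => (Φ m (walk (shift (k * m) ω) m)).toReal) P =
          Measure.map (fun ω => (Φ m (walk ω m)).toReal) P := by
        intro k
        conv_rhs => rw [← shift_map hP (k * m)]
        rw [Measure.map_map hmr (meas_shift _)]; rfl
      exact ⟨(hmr.comp (meas_shift _)).aemeasurable, (hmr.comp (meas_shift _)).aemeasurable,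
        by rw [h1, h1]⟩)
  have e : ∫ ω, (Φ m (walk (shift (0 * m) ω) m)).toReal ∂P = (∫⁻ ω, Φ m (walk ω m) ∂P).toReal := by
    rw [integral_toReal]
    · congr 1
      exact lint_shift hP (0 * m) (f := fun ω => Φ m (walk ω m)) (meas_Φ m Φ)
    · exact ((meas_Φ m Φ).comp (meas_shift _)).aemeasurable
    · filter_upwards [hΦ.ae_fin] with ω h using lt_top_iff_ne_top.2 (h _ _)
  rw [e] at this
  exact this

lemma tendsto_div_nat {m : ℕ} (hm : 0 < m) :
    Tendsto (fun n : ℕ => ((n / m : ℕ) : ℝ) / n) atTop (𝓝 (1 / m)) := by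
  have hm' : (0:ℝ) < m := by exact_mod_cast hm
  have h1 : Tendsto (fun n : ℕ => ((n % m : ℕ) : ℝ) / n) atTop (𝓝 0) := by
    refine tendsto_of_tendsto_of_tendsto_of_le_of_le tendsto_const_nhds
      (tendsto_const_div_atTop_nhds_zero_nat (m : ℝ)) (fun n => by positivity) fun n => ?_
    dsimp only
    gcongr
    exact (Nat.mod_lt _ hm).le
  have h2 : Tendsto (fun n : ℕ => (1 - ((n % m : ℕ) : ℝ) / n) / m) atTop (𝓝 ((1 - 0) / m)) :=
    (tendsto_const_nhds.sub h1).div_const _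
  rw [sub_zero] at h2
  refine h2.congr' ?_
  filter_upwards [eventually_gt_atTop 0] with n hn
  have hn' : (0:ℝ) < n := by exact_mod_cast hn
  have : (n : ℝ) = m * (n / m : ℕ) + (n % m : ℕ) := by exact_mod_cast (Nat.div_add_mod n m).symm
  field_simp
  linarith

lemma Subadd.upper (hΦ : Subadd hP Φ) {c : ℝ}
    (hc : Tendsto (fun n : ℕ => (∫⁻ ω, Φ n (walk ω n) ∂P).toReal / n) atTop (𝓝 c))
    {ε : ℝ} (hε : 0 < ε) : ∀ᵐ ω ∂P, ∀ᶠ n : ℕ in atTop, (Φ n (walk ω n)).toReal ≤ (c + ε) * n := by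
  obtain ⟨m, hm, hm0⟩ := ((hc.eventually (gt_mem_nhds (show c < c + ε by linarith))).and
    (eventually_gt_atTop 0)).exists
  filter_upwards [hΦ.slln m, hΦ.slln 1, hΦ.ae_fin] with ω h1 h2 hfin
  set A := (∫⁻ ω, Φ m (walk ω m) ∂P).toReal
  set a := (∫⁻ ω, Φ 1 (walk ω 1) ∂P).toReal
  set U : ℕ → ℝ := fun j => ∑ k ∈ Finset.range j, (Φ m (walk (shift (k * m) ω) m)).toReal
  set T : ℕ → ℝ := fun j => ∑ k ∈ Finset.range j, (Φ 1 (walk (shift (k * 1) ω) 1)).toReal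
  have hm' : (0:ℝ) < m := by exact_mod_cast hm0
  have hdiv : Tendsto (fun n : ℕ => n / m) atTop atTop := Nat.tendsto_div_const_atTop hm0.ne'
  have hdivm : Tendsto (fun n : ℕ => n / m * m) atTop atTop :=
    tendsto_atTop_mono (fun n => Nat.le_mul_of_pos_right _ hm0) hdiv
  have t1 : Tendsto (fun n : ℕ => U (n / m) / n) atTop (𝓝 (A * (1 / m))) := by
    refine ((h1.comp hdiv).mul (tendsto_div_nat hm0)).congr' ?_
    filter_upwards [hdiv.eventually (eventually_gt_atTop 0)] with n hn
    have : (0:ℝ) < (n / m : ℕ) := by exact_mod_cast hn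
    simp only [Function.comp, U]
    rw [div_mul_div_cancel₀ this.ne']
  have t2 : Tendsto (fun n : ℕ => T (n / m * m) / n) atTop (𝓝 (a * (1 / m * m))) := by
    refine ((h2.comp hdivm).mul ((tendsto_div_nat hm0).mul_const (m : ℝ))).congr' ?_
    filter_upwards [hdiv.eventually (eventually_gt_atTop 0)] with n hn
    have : (0:ℝ) < (n / m : ℕ) := by exact_mod_cast hn
    simp only [Function.comp, T]
    push_cast
    field_simp
  have t3 := (t1.add h2).sub t2
  have e : A * (1 / m) + a - a * (1 / m * m) = A / m := by field_simp; ring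
  rw [e] at t3
  filter_upwards [t3.eventually (gt_mem_nhds hm), eventually_gt_atTop 0] with n hn hn0
  have hn0 : (0:ℝ) < n := by exact_mod_cast hn0
  have h3 : Φ n (walk ω n) ≤ (∑ k ∈ Finset.range (n / m), Φ m (walk (shift (k * m) ω) m)) +
      ∑ k ∈ Finset.range (n % m), Φ 1 (walk (shift (k + n / m * m) ω) 1) := by
    have e : n = n / m * m + n % m := (Nat.div_add_mod' n m).symm
    calc Φ n (walk ω n) = Φ (n / m * m + n % m) (walk ω (n / m * m + n % m)) := by rw [← e]
      _ ≤ _ := hΦ.step _ _ _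
      _ ≤ _ := by
        refine add_le_add (hΦ.chain m (n / m) ω) ((hΦ.chain1 _ _).trans ?_)
        simp only [shift_shift]; exact le_rfl
  have f1 : ∀ k ∈ Finset.range (n / m), Φ m (walk (shift (k * m) ω) m) ≠ ∞ := fun k _ => hfin _ _
  have f2 : ∀ k ∈ Finset.range (n % m), Φ 1 (walk (shift (k + n / m * m) ω) 1) ≠ ∞ :=
    fun k _ => hfin _ _
  have h4 := ENNReal.toReal_mono (ENNReal.add_ne_top.2
    ⟨ENNReal.sum_ne_top.2 f1, ENNReal.sum_ne_top.2 f2⟩) h3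
  rw [ENNReal.toReal_add (ENNReal.sum_ne_top.2 f1) (ENNReal.sum_ne_top.2 f2),
    ENNReal.toReal_sum f1, ENNReal.toReal_sum f2] at h4
  have h5 : T n = T (n / m * m) +
      ∑ k ∈ Finset.range (n % m), (Φ 1 (walk (shift (k + n / m * m) ω) 1)).toReal := by
    conv_lhs => rw [← Nat.div_add_mod' n m]
    simp only [T]
    rw [Finset.sum_range_add]
    simp only [mul_one, add_comm]
  have h6 : (Φ n (walk ω n)).toReal ≤ U (n / m) + T n - T (n / m * m) := by
    rw [h5]; simp only [U]; linarith
  have h7 : (U (n / m) + T n - T (n / m * m)) / n < c + ε := by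
    have : (U (n / m) + T n - T (n / m * m)) / n = U (n / m) / n + T n / n - T (n / m * m) / n := by
      ring
    rw [this]; exact hn
  rw [div_lt_iff₀ hn0] at h7
  linarith

/-- Katznelson-Weiss covering bound. -/
lemma Subadd.kw (hΦ : Subadd hP Φ) {a : ℝ} (ha : 0 ≤ a) (K : ℕ) (hK : 0 < K)
    {A : Set (ℕ → H)} (hA : ∀ ω, ω ∉ A → ∃ j, 1 ≤ j ∧ j ≤ K ∧ Φ j (walk ω j) ≤ ENNReal.ofReal (a * j))
    (n : ℕ) : ∀ ω : ℕ → H, Φ n (walk ω n) ≤ ENNReal.ofReal (a * n) +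
      (∑ k ∈ Finset.range n, A.indicator (fun ω => Φ 1 (walk ω 1)) (shift k ω)) +
      ∑ k ∈ Finset.Ico (n - K) n, Φ 1 (walk (shift k ω) 1) := by
  induction n using Nat.strong_induction_on with
  | _ n ih =>
  intro ω
  rcases le_or_gt n K with hn | hn
  · refine (hΦ.chain1 n ω).trans ?_
    rw [Nat.sub_eq_zero_of_le hn, ← Finset.range_eq_Ico]
    exact le_add_self
  have main : ∀ j, 1 ≤ j → j ≤ K → (x : ℝ≥0∞) → Φ j (walk ω j) ≤ x →
      Φ n (walk ω n) ≤ x + (ENNReal.ofReal (a * (n - j : ℕ)) +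
      (∑ k ∈ Finset.Ico j n, A.indicator (fun ω => Φ 1 (walk ω 1)) (shift k ω)) +
      ∑ k ∈ Finset.Ico (n - K) n, Φ 1 (walk (shift k ω) 1)) := by
    intro j hj1 hjK x hx
    have h1 : Φ n (walk ω n) ≤ Φ j (walk ω j) + Φ (n - j) (walk (shift j ω) (n - j)) := by
      have := hΦ.step j (n - j) ω
      rwa [Nat.add_sub_cancel' (by omega)] at this
    refine h1.trans (add_le_add hx ((ih (n - j) (by omega) (shift j ω)).trans ?_))
    refine add_le_add (add_le_add le_rfl ?_) ?_
    · rw [Finset.sum_Ico_eq_sum_range]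
      simp only [shift_shift, add_comm]; exact le_rfl
    · simp only [shift_shift]
      rw [Finset.sum_Ico_add' (fun k => Φ 1 (walk (shift k ω) 1)) (n - j - K) (n - j) j]
      apply Finset.sum_le_sum_of_subset
      intro k
      simp only [Finset.mem_Ico]; omega
  by_cases hω : ω ∈ A
  · refine (main 1 le_rfl hK _ le_rfl).trans ?_
    rw [Finset.range_eq_Ico, Finset.sum_eq_sum_Ico_succ_bot (by omega : 0 < n)]
    have : A.indicator (fun ω => Φ 1 (walk ω 1)) (shift 0 ω) = Φ 1 (walk ω 1) :=
      Set.indicator_of_mem hω _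
    rw [this]
    have h2 : ENNReal.ofReal (a * (n - 1 : ℕ)) ≤ ENNReal.ofReal (a * n) := by
      apply ENNReal.ofReal_le_ofReal; gcongr; omega
    calc _ ≤ Φ 1 (walk ω 1) + (ENNReal.ofReal (a * n) + (∑ k ∈ Finset.Ico 1 n, A.indicator (fun ω => Φ 1 (walk ω 1)) (shift k ω)) +
      ∑ k ∈ Finset.Ico (n - K) n, Φ 1 (walk (shift k ω) 1)) := by gcongr
      _ = _ := by rw [zero_add]; ring
  · obtain ⟨j, hj1, hjK, hj⟩ := hA ω hω
    refine (main j hj1 hjK _ hj).trans ?_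
    rw [← add_assoc, ← add_assoc, ← ENNReal.ofReal_add (by positivity) (by positivity)]
    have e : a * (j : ℝ) + a * ((n - j : ℕ) : ℝ) = a * n := by
      rw [Nat.cast_sub (by omega)]; ring
    rw [e]
    refine add_le_add (add_le_add le_rfl ?_) le_rfl
    rw [Finset.range_eq_Ico]
    exact Finset.sum_le_sum_of_subset (Finset.Ico_subset_Ico_left (Nat.zero_le _))

/-- `liminf < a` -/
def lowSet (Φ : ℕ → H → ℝ≥0∞) (a : ℝ) : Set (ℕ → H) :=
  {ω | ∃ q : ℚ, (q : ℝ) < a ∧ ∀ N : ℕ, ∃ n, N ≤ n ∧ Φ n (walk ω n) ≤ ENNReal.ofReal (q * n)}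

lemma meas_lowSet (Φ : ℕ → H → ℝ≥0∞) (a : ℝ) : MeasurableSet (lowSet Φ a) := by
  have : lowSet Φ a = ⋃ q : ℚ, ⋃ (_ : (q : ℝ) < a), ⋂ N : ℕ, ⋃ n, ⋃ (_ : N ≤ n),
      {ω | Φ n (walk ω n) ≤ ENNReal.ofReal (q * n)} := by
    ext ω; simp [lowSet]
  rw [this]
  exact MeasurableSet.iUnion fun q => MeasurableSet.iUnion fun _ => MeasurableSet.iInter fun N =>
    MeasurableSet.iUnion fun n => MeasurableSet.iUnion fun _ =>
      measurableSet_le (meas_Φ n Φ) measurable_const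

lemma Subadd.lower (hΦ : Subadd hP Φ) {c : ℝ}
    (hc : Tendsto (fun n : ℕ => (∫⁻ ω, Φ n (walk ω n) ∂P).toReal / n) atTop (𝓝 c))
    {a : ℝ} (ha : 0 < a) (hac : a < c) : P (lowSet Φ a) = 0 := by
  have := hP.1
  have h01 := zero_one hP (meas_lowSet Φ a) (by
    filter_upwards [hΦ.ae_fin] with ω hfin
    rintro ⟨q, hq, hN⟩
    obtain ⟨q', hqq', hq'⟩ := exists_rat_btwn (max_lt hq ha)
    have h1 : (q : ℝ) < q' := (le_max_left _ _).trans_lt hqq'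
    have h0 : (0 : ℝ) < q' := (le_max_right _ _).trans_lt hqq'
    refine ⟨q', hq', fun N => ?_⟩
    have f1 := hfin 1 0
    set x := (Φ 1 (walk ω 1)).toReal with hx
    have hfx : Φ 1 (walk ω 1) = ENNReal.ofReal x := (ENNReal.ofReal_toReal f1).symm
    obtain ⟨N1, hN1⟩ := exists_nat_gt (x / (q' - max (q:ℝ) 0))
    obtain ⟨n, hn, hfn⟩ := hN (max N N1)
    refine ⟨1 + n, by have := le_max_left N N1; omega, ?_⟩
    refine (hΦ.step 1 n ω).trans ?_
    rw [hfx]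
    refine (add_le_add_right hfn _).trans ?_
    have hd : 0 < (q' : ℝ) - max (q:ℝ) 0 := by linarith
    have hn1 : (N1 : ℝ) ≤ n := by exact_mod_cast (le_max_right N N1).trans hn
    rw [div_lt_iff₀ hd] at hN1
    have h3 : x ≤ n * ((q' : ℝ) - max (q:ℝ) 0) := hN1.le.trans (by gcongr)
    have hm : (q : ℝ) * n ≤ max (q:ℝ) 0 * n := by gcongr; exact le_max_left _ _
    refine (add_le_add_right (ENNReal.ofReal_le_ofReal hm) _).trans ?_
    rw [← ENNReal.ofReal_add ENNReal.toReal_nonneg (by positivity)]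
    apply ENNReal.ofReal_le_ofReal
    push_cast
    rw [← hx]; nlinarith)
  rcases h01 with h | h
  · exact h
  exfalso
  set A : ℕ → Set (ℕ → H) := fun K => {ω | ∀ j, 1 ≤ j → j ≤ K → ENNReal.ofReal (a * j) < Φ j (walk ω j)} with hA
  have hAm : ∀ K, MeasurableSet (A K) := by
    intro K
    have : A K = ⋂ j, ⋂ (_ : 1 ≤ j), ⋂ (_ : j ≤ K), {ω | ENNReal.ofReal (a * j) < Φ j (walk ω j)} := by
      ext ω; simp [hA]
    rw [this]
    exact MeasurableSet.iInter fun j => MeasurableSet.iInter fun _ => MeasurableSet.iInter fun _ =>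
      measurableSet_lt measurable_const (meas_Φ j Φ)
  have hanti : Antitone A := fun K L hKL ω hω j h1 h2 => hω j h1 (h2.trans hKL)
  have hA0 : P (⋂ K, A K) = 0 := by
    have hc0 : P (lowSet Φ a)ᶜ = 0 := (prob_compl_eq_zero_iff (meas_lowSet Φ a)).2 h
    refine measure_mono_null ?_ hc0
    intro ω hω
    rintro ⟨q, hq, hN⟩
    obtain ⟨n, hn, hf⟩ := hN 1
    have := Set.mem_iInter.1 hω n n hn le_rfl
    refine absurd (hf.trans (ENNReal.ofReal_le_ofReal ?_)) (not_le.2 this)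
    gcongr
  have hAt : Tendsto (fun K => P (A K)) atTop (𝓝 0) := by
    rw [← hA0]
    exact tendsto_measure_iInter_atTop (fun K => (hAm K).nullMeasurableSet) hanti ⟨0, measure_ne_top _ _⟩
  have hIt := tendsto_setLIntegral_zero hΦ.fin hAt
  have hε : 0 < (c - a) / 2 := by linarith
  obtain ⟨K, hK1, hK0⟩ := ((hIt.eventually (gt_mem_nhds (ENNReal.ofReal_pos.2 hε))).and
    (eventually_gt_atTop 0)).exists
  set I1 := ∫⁻ ω, Φ 1 (walk ω 1) ∂P with hI1
  have hbound : ∀ n : ℕ, (∫⁻ ω, Φ n (walk ω n) ∂P).toReal ≤ a * n + n * ((c - a) / 2) + K * I1.toReal := by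
    intro n
    have hk := lintegral_mono (μ := P) (fun ω => hΦ.kw ha.le K hK0 (A := A K) (by
      intro ω hω
      simp only [hA, Set.mem_ofPred_eq] at hω
      push Not at hω
      exact hω) n ω)
    have hmi : ∀ k, Measurable fun ω => (A K).indicator (fun ω => Φ 1 (walk ω 1)) (shift k ω) :=
      fun k => ((meas_Φ 1 Φ).indicator (hAm K)).comp (meas_shift k)
    have hm1 : ∀ k, Measurable fun ω : ℕ → H => Φ 1 (walk (shift k ω) 1) :=
      fun k => (meas_Φ 1 Φ).comp (meas_shift k)
    rw [lintegral_add_right _ (Finset.measurable_fun_sum _ fun k _ => hm1 k),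
      lintegral_add_right _ (Finset.measurable_fun_sum _ fun k _ => hmi k),
      lintegral_const, measure_univ, mul_one,
      lintegral_finsetSum (f := fun k ω => Φ 1 (walk (shift k ω) 1)) _ fun k _ => hm1 k,
      lintegral_finsetSum (f := fun k ω => (A K).indicator (fun ω => Φ 1 (walk ω 1)) (shift k ω)) _
        fun k _ => hmi k] at hk
    have e1 : ∀ k, ∫⁻ ω, (A K).indicator (fun ω => Φ 1 (walk ω 1)) (shift k ω) ∂P
        ≤ ENNReal.ofReal ((c - a) / 2) := by
      intro k
      rw [lint_shift hP k (f := (A K).indicator (fun ω => Φ 1 (walk ω 1)))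
        ((meas_Φ 1 Φ).indicator (hAm K)), lintegral_indicator (hAm K)]
      exact hK1.le
    have e2 : ∀ k, ∫⁻ ω, Φ 1 (walk (shift k ω) 1) ∂P = I1 := fun k =>
      lint_shift hP k (f := fun ω => Φ 1 (walk ω 1)) (meas_Φ 1 Φ)
    have hk2 : ∫⁻ ω, Φ n (walk ω n) ∂P ≤ ENNReal.ofReal (a * n) + n * ENNReal.ofReal ((c - a) / 2)
        + K * I1 := by
      refine hk.trans (add_le_add (add_le_add le_rfl ?_) ?_)
      · refine (Finset.sum_le_sum fun k _ => e1 k).trans ?_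
        simp
      · rw [Finset.sum_congr rfl fun k _ => e2 k, Finset.sum_const, nsmul_eq_mul]
        gcongr
        simp
        omega
    have := ENNReal.toReal_mono (by
      refine ENNReal.add_ne_top.2 ⟨ENNReal.add_ne_top.2 ⟨ENNReal.ofReal_ne_top, ?_⟩, ?_⟩
      · exact ENNReal.mul_ne_top (ENNReal.natCast_ne_top _) ENNReal.ofReal_ne_top
      · exact ENNReal.mul_ne_top (ENNReal.natCast_ne_top _) hΦ.fin) hk2
    rw [ENNReal.toReal_add (ENNReal.add_ne_top.2 ⟨ENNReal.ofReal_ne_top, ENNReal.mul_ne_top (ENNReal.natCast_ne_top _) ENNReal.ofReal_ne_top⟩)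
      (ENNReal.mul_ne_top (ENNReal.natCast_ne_top _) hΦ.fin), ENNReal.toReal_add ENNReal.ofReal_ne_top (ENNReal.mul_ne_top (ENNReal.natCast_ne_top _) ENNReal.ofReal_ne_top),
      ENNReal.toReal_ofReal (by positivity), ENNReal.toReal_mul, ENNReal.toReal_mul,
      ENNReal.toReal_ofReal hε.le] at this
    simpa using this
  have hlim : Tendsto (fun n : ℕ => a + (c - a) / 2 + K * I1.toReal / n) atTop (𝓝 (a + (c - a) / 2 + 0)) :=
    tendsto_const_nhds.add (tendsto_const_div_atTop_nhds_zero_nat _)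
  have := le_of_tendsto_of_tendsto hc hlim (by
    filter_upwards [eventually_gt_atTop 0] with n hn
    have hn' : (0:ℝ) < n := by exact_mod_cast hn
    rw [div_le_iff₀ hn']
    have := hbound n
    have e : (a + (c - a) / 2 + K * I1.toReal / n) * n = a * n + n * ((c - a) / 2) + K * I1.toReal := by
      field_simp
    rw [e]; exact this)
  linarith

/-- Kingman's theorem for our processes. -/
theorem kingman (hΦ : Subadd hP Φ) {c : ℝ}
    (hc : Tendsto (fun n : ℕ => (∫⁻ ω, Φ n (walk ω n) ∂P).toReal / n) atTop (𝓝 c))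
    {ε : ℝ} (hε : 0 < ε) : ∀ᵐ ω ∂P, ∀ᶠ n : ℕ in atTop, Φ n (walk ω n) ≠ ∞ ∧
      (c - ε) * n ≤ (Φ n (walk ω n)).toReal ∧ (Φ n (walk ω n)).toReal ≤ (c + ε) * n := by
  have := hP.1
  have hlow : ∀ᵐ ω ∂P, ∀ᶠ n : ℕ in atTop, (c - ε) * n ≤ (Φ n (walk ω n)).toReal := by
    rcases le_or_gt (c - ε) 0 with h | h
    · refine Eventually.of_forall fun ω => Eventually.of_forall fun n => ?_
      exact (mul_nonpos_of_nonpos_of_nonneg h (Nat.cast_nonneg _)).trans ENNReal.toReal_nonneg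
    · obtain ⟨q, hq1, hq2⟩ := exists_rat_btwn (show c - ε < c - ε / 2 by linarith)
      have h0 : P (lowSet Φ (c - ε / 2)) = 0 := hΦ.lower hc (by linarith) (by linarith)
      have h1 : ∀ᵐ ω ∂P, ω ∉ lowSet Φ (c - ε / 2) := measure_eq_zero_iff_ae_notMem.1 h0
      filter_upwards [h1, hΦ.ae_fin] with ω hω hfin
      simp only [lowSet, Set.mem_ofPred_eq] at hω
      push Not at hω
      obtain ⟨N, hN⟩ := hω q hq2
      filter_upwards [eventually_ge_atTop N] with n hn
      have := hN n hn
      have h2 := (ENNReal.ofReal_lt_iff_lt_toReal (by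
        have : (0:ℝ) < q := by linarith
        positivity) (hfin n 0)).1 this
      refine le_trans ?_ h2.le
      gcongr
  filter_upwards [hlow, hΦ.upper hc hε, hΦ.ae_fin] with ω h1 h2 h3
  filter_upwards [h1, h2] with n h4 h5
  exact ⟨h3 n 0, h4, h5⟩
end RW

end ModF2

section ModG1
set_option linter.unusedSectionVars false

section RW
variable {H : Type*} [Group H] [Countable H] [MeasurableSpace H] [DiscreteMeasurableSpace H]
  {p : H → ℝ≥0∞} {P : Measure (ℕ → H)}

lemma walk_map {K : Type*} [Group K] [Countable K] [MeasurableSpace K] [DiscreteMeasurableSpace K] (f : H →* K) (ω : ℕ → H) (n : ℕ) :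
    walk (fun i => f (ω i)) n = f (walk ω n) := by
  induction n with
  | zero => simp [walk_zero]
  | succ n ih => rw [walk_succ, walk_succ, ih, map_mul]

lemma meas_letters {K : Type*} [Group K] [Countable K] [MeasurableSpace K] [DiscreteMeasurableSpace K]
    (f : H →* K) : Measurable fun (ω : ℕ → H) i => f (ω i) :=
  measurable_pi_lambda _ fun i => (Measurable.of_discrete (f := f)).comp (measurable_pi_apply i)

lemma rw_map {K : Type*} [Group K] [Countable K] [MeasurableSpace K] [DiscreteMeasurableSpace K]
    (hP : IsRWMeasure p P) (f : H →* K) (q : K → ℝ≥0∞)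
    (hq : ∀ k, ∑' h, (if f h = k then p h else 0) = q k) :
    IsRWMeasure q (P.map fun ω i => f (ω i)) := by
  have := hP.1
  have h1 : ∀ k, P {ω | f (ω 0) = k} = q k := by
    intro k
    rw [← hq]
    have : {ω : ℕ → H | f (ω 0) = k} = ⋃ h : {h // f h = k}, {ω | ω 0 = h.1} := by
      ext ω; simp
    rw [this, measure_iUnion]
    · simp only [law_one hP]
      refine (tsum_subtype {h | f h = k} p).trans ?_
      refine tsum_congr fun h => ?_
      simp [Set.indicator]
    · intro a b hab
      rw [Function.onFun, Set.disjoint_left]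
      intro ω ha hb
      exact hab (Subtype.ext (ha.symm.trans hb))
    · exact fun h => meas_zero_eq _
  refine ⟨Measure.isProbabilityMeasure_map (meas_letters f).aemeasurable, fun n g => ?_⟩
  have hm : ∀ n, MeasurableSet {ω : ℕ → H | ∀ i < n, f (ω i) = g i} := fun n => meas_letters f (meas_pcyl n g)
  rw [Measure.map_apply (meas_letters f) (meas_pcyl n g)]
  show P {ω : ℕ → H | ∀ i < n, f (ω i) = g i} = _
  induction n with
  | zero => simp
  | succ n ih =>
    rw [Finset.prod_range_succ, ← ih, ← h1, ← Measure.prod_prod]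
    conv_lhs => rw [← cat_map hP n]
    rw [Measure.map_apply (meas_cat n) (hm (n+1))]
    congr 1
    ext z
    simp only [Set.mem_preimage, Set.mem_prod, Set.mem_ofPred_eq]
    constructor
    · intro h
      refine ⟨fun i hi => ?_, ?_⟩
      · have := h i (by omega); simpa [cat, hi] using this
      · have := h n (by omega); simpa [cat] using this
    · rintro ⟨h1, h2⟩ i hi
      rcases Nat.lt_succ_iff_lt_or_eq.1 hi with h | h
      · simpa [cat, h] using h1 i h
      · subst h; simpa [cat] using h2

lemma piN_le_one (hP : IsRWMeasure p P) (n : ℕ) (g : H) : piN p n g ≤ 1 := by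
  have := hP.1
  rw [← law_walk hP]; exact prob_le_one

lemma piN_ne_top (hP : IsRWMeasure p P) (n : ℕ) (g : H) : piN p n g ≠ ∞ :=
  ne_top_of_le_ne_top ENNReal.one_ne_top (piN_le_one hP n g)

lemma piN_one (hP : IsRWMeasure p P) (g : H) : piN p 1 g = p g := by
  rw [← law_walk hP, ← law_one hP]; simp only [walk_one]

lemma piN_super (hP : IsRWMeasure p P) (n m : ℕ) (g h : H) :
    piN p n g * piN p m h ≤ piN p (n + m) (g * h) := by
  have := past_future hP n g (meas_walk_eq m h)
  rw [law_walk hP, law_walk hP] at this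
  rw [← this, ← law_walk hP]
  refine measure_mono ?_
  rintro ω ⟨h1, h2⟩
  simp only [Set.mem_ofPred_eq, Set.mem_preimage] at h1 h2 ⊢
  rw [walk_add, h1, h2]

lemma piN_tsum (hP : IsRWMeasure p P) (n : ℕ) : ∑' g, piN p n g = 1 := by
  have := hP.1
  have := lintegral_walk hP n (fun _ => 1)
  simpa using this.symm

/-- entropy process -/
def entΦ (p : H → ℝ≥0∞) (n : ℕ) (g : H) : ℝ≥0∞ :=
  if piN p n g = 0 then ∞ else ENNReal.ofReal (-Real.log (piN p n g).toReal)

lemma int_entΦ (hP : IsRWMeasure p P) (n : ℕ) :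
    ∫⁻ ω, entΦ p n (walk ω n) ∂P = ∑' g, ENNReal.ofReal (Real.negMulLog (piN p n g).toReal) := by
  rw [lintegral_walk hP]
  refine tsum_congr fun g => ?_
  unfold entΦ
  split_ifs with h
  · simp [h]
  · rw [Real.negMulLog]
    have e := ENNReal.ofReal_toReal (piN_ne_top hP n g)
    calc _ = ENNReal.ofReal (piN p n g).toReal * ENNReal.ofReal (-Real.log (piN p n g).toReal) := by rw [e]
      _ = _ := by
        rw [← ENNReal.ofReal_mul ENNReal.toReal_nonneg]
        congr 1; ring

lemma int_entΦ_toReal (hP : IsRWMeasure p P) (n : ℕ) :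
    (∫⁻ ω, entΦ p n (walk ω n) ∂P).toReal = entropySeq p n := by
  rw [int_entΦ hP, ENNReal.tsum_toReal_eq fun _ => ENNReal.ofReal_ne_top]
  refine tsum_congr fun g => ENNReal.toReal_ofReal ?_
  refine Real.negMulLog_nonneg ENNReal.toReal_nonneg ?_
  exact ENNReal.toReal_le_of_le_ofReal zero_le_one (by simpa using piN_le_one hP n g)

lemma subadd_ent (hP : IsRWMeasure p P)
    (hfin : ∑' g, ENNReal.ofReal (Real.negMulLog (p g).toReal) ≠ ∞) : Subadd hP (entΦ p) where
  zero := by simp [entΦ, piN]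
  sub n m g h := by
    unfold entΦ
    by_cases h1 : piN p n g = 0
    · simp [h1]
    by_cases h2 : piN p m h = 0
    · simp [h2]
    have h3 := piN_super hP n m g h
    have h4 : piN p (n + m) (g * h) ≠ 0 := by
      intro h5; rw [h5] at h3
      rcases mul_eq_zero.1 (le_antisymm h3 zero_le) with h | h <;> contradiction
    rw [if_neg h1, if_neg h2, if_neg h4]
    have p1 : 0 < (piN p n g).toReal := ENNReal.toReal_pos h1 (piN_ne_top hP _ _)
    have p2 : 0 < (piN p m h).toReal := ENNReal.toReal_pos h2 (piN_ne_top hP _ _)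
    have h5 := ENNReal.toReal_mono (piN_ne_top hP _ _) h3
    rw [ENNReal.toReal_mul] at h5
    refine le_trans (ENNReal.ofReal_le_ofReal ?_) ENNReal.ofReal_add_le
    have := Real.log_le_log (mul_pos p1 p2) h5
    rw [Real.log_mul p1.ne' p2.ne'] at this
    linarith
  fin := by
    rw [int_entΦ hP]
    simpa only [piN_one hP] using hfin

lemma ent_fin (hp : ∀ x, p x ≠ ∞) (a : H → ℝ) (h1 : ∑' x, p x * ENNReal.ofReal (a x) ≠ ∞)
    (h2 : ∑' x, ENNReal.ofReal (Real.exp (-(a x))) ≠ ∞) :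
    ∑' g, ENNReal.ofReal (Real.negMulLog (p g).toReal) ≠ ∞ := by
  refine ne_top_of_le_ne_top (ENNReal.add_ne_top.2 ⟨h1, h2⟩) ?_
  rw [← ENNReal.tsum_add]
  refine ENNReal.tsum_le_tsum fun x => ?_
  conv_rhs => rw [← ENNReal.ofReal_toReal (hp x)]
  rw [← ENNReal.ofReal_mul ENNReal.toReal_nonneg]
  refine le_trans (ENNReal.ofReal_le_ofReal ?_) ENNReal.ofReal_add_le
  set t := (p x).toReal with ht
  have ht0 : 0 ≤ t := ENNReal.toReal_nonneg
  rcases ht0.eq_or_lt with h | h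
  · rw [← h]; simp; positivity
  · -- -t log t ≤ t a + e^{-a}
    have := Real.add_one_le_exp (-(a x) - Real.log t)
    have e : Real.exp (-(a x) - Real.log t) = Real.exp (-(a x)) / t := by
      rw [Real.exp_sub, Real.exp_log h]
    rw [e, le_div_iff₀ h] at this
    rw [Real.negMulLog]
    nlinarith

end RW

section G
variable {G : Type*} [Group G] [MetricSpace G] [Countable G] [MeasurableSpace G]
  [DiscreteMeasurableSpace G] {p : G → ℝ≥0∞} {P : Measure (ℕ → G)}

def distΦ (_ : ℕ) (g : G) : ℝ≥0∞ := ENNReal.ofReal (dist 1 g)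

lemma dist_mul_le (hL : LeftInvariantMetric G) (g h : G) : dist 1 (g * h) ≤ dist 1 g + dist 1 h := by
  have h1 : dist g (g * h) = dist 1 h := by simpa using hL g 1 h
  have := dist_triangle 1 g (g * h)
  linarith

lemma subadd_dist (hL : LeftInvariantMetric G) (hP : IsRWMeasure p P)
    (hmom : FiniteFirstMoment p fun x => dist (1 : G) x) : Subadd hP (distΦ (G := G)) where
  zero := by simp [distΦ]
  sub n m g h := by
    unfold distΦ
    rw [← ENNReal.ofReal_add dist_nonneg dist_nonneg]
    exact ENNReal.ofReal_le_ofReal (dist_mul_le hL g h)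
  fin := by
    rw [lintegral_walk hP 1 (distΦ 1)]
    simp only [piN_one hP]
    exact hmom

lemma int_distΦ_toReal (hP : IsRWMeasure p P) (n : ℕ) :
    (∫⁻ ω, distΦ n (walk ω n) ∂P).toReal = momentSeq p (fun x => dist (1:G) x) n := by
  rw [lintegral_walk hP n (distΦ n), ENNReal.tsum_toReal_eq]
  · refine tsum_congr fun g => ?_
    rw [ENNReal.toReal_mul, distΦ, ENNReal.toReal_ofReal dist_nonneg]
  · exact fun g => ENNReal.mul_ne_top (piN_ne_top hP _ _) ENNReal.ofReal_ne_top

lemma exp_summable (hq : IsQIToWordMetric G) :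
    ∃ C : ℝ, 0 ≤ C ∧ ∑' x : G, ENNReal.ofReal (Real.exp (-(C * dist 1 x))) ≠ ∞ := by
  obtain ⟨c, hc, hgr⟩ := growth hq
  refine ⟨c + 1, by linarith, ?_⟩
  -- group by floor of the distance
  have hle : ∀ x : G, ENNReal.ofReal (Real.exp (-((c+1) * dist 1 x))) ≤
      ∑' n : ℕ, if dist 1 x ≤ n + 1 then ENNReal.ofReal (Real.exp (-((c+1) * n))) else 0 := by
    intro x
    refine le_trans ?_ (ENNReal.le_tsum ⌊dist 1 x⌋₊)
    rw [if_pos (Nat.lt_floor_add_one _).le]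
    apply ENNReal.ofReal_le_ofReal
    apply Real.exp_le_exp.2
    have := Nat.floor_le (dist_nonneg (x := (1:G)) (y := x))
    nlinarith
  refine ne_top_of_le_ne_top ?_ (ENNReal.tsum_le_tsum hle)
  rw [ENNReal.tsum_comm]
  have hb : ∀ n : ℕ, ∑' x : G, (if dist 1 x ≤ n + 1 then ENNReal.ofReal (Real.exp (-((c+1) * n))) else 0)
      ≤ ENNReal.ofReal (c * Real.exp c * Real.exp (-1) ^ n) := by
    intro n
    obtain ⟨hf, hcard⟩ := hgr (n + 1) (by positivity)
    have : ∑' x : G, (if dist 1 x ≤ n + 1 then ENNReal.ofReal (Real.exp (-((c+1) * n))) else 0)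
        = ∑ x ∈ hf.toFinset, ENNReal.ofReal (Real.exp (-((c+1) * n))) := by
      rw [tsum_eq_sum (s := hf.toFinset)]
      · refine Finset.sum_congr rfl fun x hx => ?_
        rw [if_pos]; simpa using hx
      · intro x hx; rw [if_neg]; simpa using hx
    rw [this, Finset.sum_const, nsmul_eq_mul, ← ENNReal.ofReal_natCast, ← ENNReal.ofReal_mul (by positivity)]
    apply ENNReal.ofReal_le_ofReal
    rw [← Set.ncard_eq_toFinset_card _ hf]
    calc _ ≤ c * Real.exp (c * (n + 1)) * Real.exp (-((c + 1) * n)) := by gcongr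
      _ = _ := by
        rw [← Real.exp_nat_mul, mul_assoc, mul_assoc, ← Real.exp_add, ← Real.exp_add]
        congr 2; ring
  refine ne_top_of_le_ne_top ?_ (ENNReal.tsum_le_tsum hb)
  rw [← ENNReal.ofReal_tsum_of_nonneg (fun n => by positivity)]
  · exact ENNReal.ofReal_ne_top
  · exact (summable_geometric_of_lt_one (Real.exp_pos _).le (by rw [Real.exp_lt_one_iff]; norm_num)).mul_left _

lemma ent_fin_G (hq : IsQIToWordMetric G) (hp : ∀ x, p x ≠ ∞)
    (hmom : FiniteFirstMoment p fun x => dist (1 : G) x) :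
    ∑' g, ENNReal.ofReal (Real.negMulLog (p g).toReal) ≠ ∞ := by
  obtain ⟨C, hC, hs⟩ := exp_summable hq
  refine ent_fin hp (fun x => C * dist 1 x) ?_ hs
  have : ∀ x, p x * ENNReal.ofReal (C * dist 1 x) = ENNReal.ofReal C * (p x * ENNReal.ofReal (dist 1 x)) := by
    intro x; rw [ENNReal.ofReal_mul hC]; ring
  simp only [this]
  rw [ENNReal.tsum_mul_left]
  exact ENNReal.mul_ne_top ENNReal.ofReal_ne_top hmom

lemma marg1 {r : G × G → ℝ≥0∞} (k : G) : ∑' h : G × G, (if h.1 = k then r h else 0) = ∑' y, r (k, y) := by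
  rw [ENNReal.tsum_prod']
  rw [tsum_eq_single k]
  · simp
  · intro b hb; simp [hb]

lemma marg2 {r : G × G → ℝ≥0∞} (k : G) : ∑' h : G × G, (if h.2 = k then r h else 0) = ∑' x, r (x, k) := by
  rw [ENNReal.tsum_prod']
  refine tsum_congr fun x => ?_
  rw [tsum_eq_single k]
  · simp
  · intro b hb; simp [hb]

lemma rho_add {ρ : ℝ} (hρ : ρ ∈ Set.Icc (0:ℝ) 1) : ENNReal.ofReal ρ + ENNReal.ofReal (1 - ρ) = 1 := by
  rw [← ENNReal.ofReal_add hρ.1 (by linarith [hρ.2])]; simp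

lemma pRho_marg1 (hp : IsProb p) {ρ : ℝ} (hρ : ρ ∈ Set.Icc (0:ℝ) 1) (k : G) :
    ∑' y, pRho p ρ (k, y) = p k := by
  have hp' : ∑' x, p x = 1 := hp
  unfold pRho
  dsimp only
  rw [ENNReal.tsum_add, ENNReal.tsum_mul_left, ENNReal.tsum_mul_left, ENNReal.tsum_mul_left, hp', mul_one,
    tsum_ite_eq' , ← add_mul, rho_add hρ, one_mul]

lemma pRho_marg2 (hp : IsProb p) {ρ : ℝ} (hρ : ρ ∈ Set.Icc (0:ℝ) 1) (k : G) :
    ∑' x, pRho p ρ (x, k) = p k := by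
  have hp' : ∑' x, p x = 1 := hp
  unfold pRho
  dsimp only
  rw [ENNReal.tsum_add, ENNReal.tsum_mul_left, ENNReal.tsum_mul_left, ENNReal.tsum_mul_right, hp', one_mul,
    tsum_ite_eq, ← add_mul, rho_add hρ, one_mul]

lemma ent_fin_pair (hq : IsQIToWordMetric G) {r : G × G → ℝ≥0∞}
    (hr : ∀ x, r x ≠ ∞) (h1 : ∀ k, ∑' y, r (k, y) = p k) (h2 : ∀ k, ∑' x, r (x, k) = p k)
    (hmom : FiniteFirstMoment p fun x => dist (1 : G) x) :
    ∑' g, ENNReal.ofReal (Real.negMulLog (r g).toReal) ≠ ∞ := by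
  obtain ⟨C, hC, hs⟩ := exp_summable hq
  refine ent_fin hr (fun x => C * dist 1 x.1 + C * dist 1 x.2) ?_ ?_
  · have : ∀ x : G × G, r x * ENNReal.ofReal (C * dist 1 x.1 + C * dist 1 x.2) =
      ENNReal.ofReal C * (r x * ENNReal.ofReal (dist 1 x.1)) +
        ENNReal.ofReal C * (r x * ENNReal.ofReal (dist 1 x.2)) := by
      intro x; rw [ENNReal.ofReal_add (by positivity) (by positivity), ENNReal.ofReal_mul hC,
        ENNReal.ofReal_mul hC]; ring
    simp only [this]
    rw [ENNReal.tsum_add, ENNReal.tsum_mul_left, ENNReal.tsum_mul_left]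
    refine ENNReal.add_ne_top.2 ⟨ENNReal.mul_ne_top ENNReal.ofReal_ne_top ?_,
      ENNReal.mul_ne_top ENNReal.ofReal_ne_top ?_⟩
    · rw [ENNReal.tsum_prod']
      simp only [ENNReal.tsum_mul_right, h1]
      exact hmom
    · rw [ENNReal.tsum_prod', ENNReal.tsum_comm]
      simp only [ENNReal.tsum_mul_right, h2]
      exact hmom
  · have : ∀ x : G × G, ENNReal.ofReal (Real.exp (-(C * dist 1 x.1 + C * dist 1 x.2))) =
      ENNReal.ofReal (Real.exp (-(C * dist 1 x.1))) * ENNReal.ofReal (Real.exp (-(C * dist 1 x.2))) := by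
      intro x
      rw [← ENNReal.ofReal_mul (by positivity), ← Real.exp_add]; congr 2; ring
    simp only [this]
    rw [ENNReal.tsum_prod']
    simp only [ENNReal.tsum_mul_left, ENNReal.tsum_mul_right]
    exact ENNReal.mul_ne_top hs hs

end G

end ModG1

section ModG2
set_option linter.unusedSectionVars false

section RW
variable {H : Type*} [Group H] [Countable H] [MeasurableSpace H] [DiscreteMeasurableSpace H]
  {p : H → ℝ≥0∞} {P : Measure (ℕ → H)}

lemma ent_conv (hP : IsRWMeasure p P) {h : ℝ} (hh : HasEntropy p h)
    (hfin : ∑' g, ENNReal.ofReal (Real.negMulLog (p g).toReal) ≠ ∞) {ε : ℝ} (hε : 0 < ε) :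
    ∀ᵐ ω ∂P, ∀ᶠ n : ℕ in atTop,
      ENNReal.ofReal (Real.exp (-(n * (h + ε)))) ≤ piN p n (walk ω n) ∧
      piN p n (walk ω n) ≤ ENNReal.ofReal (Real.exp (-(n * (h - ε)))) := by
  have hk := kingman (subadd_ent hP hfin) (c := h) (by
    simp only [int_entΦ_toReal hP]; exact hh) hε
  filter_upwards [hk] with ω hω
  filter_upwards [hω] with n ⟨h1, h2, h3⟩
  have h0 : piN p n (walk ω n) ≠ 0 := by
    intro h0; exact h1 (by simp [entΦ, h0])
  have hpos := ENNReal.toReal_pos h0 (piN_ne_top hP _ _)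
  have hle : (piN p n (walk ω n)).toReal ≤ 1 :=
    ENNReal.toReal_le_of_le_ofReal zero_le_one (by simpa using piN_le_one hP n _)
  have e : (entΦ p n (walk ω n)).toReal = -Real.log (piN p n (walk ω n)).toReal := by
    rw [entΦ, if_neg h0, ENNReal.toReal_ofReal]
    have := Real.log_nonpos hpos.le hle
    linarith
  rw [e] at h2 h3
  rw [← ENNReal.ofReal_toReal (piN_ne_top hP n (walk ω n))]
  constructor
  · apply ENNReal.ofReal_le_ofReal
    rw [← Real.le_log_iff_exp_le hpos]; linarith
  · apply ENNReal.ofReal_le_ofReal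
    rw [← Real.log_le_iff_le_exp hpos]; linarith
end RW

section G
variable {G : Type*} [Group G] [MetricSpace G] [Countable G] [MeasurableSpace G]
  [DiscreteMeasurableSpace G] {p : G → ℝ≥0∞} {P : Measure (ℕ → G)}

lemma step_small (hL : LeftInvariantMetric G) (hP : IsRWMeasure p P)
    (hmom : FiniteFirstMoment p fun x => dist (1 : G) x) {ε : ℝ} (hε : 0 < ε) :
    ∀ᵐ ω ∂P, ∀ᶠ n : ℕ in atTop, dist 1 (ω n) ≤ ε * n := by
  filter_upwards [(subadd_dist hL hP hmom).slln 1] with ω h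
  set I := (∫⁻ ω, distΦ 1 (walk ω 1) ∂P).toReal
  set S : ℕ → ℝ := fun j => ∑ k ∈ Finset.range j, (distΦ 1 (walk (shift (k * 1) ω) 1)).toReal with hS
  have hstep : ∀ n, dist 1 (ω n) = S (n + 1) - S n := by
    intro n
    simp only [hS, Finset.sum_range_succ, mul_one, add_sub_cancel_left]
    rw [walk_one, distΦ, ENNReal.toReal_ofReal dist_nonneg]; simp [shift]
  have h1 : Tendsto (fun n : ℕ => S (n + 1) / ((n + 1 : ℕ) : ℝ)) atTop (𝓝 I) := h.comp (tendsto_add_atTop_nat 1)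
  have h2 : Tendsto (fun n : ℕ => (1 : ℝ) + 1 / n) atTop (𝓝 (1 + 0)) :=
    tendsto_const_nhds.add (tendsto_const_div_atTop_nhds_zero_nat 1)
  have h3 := (h1.mul h2).sub h
  have e0 : I * (1 + 0) - I = 0 := by ring
  rw [e0] at h3
  filter_upwards [h3.eventually (gt_mem_nhds hε), eventually_gt_atTop 0] with n hn hn0
  have hn0 : (0:ℝ) < n := by exact_mod_cast hn0
  have e : S (n + 1) / ((n + 1 : ℕ) : ℝ) * (1 + 1 / n) - S n / n = (S (n + 1) - S n) / n := by
    push_cast; field_simp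
  have hn : S (n + 1) / ((n + 1 : ℕ) : ℝ) * (1 + 1 / n) - S n / n < ε := hn
  rw [e, ← hstep, div_lt_iff₀ hn0] at hn
  exact hn.le

lemma dist_conv (hL : LeftInvariantMetric G) (hP : IsRWMeasure p P)
    (hmom : FiniteFirstMoment p fun x => dist (1 : G) x) {l : ℝ}
    (hl : HasDrift p (fun x => dist (1 : G) x) l) {ε : ℝ} (hε : 0 < ε) :
    ∀ᵐ ω ∂P, ∀ᶠ n : ℕ in atTop, (l - ε) * n ≤ dist 1 (walk ω n) ∧ dist 1 (walk ω n) ≤ (l + ε) * n := by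
  have hk := kingman (subadd_dist hL hP hmom) (c := l) (by
    simp only [int_distΦ_toReal hP]; exact hl) hε
  filter_upwards [hk] with ω hω
  filter_upwards [hω] with n ⟨h1, h2, h3⟩
  rw [distΦ, ENNReal.toReal_ofReal dist_nonneg] at h2 h3
  exact ⟨h2, h3⟩

lemma track_walk (hG : IsHypGroupMetric G) (hP : IsRWMeasure p P)
    (hmom : FiniteFirstMoment p fun x => dist (1 : G) x) {l : ℝ}
    (hl : HasDrift p (fun x => dist (1 : G) x) l) {ε : ℝ} (hε : 0 < ε) :
    ∀ᵐ ω ∂P, ∀ᶠ n : ℕ in atTop, ∀ᶠ m : ℕ in atTop, (l - ε) * n ≤ gp 1 (walk ω n) (walk ω m) := by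
  obtain ⟨hL, ⟨δ, hδ, hX⟩, -⟩ := hG
  rcases le_or_gt (l - ε) 0 with h0 | h0
  · refine Eventually.of_forall fun ω => Eventually.of_forall fun n => Eventually.of_forall fun m => ?_
    exact (mul_nonpos_of_nonpos_of_nonneg h0 (Nat.cast_nonneg _)).trans (gp_nonneg _ _ _)
  obtain ⟨C, hC, htr⟩ := tracking hδ hX (1:G) (a := l - ε / 2) (by linarith)
  filter_upwards [dist_conv hL hP hmom hl (show 0 < ε / 4 by linarith),
    step_small hL hP hmom (show 0 < ε / 4 by linarith)] with ω h1 h2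
  obtain ⟨N, hN⟩ := eventually_atTop.1 (h1.and h2)
  have hdist : ∀ n, dist (walk ω n) (walk ω (n + 1)) = dist 1 (ω n) := by
    intro n; rw [walk_succ]; simpa using hL (walk ω n) 1 (ω n)
  have key : ∀ n, N ≤ n → ∀ m, n ≤ m → (l - ε / 2) * n - C ≤ gp 1 (walk ω n) (walk ω m) := by
    intro n hn m hm
    refine htr (walk ω) N m ?_ ?_ n m hn hm le_rfl
    · intro k hk _
      have := (hN k hk).1.1
      nlinarith [show (0:ℝ) ≤ k from Nat.cast_nonneg k]
    · intro k hk _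
      have h3 := (hN k hk).1.1
      have h4 := (hN k hk).2
      have h5 := gp_ge_sub 1 (walk ω k) (walk ω (k + 1))
      rw [hdist] at h5
      nlinarith [show (0:ℝ) ≤ k from Nat.cast_nonneg k]
  obtain ⟨N1, hN1⟩ := exists_nat_gt (C / (ε / 2))
  rw [div_lt_iff₀ (by linarith)] at hN1
  filter_upwards [eventually_ge_atTop N, eventually_ge_atTop N1] with n hn hn1
  filter_upwards [eventually_ge_atTop n] with m hm
  have := key n hn m hm
  have hn1 : (N1 : ℝ) ≤ n := by exact_mod_cast hn1
  nlinarith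

/-- Setting: a random walk on `G × G` with both marginals `p`. -/
structure Setting (p : G → ℝ≥0∞) (r : G × G → ℝ≥0∞) (P : Measure (ℕ → G × G))
    (bnd : (ℕ → G × G) → Boundary G (1:G) × Boundary G (1:G)) (l hμ hπ : ℝ) : Prop where
  hG : IsHypGroupMetric G
  hP : IsRWMeasure r P
  m1 : ∀ k, ∑' y, r (k, y) = p k
  m2 : ∀ k, ∑' x, r (x, k) = p k
  hmom : FiniteFirstMoment p fun x => dist (1 : G) x
  hl : HasDrift p (fun x => dist (1 : G) x) l
  hhμ : HasEntropy p hμ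
  hhπ : HasEntropy r hπ
  hlpos : 0 < l
  meas : Measurable bnd
  hb : ∀ᵐ ω ∂P, ∃ (h1 : IsDivergent (1:G) fun n => (walk ω n).1)
        (h2 : IsDivergent (1:G) fun n => (walk ω n).2), bnd ω = (mkB 1 ⟨_, h1⟩, mkB 1 ⟨_, h2⟩)

lemma rw_fst {r : G × G → ℝ≥0∞} {P : Measure (ℕ → G × G)} (hP : IsRWMeasure r P)
    (m1 : ∀ k, ∑' y, r (k, y) = p k) : IsRWMeasure p (P.map fun ω i => (ω i).1) :=
  rw_map hP (MonoidHom.fst G G) p fun k => by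
    rw [← m1]; exact marg1 k

lemma rw_snd {r : G × G → ℝ≥0∞} {P : Measure (ℕ → G × G)} (hP : IsRWMeasure r P)
    (m2 : ∀ k, ∑' x, r (x, k) = p k) : IsRWMeasure p (P.map fun ω i => (ω i).2) :=
  rw_map hP (MonoidHom.snd G G) p fun k => by
    rw [← m2]; exact marg2 k

lemma walk_fst (ω : ℕ → G × G) (n : ℕ) : walk (fun i => (ω i).1) n = (walk ω n).1 :=
  walk_map (MonoidHom.fst G G) ω n
lemma walk_snd (ω : ℕ → G × G) (n : ℕ) : walk (fun i => (ω i).2) n = (walk ω n).2 :=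
  walk_map (MonoidHom.snd G G) ω n

lemma Setting.good {r : G × G → ℝ≥0∞} {P : Measure (ℕ → G × G)}
    {bnd : (ℕ → G × G) → Boundary G (1:G) × Boundary G (1:G)} {l hμ hπ : ℝ}
    (S : Setting p r P bnd l hμ hπ) {ε : ℝ} (hε : 0 < ε) : ∀ᵐ ω ∂P, ∀ᶠ n : ℕ in atTop,
      (((bnd ω).1 ∈ Sh 1 (walk ω n).1 ((l - ε) * n) ∧ (bnd ω).2 ∈ Sh 1 (walk ω n).2 ((l - ε) * n)) ∧
      (dist 1 (walk ω n).1 ≤ (l + ε) * n ∧ dist 1 (walk ω n).2 ≤ (l + ε) * n)) ∧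
      ((ENNReal.ofReal (Real.exp (-(n * (hπ + ε)))) ≤ piN r n (walk ω n) ∧
        piN r n (walk ω n) ≤ ENNReal.ofReal (Real.exp (-(n * (hπ - ε))))) ∧
       (ENNReal.ofReal (Real.exp (-(n * (hμ + ε)))) ≤ piN p n (walk ω n).2 ∧
        piN p n (walk ω n).2 ≤ ENNReal.ofReal (Real.exp (-(n * (hμ - ε)))))) := by
  have hL := S.hG.1
  have hq := S.hG.2.2
  have P1 := rw_fst S.hP S.m1
  have P2 := rw_snd S.hP S.m2
  have hr : ∀ x, r x ≠ ∞ := fun x => by rw [← piN_one S.hP]; exact piN_ne_top S.hP _ _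
  have hp : ∀ x, p x ≠ ∞ := fun x => by rw [← piN_one P1]; exact piN_ne_top P1 _ _
  have mm1 : Measurable fun (ω : ℕ → G × G) i => (ω i).1 := meas_letters (MonoidHom.fst G G)
  have mm2 : Measurable fun (ω : ℕ → G × G) i => (ω i).2 := meas_letters (MonoidHom.snd G G)
  have a1 := ae_of_ae_map mm1.aemeasurable (dist_conv hL P1 S.hmom S.hl hε)
  have a2 := ae_of_ae_map mm2.aemeasurable (dist_conv hL P2 S.hmom S.hl hε)
  have b1 := ae_of_ae_map mm1.aemeasurable (track_walk S.hG P1 S.hmom S.hl hε)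
  have b2 := ae_of_ae_map mm2.aemeasurable (track_walk S.hG P2 S.hmom S.hl hε)
  have c1 := ent_conv S.hP S.hhπ (ent_fin_pair hq hr S.m1 S.m2 S.hmom) hε
  have c2 := ae_of_ae_map mm2.aemeasurable (ent_conv P2 S.hhμ (ent_fin_G hq hp S.hmom) hε)
  simp only [walk_fst, walk_snd] at a1 a2 b1 b2 c2
  filter_upwards [a1, a2, b1, b2, c1, c2, S.hb] with ω a1 a2 b1 b2 c1 c2 ⟨d1, d2, hbω⟩
  filter_upwards [a1, a2, b1, b2, c1, c2] with n a1 a2 b1 b2 c1 c2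
  rw [hbω]
  exact ⟨⟨⟨⟨_, rfl, b1⟩, ⟨_, rfl, b2⟩⟩, a1.2, a2.2⟩, c1, c2⟩

/-- the unconditional theorem -/
lemma Setting.uncond {r : G × G → ℝ≥0∞} {P : Measure (ℕ → G × G)}
    {bnd : (ℕ → G × G) → Boundary G (1:G) × Boundary G (1:G)} {l hμ hπ : ℝ}
    (S : Setting p r P bnd l hμ hπ) :
    ExactDim (qbb (1:G) (1:G)) (P.map bnd) (hπ / l) ∧ HasDim (qbb (1:G) (1:G)) (P.map bnd) (hπ / l) := by
  have := S.hP.1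
  obtain ⟨h0, hE, hpos⟩ := core S.hG P bnd S.meas (fun n ω => walk ω n) (fun n g => meas_walk_eq n g)
    l hπ S.hlpos (by
      intro ε hε
      filter_upwards [S.good hε] with ω hω
      filter_upwards [hω] with n ⟨⟨h1, h2⟩, h3, h4⟩
      refine ⟨h1, h2, ?_⟩
      rw [law_walk S.hP]; exact h3)
  refine ⟨hE, ?_⟩
  obtain ⟨a, B, hB, hcov⟩ := cover_pair S.hG
  obtain ⟨-, ⟨δ, hδ, hX⟩, -⟩ := S.hG
  have : IsProbabilityMeasure (P.map bnd) := Measure.isProbabilityMeasure_map S.meas.aemeasurable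
  exact hasDim_of_exactDim (qbb_quasi hδ hX) (fun x r => meas_qball_qbb x r) _ hE hpos hB hcov
end G

end ModG2

section ModG3
set_option linter.unusedSectionVars false

section Dis
variable {A B : Type*} [MeasurableSpace A] [MeasurableSpace B] {ν : Measure A} [IsProbabilityMeasure ν]
  {f : A → B} {νB : Measure B} {cond : B → Measure A}

lemma dis_prob (hf : Measurable f) (hd : IsDisintegration ν f νB cond) : IsProbabilityMeasure νB := by
  rw [hd.1]; exact Measure.isProbabilityMeasure_map hf.aemeasurable

lemma dis_aem (hf : Measurable f) (hd : IsDisintegration ν f νB cond) {s : Set A} (hs : MeasurableSet s) :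
    AEMeasurable (fun b => cond b s) νB := by
  have := dis_prob hf hd
  obtain ⟨g1, hg1, hl1, hi1⟩ := exists_measurable_le_lintegral_eq νB (fun b => cond b s)
  obtain ⟨g2, hg2, hl2, hi2⟩ := exists_measurable_le_lintegral_eq νB (fun b => cond b sᶜ)
  have hsum : ∀ᵐ b ∂νB, cond b s + cond b sᶜ = 1 := by
    filter_upwards [hd.2.1] with b hb
    rw [measure_add_measure_compl hs, measure_univ]
  have hle : (fun b => g1 b + g2 b) ≤ᵐ[νB] fun _ => 1 := by
    filter_upwards [hsum] with b hb
    rw [← hb]; exact add_le_add (hl1 b) (hl2 b)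
  have hintg : ∫⁻ b, g1 b + g2 b ∂νB = 1 := by
    rw [lintegral_add_left hg1, ← hi1, ← hi2, ← hd.2.2.2 s hs, ← hd.2.2.2 _ hs.compl,
      measure_add_measure_compl hs, measure_univ]
  have heq := ae_eq_of_ae_le_of_lintegral_le hle (by rw [hintg]; simp) aemeasurable_const (by rw [hintg]; simp)
  refine ⟨g1, hg1, ?_⟩
  filter_upwards [hsum, heq] with b h1 h2
  refine le_antisymm ?_ (hl1 b)
  have h3 : cond b s + cond b sᶜ ≤ g1 b + cond b sᶜ := by
    rw [h1, ← h2]; exact add_le_add le_rfl (hl2 b)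
  refine (ENNReal.add_le_add_iff_right ?_).1 h3
  refine ne_top_of_le_ne_top ENNReal.one_ne_top ?_
  rw [← h1]; exact le_add_self

lemma dis_set (hf : Measurable f) (hd : IsDisintegration ν f νB cond) {s : Set A} (hs : MeasurableSet s)
    {E : Set B} (hE : MeasurableSet E) : ∫⁻ b in E, cond b s ∂νB = ν (s ∩ f ⁻¹' E) := by
  rw [hd.2.2.2 _ (hs.inter (hf hE)), ← lintegral_indicator hE]
  apply lintegral_congr_ae
  filter_upwards [hd.2.1, hd.2.2.1] with b hb hb1
  by_cases h : b ∈ E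
  · rw [Set.indicator_of_mem h]
    have : cond b (f ⁻¹' E) = 1 := le_antisymm prob_le_one (by
      rw [← hb1]; exact measure_mono (Set.preimage_mono (by simpa using h)))
    exact (measure_inter_conull ((prob_compl_eq_zero_iff (hf hE)).2 this)).symm
  · rw [Set.indicator_of_notMem h]
    have : cond b (f ⁻¹' Eᶜ) = 1 := le_antisymm prob_le_one (by
      rw [← hb1]; exact measure_mono (Set.preimage_mono (by simpa using h)))
    have h0 := (prob_compl_eq_zero_iff (hf hE.compl)).2 this
    symm
    refine measure_mono_null ?_ h0
    intro x hx
    simp at hx ⊢; exact hx.2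

lemma dis_lint (hf : Measurable f) (hd : IsDisintegration ν f νB cond) {F : A → ℝ≥0∞} (hF : Measurable F) :
    AEMeasurable (fun b => ∫⁻ a, F a ∂cond b) νB ∧
      ∀ E, MeasurableSet E → ∫⁻ b in E, ∫⁻ a, F a ∂cond b ∂νB = ∫⁻ a in f ⁻¹' E, F a ∂ν := by
  refine Measurable.ennreal_induction (motive := fun F => AEMeasurable (fun b => ∫⁻ a, F a ∂cond b) νB ∧
      ∀ E, MeasurableSet E → ∫⁻ b in E, ∫⁻ a, F a ∂cond b ∂νB = ∫⁻ a in f ⁻¹' E, F a ∂ν) ?_ ?_ ?_ hF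
  · intro c s hs
    simp only [lintegral_indicator hs, lintegral_const, Measure.restrict_apply MeasurableSet.univ, univ_inter]
    refine ⟨(dis_aem hf hd hs).const_mul c, fun E hE => ?_⟩
    rw [lintegral_const_mul'' _ (dis_aem hf hd hs).restrict, dis_set hf hd hs hE,
      Measure.restrict_apply hs]
  · intro F F' _ hF hF' h h'
    simp only [Pi.add_apply, lintegral_add_left hF]
    refine ⟨h.1.add h'.1, fun E hE => ?_⟩
    rw [lintegral_add_left' h.1.restrict, h.2 E hE, h'.2 E hE]
  · intro F hF hm h
    simp only [lintegral_iSup hF hm]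
    refine ⟨AEMeasurable.iSup fun n => (h n).1, fun E hE => ?_⟩
    rw [lintegral_iSup' (fun n => (h n).1.restrict)
      (Eventually.of_forall fun b i j hij => lintegral_mono (hm hij))]
    exact iSup_congr fun n => (h n).2 E hE

lemma dis_ae (hf : Measurable f) (hd : IsDisintegration ν f νB cond) {Q : A → Prop}
    (hQ : ∀ᵐ a ∂ν, Q a) : ∀ᵐ b ∂νB, ∀ᵐ a ∂cond b, Q a := by
  obtain ⟨N, hN, hNm, hN0⟩ := exists_measurable_superset_of_null (ae_iff.1 hQ)
  have h1 := hd.2.2.2 N hNm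
  rw [hN0] at h1
  have h2 := (lintegral_eq_zero_iff' (dis_aem hf hd hNm)).1 h1.symm
  filter_upwards [h2] with b hb
  rw [ae_iff]
  exact measure_mono_null hN hb
end Dis

section Lift
variable {Ω A B : Type*} [MeasurableSpace Ω] [StandardBorelSpace Ω] [Nonempty Ω] [MeasurableSpace A]
  [MeasurableSpace B] {P : Measure Ω} [IsProbabilityMeasure P] {X : Ω → A}
  {f : A → B} {νB : Measure B} {cond : B → Measure A}

/-- lifted conditional measures on the path space -/
def lift (P : Measure Ω) [IsProbabilityMeasure P] (X : Ω → A) (cond : B → Measure A) (b : B) : Measure Ω :=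
  (cond b).bind (ProbabilityTheory.condDistrib id X P)

lemma lift_apply (b : B) {s : Set Ω} (hs : MeasurableSet s) :
    lift P X cond b s = ∫⁻ a, ProbabilityTheory.condDistrib id X P a s ∂cond b :=
  Measure.bind_apply hs (ProbabilityTheory.Kernel.measurable _).aemeasurable

lemma lift_prob (hd : IsDisintegration (P.map X) f νB cond) : ∀ᵐ b ∂νB, IsProbabilityMeasure (lift P X cond b) := by
  filter_upwards [hd.2.1] with b hb
  refine ⟨?_⟩
  rw [lift_apply b MeasurableSet.univ]
  simp

lemma lift_int (hX : Measurable X) (hf : Measurable f) (hd : IsDisintegration (P.map X) f νB cond)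
    {s : Set Ω} (hs : MeasurableSet s) :
    AEMeasurable (fun b => lift P X cond b s) νB ∧
      ∀ E, MeasurableSet E → ∫⁻ b in E, lift P X cond b s ∂νB = P (s ∩ X ⁻¹' (f ⁻¹' E)) := by
  have : IsProbabilityMeasure (P.map X) := Measure.isProbabilityMeasure_map hX.aemeasurable
  simp only [lift_apply _ hs]
  have h := dis_lint hf hd (F := fun a => ProbabilityTheory.condDistrib id X P a s)
    (ProbabilityTheory.Kernel.measurable_coe _ hs)
  refine ⟨h.1, fun E hE => ?_⟩
  rw [h.2 E hE]
  have hc : (P.map X).compProd (ProbabilityTheory.condDistrib id X P) = P.map (fun a => (X a, id a)) :=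
      ProbabilityTheory.compProd_map_condDistrib measurable_id.aemeasurable
  have h2 := congrArg (fun m => m ((f ⁻¹' E) ×ˢ s)) hc
  rw [Measure.compProd_apply_prod (hf hE) hs, Measure.map_apply (hX.prodMk measurable_id) ((hf hE).prod hs)] at h2
  rw [h2]
  congr 1
  ext ω; simp [and_comm]

lemma lift_ae (hX : Measurable X) (hf : Measurable f) (hd : IsDisintegration (P.map X) f νB cond)
    {Q : Ω → Prop} (hQ : ∀ᵐ a ∂P, Q a) : ∀ᵐ b ∂νB, ∀ᵐ a ∂(lift P X cond b), Q a := by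
  obtain ⟨N, hN, hNm, hN0⟩ := exists_measurable_superset_of_null (ae_iff.1 hQ)
  obtain ⟨h0, h1⟩ := lift_int hX hf hd hNm
  have h1 := h1 univ MeasurableSet.univ
  rw [Measure.restrict_univ, measure_inter_null_of_null_left _ hN0] at h1
  have h2 := (lintegral_eq_zero_iff' h0).1 h1
  filter_upwards [h2] with b hb
  rw [ae_iff]
  exact measure_mono_null hN hb

lemma lift_map (hX : Measurable X) (hf : Measurable f) (hd : IsDisintegration (P.map X) f νB cond)
    (hg : MeasurableSet {z : A × A | z.1 = z.2}) :
    ∀ᵐ b ∂νB, (lift P X cond b).map X = cond b := by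
  have : IsProbabilityMeasure (P.map X) := Measure.isProbabilityMeasure_map hX.aemeasurable
  set κ := ProbabilityTheory.condDistrib id X P with hκ
  have hgr : MeasurableSet {z : A × Ω | z.1 = X z.2} :=
    (measurable_fst.prodMk (hX.comp measurable_snd)) hg
  have h1 : ∀ᵐ a ∂(P.map X), κ a {ω | a = X ω} = 1 := by
    have hc : (P.map X).compProd (ProbabilityTheory.condDistrib id X P) = P.map (fun a => (X a, id a)) :=
      ProbabilityTheory.compProd_map_condDistrib measurable_id.aemeasurable
    have h2 := congrArg (fun m => m {z : A × Ω | z.1 = X z.2}ᶜ) hc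
    rw [Measure.compProd_apply hgr.compl, Measure.map_apply (hX.prodMk measurable_id) hgr.compl] at h2
    have e : (fun a => (X a, id a)) ⁻¹' {z : A × Ω | z.1 = X z.2}ᶜ = ∅ := by
      ext ω; simp
    rw [e, measure_empty, lintegral_eq_zero_iff (ProbabilityTheory.Kernel.measurable_kernel_prodMk_left hgr.compl)] at h2
    filter_upwards [h2] with a ha
    have hm : MeasurableSet {ω | a = X ω} := measurable_prodMk_left hgr
    exact (prob_compl_eq_zero_iff hm).1 ha
  filter_upwards [dis_ae hf hd h1] with b hb
  ext s hs
  rw [Measure.map_apply hX hs, lift_apply b (hX hs)]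
  have : ∀ᵐ a ∂cond b, κ a (X ⁻¹' s) = s.indicator 1 a := by
    filter_upwards [hb] with a ha
    by_cases h : a ∈ s
    · rw [Set.indicator_of_mem h]
      refine le_antisymm prob_le_one ?_
      rw [Pi.one_apply, ← ha]
      refine measure_mono fun ω hω => ?_
      have : a = X ω := hω
      simpa [← this] using h
    · rw [Set.indicator_of_notMem h]
      have hm : MeasurableSet {ω | a = X ω} := measurable_prodMk_left hgr
      refine measure_mono_null ?_ ((prob_compl_eq_zero_iff hm).2 ha)
      intro ω hω h2
      have : a = X ω := h2
      rw [Set.mem_preimage, ← this] at hω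
      exact h hω
  rw [lintegral_congr_ae this, lintegral_indicator_one hs]
end Lift

section G
variable {G : Type*} [Group G] [MetricSpace G]

lemma meas_singleton_B (hG : IsHypGroupMetric G) (η : Boundary G (1:G)) : MeasurableSet {η} := by
  have h := meas_graph hG
  have hm : Measurable fun x : Boundary G (1:G) => (((η, η), (η, x)) :
      (Boundary G (1 : G) × Boundary G (1 : G)) × (Boundary G (1 : G) × Boundary G (1 : G))) := by
    fun_prop
  have := hm h
  convert this using 1
  ext x; simp [eq_comm]

lemma tend_add (n : ℕ) : Tendsto (fun k : ℕ => n + k) atTop atTop :=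
  Filter.tendsto_atTop_mono (fun k => Nat.le_add_left k n) tendsto_id

lemma tail_div {u : ℕ → G} (h : IsDivergent (1:G) u) (n : ℕ) : IsDivergent (1:G) fun k => u (n + k) := by
  have h' : Tendsto (fun pr : ℕ × ℕ => gp 1 (u pr.1) (u pr.2)) (atTop ×ˢ atTop) atTop := by
    rw [prod_atTop_atTop_eq]; exact h
  have ht : Tendsto (fun pr : ℕ × ℕ => (n + pr.1, n + pr.2)) (atTop ×ˢ atTop) (atTop ×ˢ atTop) :=
    (tend_add n).prodMap (tend_add n)
  have h2 := h'.comp ht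
  rw [prod_atTop_atTop_eq] at h2
  exact h2

lemma tail_mk {u : ℕ → G} (h : IsDivergent (1:G) u) (n : ℕ) :
    mkB (1:G) ⟨fun k => u (n + k), tail_div h n⟩ = mkB 1 ⟨u, h⟩ := by
  have h' : Tendsto (fun pr : ℕ × ℕ => gp 1 (u pr.1) (u pr.2)) (atTop ×ˢ atTop) atTop := by
    rw [prod_atTop_atTop_eq]; exact h
  have ht : Tendsto (fun pr : ℕ × ℕ => (n + pr.1, pr.2)) (atTop ×ˢ atTop) (atTop ×ˢ atTop) :=
    (tend_add n).prodMap tendsto_id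
  have h2 := h'.comp ht
  rw [prod_atTop_atTop_eq] at h2
  exact Quot.sound h2
end G

end ModG3

section ModG4
set_option linter.unusedSectionVars false

section G
variable {G : Type*} [Group G] [MetricSpace G] [Countable G] [MeasurableSpace G] [DiscreteMeasurableSpace G]
  {p : G → ℝ≥0∞} {r : G × G → ℝ≥0∞} {P : Measure (ℕ → G × G)}
    {bnd : (ℕ → G × G) → Boundary G (1:G) × Boundary G (1:G)} {l hμ hπ : ℝ}

lemma mkB_eqf {u v : ℕ → G} (e : u = v) (hu : IsDivergent (1:G) u) (hv : IsDivergent (1:G) v) :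
    mkB (1:G) ⟨u, hu⟩ = mkB 1 ⟨v, hv⟩ := by
  subst e; rfl

def Cset (E : Set (Boundary G (1:G))) (a : G) : Set (ℕ → G × G) :=
  {ω | ∃ h : IsDivergent (1:G) fun k => a * (walk ω k).2, mkB 1 ⟨_, h⟩ ∈ E}

lemma markov1 (S : Setting p r P bnd l hμ hπ) (n : ℕ) (g : G × G) {E : Set (Boundary G (1:G))}
    (hE : MeasurableSet E) :
    P ({ω | walk ω n = g} ∩ bnd ⁻¹' (Prod.snd ⁻¹' E)) = piN r n g * P (Cset E g.2) := by
  have := S.hP.1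
  have hm : MeasurableSet (bnd ⁻¹' (Prod.snd ⁻¹' E)) := S.meas (measurable_snd hE)
  have hb : ∀ᵐ ω ∂((P.prod P).map (cat n)), ∃ (h1 : IsDivergent (1:G) fun n => (walk ω n).1)
        (h2 : IsDivergent (1:G) fun n => (walk ω n).2), bnd ω = (mkB 1 ⟨_, h1⟩, mkB 1 ⟨_, h2⟩) := by
    rw [cat_map S.hP n]; exact S.hb
  have hb' := ae_of_ae_map (meas_cat n).aemeasurable hb
  rw [← law_walk S.hP, ← Measure.prod_prod]
  conv_lhs => rw [← cat_map S.hP n]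
  rw [Measure.map_apply (meas_cat n) ((meas_walk_eq n g).inter hm)]
  apply measure_congr
  filter_upwards [hb'] with z ⟨h1, h2, hz⟩
  apply propext
  show (walk (cat n z) n = g ∧ (bnd (cat n z)).2 ∈ E) ↔ (walk z.1 n = g ∧ z.2 ∈ Cset E g.2)
  rw [walk_cat le_rfl]
  refine and_congr_right fun hg => ?_
  have hf : (fun k => (walk (cat n z) (n + k)).2) = fun k => g.2 * (walk z.2 k).2 := by
    funext k
    rw [walk_add, walk_cat le_rfl, shift_cat, hg, Prod.snd_mul]
  have e1 := tail_mk h2 n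
  have e2 := tail_div h2 n
  rw [hz]
  simp only [Cset, Set.mem_ofPred_eq]
  rw [← e1]
  constructor
  · intro h
    exact ⟨hf ▸ e2, mkB_eqf hf e2 (hf ▸ e2) ▸ h⟩
  · rintro ⟨h', h⟩
    rw [mkB_eqf hf e2 h']; exact h

lemma snd_sum (n : ℕ) (a : G) {A : Set (ℕ → G × G)} (hA : MeasurableSet A) :
    P ({ω | (walk ω n).2 = a} ∩ A) = ∑' x, P ({ω | walk ω n = (x, a)} ∩ A) := by
  rw [← measure_iUnion]
  · congr 1; ext ω; simp [Prod.ext_iff]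
  · intro g h hgh
    rw [Function.onFun, Set.disjoint_left]
    rintro ω ⟨h1, -⟩ ⟨h2, -⟩
    simp only [Set.mem_ofPred_eq] at h1 h2
    rw [h1] at h2
    exact hgh (congrArg Prod.fst h2)
  · intro g; exact (meas_walk_eq n _).inter hA

lemma law_snd (S : Setting p r P bnd l hμ hπ) (n : ℕ) (a : G) : P {ω | (walk ω n).2 = a} = piN p n a := by
  have P2 := rw_snd S.hP S.m2
  have mm2 : Measurable fun (ω : ℕ → G × G) i => (ω i).2 := meas_letters (MonoidHom.snd G G)
  rw [← law_walk P2, Measure.map_apply mm2 (meas_walk_eq n a)]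
  congr 1; ext ω; simp [walk_snd]

lemma markov2 (S : Setting p r P bnd l hμ hπ) (n : ℕ) (g : G × G) {E : Set (Boundary G (1:G))}
    (hE : MeasurableSet E) :
    P ({ω | walk ω n = g} ∩ bnd ⁻¹' (Prod.snd ⁻¹' E)) * piN p n g.2 =
      piN r n g * P ({ω | (walk ω n).2 = g.2} ∩ bnd ⁻¹' (Prod.snd ⁻¹' E)) := by
  have h1 : ∑' x, piN r n (x, g.2) = piN p n g.2 := by
    rw [← law_snd S, ← Set.inter_univ {ω | _}, snd_sum n g.2 MeasurableSet.univ]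
    simp only [Set.inter_univ, law_walk S.hP]
  rw [snd_sum n g.2 (S.meas (measurable_snd hE))]
  simp only [markov1 S n _ hE, ENNReal.tsum_mul_right, h1]
  ring

lemma markov3 (S : Setting p r P bnd l hμ hπ) {νs : Measure (Boundary G (1:G))}
    {cond : Boundary G (1:G) → Measure (Boundary G (1:G) × Boundary G (1:G))}
    (hd : IsDisintegration (P.map bnd) Prod.snd νs cond) [IsProbabilityMeasure P] :
    ∀ᵐ η ∂νs, ∀ (n : ℕ) (g : G × G),
      lift P bnd cond η {ω | walk ω n = g} * piN p n g.2 =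
        piN r n g * lift P bnd cond η {ω | (walk ω n).2 = g.2} := by
  rw [ae_all_iff]; intro n
  rw [ae_all_iff]; intro g
  have : IsProbabilityMeasure (P.map bnd) := Measure.isProbabilityMeasure_map S.meas.aemeasurable
  have : IsProbabilityMeasure νs := dis_prob measurable_snd hd
  have hs2 : MeasurableSet {ω : ℕ → G × G | (walk ω n).2 = g.2} :=
    meas_walk n (MeasurableSet.of_discrete (s := {x : G × G | x.2 = g.2}))
  obtain ⟨m1, i1⟩ := lift_int S.meas measurable_snd hd (meas_walk_eq n g)
  obtain ⟨m2, i2⟩ := lift_int S.meas measurable_snd hd hs2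
  refine AEMeasurable.ae_eq_of_forall_setLIntegral_eq (m1.mul_const _) (m2.const_mul _) ?_ ?_ ?_
  · rw [lintegral_mul_const'' _ m1]
    have := i1 univ MeasurableSet.univ
    rw [Measure.restrict_univ] at this
    rw [this]
    have P2 := rw_snd S.hP S.m2
    exact ENNReal.mul_ne_top (measure_ne_top _ _) (piN_ne_top P2 _ _)
  · rw [lintegral_const_mul'' _ m2]
    have := i2 univ MeasurableSet.univ
    rw [Measure.restrict_univ] at this
    rw [this]
    exact ENNReal.mul_ne_top (piN_ne_top S.hP _ _) (measure_ne_top _ _)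
  · intro E hE _
    rw [lintegral_mul_const'' _ m1.restrict, lintegral_const_mul'' _ m2.restrict, i1 E hE, i2 E hE]
    exact markov2 S n g hE
end G

end ModG4

section ModG5
set_option linter.unusedSectionVars false

section G
variable {G : Type*} [Group G] [MetricSpace G] [Countable G]

lemma ball_count (hL : LeftInvariantMetric G) {c : ℝ}
    (hgr : ∀ R : ℝ, 0 ≤ R → {g : G | dist (1 : G) g ≤ R}.Finite ∧
      ({g : G | dist (1 : G) g ≤ R}.ncard : ℝ) ≤ c * Real.exp (c * R)) (g0 : G) {R : ℝ} (hR : 0 ≤ R) :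
    ∃ T : Finset G, (∀ g, dist g0 g ≤ R → g ∈ T) ∧ (T.card : ℝ) ≤ c * Real.exp (c * R) := by
  obtain ⟨hf, hn⟩ := hgr R hR
  refine ⟨hf.toFinset.image (fun x => g0 * x), ?_, ?_⟩
  · intro g hg
    rw [Finset.mem_image]
    refine ⟨g0⁻¹ * g, ?_, by group⟩
    rw [Set.Finite.mem_toFinset]
    show dist 1 (g0⁻¹ * g) ≤ R
    rw [← hL g0 1 (g0⁻¹ * g)]
    simpa using hg
  · refine le_trans ?_ hn
    rw [Set.ncard_eq_toFinset_card _ hf]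
    exact_mod_cast Finset.card_image_le

/-- basic good event -/
def Basic {Ω : Type*} (b : Ω → Boundary G (1 : G) × Boundary G (1 : G)) (w : ℕ → Ω → G × G)
    (π : ℕ → G × G → ℝ≥0∞) (m : ℕ → G → ℝ≥0∞) (l hπ hμ ε : ℝ) (n : ℕ) (ω : Ω) : Prop :=
      (((b ω).1 ∈ Sh 1 (w n ω).1 ((l - ε) * n) ∧ (b ω).2 ∈ Sh 1 (w n ω).2 ((l - ε) * n)) ∧
      (dist 1 (w n ω).1 ≤ (l + ε) * n ∧ dist 1 (w n ω).2 ≤ (l + ε) * n)) ∧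
      ((ENNReal.ofReal (Real.exp (-(n * (hπ + ε)))) ≤ π n (w n ω) ∧
        π n (w n ω) ≤ ENNReal.ofReal (Real.exp (-(n * (hπ - ε))))) ∧
       (ENNReal.ofReal (Real.exp (-(n * (hμ + ε)))) ≤ m n (w n ω).2 ∧
        m n (w n ω).2 ≤ ENNReal.ofReal (Real.exp (-(n * (hμ - ε))))))

lemma cond_good (hG : IsHypGroupMetric G) : ∃ K : ℝ, 1 ≤ K ∧
    ∀ {Ω : Type*} [MeasurableSpace Ω] (M : Measure Ω) [IsProbabilityMeasure M]
    (b : Ω → Boundary G (1 : G) × Boundary G (1 : G)) (w : ℕ → Ω → G × G)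
    (π : ℕ → G × G → ℝ≥0∞) (m : ℕ → G → ℝ≥0∞) (l hπ hμ ε ε' : ℝ) (η : Boundary G (1:G))
    (_ : 0 < ε') (_ : K * ε' ≤ ε) (_ : ∀ᵐ ω ∂M, (b ω).2 = η)
    (_ : ∀ᵐ ω ∂M, ∀ᶠ n in atTop, Basic b w π m l hπ hμ ε' n ω)
    (_ : ∀ n g, M {ω | w n ω = g} * m n g.2 = π n g * M {ω | (w n ω).2 = g.2}),
    ∀ᵐ ω ∂M, ∀ᶠ n in atTop, GoodAt M b w l (hπ - hμ) ε n ω := by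
  obtain ⟨hL, ⟨δ, hδ, hX⟩, hq⟩ := hG
  obtain ⟨c, hc, hgr⟩ := growth hq
  refine ⟨4 * c + 4, by linarith, ?_⟩
  intro Ω _ M _ b w π m l hπ hμ ε ε' η hε' hK hη hbas hid
  set θ := (4 * c + 2) * ε' with hθ
  obtain ⟨N0, hN0⟩ : ∃ N0 : ℕ, ∀ n ≥ N0, c * Real.exp (4 * c * δ) ≤ Real.exp (n * ε') := by
    have : Tendsto (fun n : ℕ => Real.exp (n * ε')) atTop atTop :=
      Real.tendsto_exp_atTop.comp (tendsto_natCast_atTop_atTop.atTop_mul_const hε')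
    exact eventually_atTop.1 (this.eventually_ge_atTop _)
  set S : ℕ → Set Ω := fun n => {ω | (b ω).2 = η ∧ Basic b w π m l hπ hμ ε' n ω} with hS
  set B : ℕ → Set Ω := fun n => {ω | N0 ≤ n ∧ ω ∈ S n ∧
    M {ω' | (w n ω').2 = (w n ω).2} < ENNReal.ofReal (Real.exp (-(n * θ)))} with hB
  have hBC := borel_cantelli_exp M (B := B) hε' (by
    intro n
    rcases Set.eq_empty_or_nonempty (B n) with he | ⟨ω0, hω0⟩
    · rw [he]; simp
    obtain ⟨hn0, hs0, -⟩ := hω0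
    obtain ⟨T, hT, hTc⟩ := ball_count hL hgr (w n ω0).2 (R := 4 * ε' * n + 4 * δ) (by positivity)
    have hmem : ∀ ω ∈ B n, (w n ω).2 ∈ T := by
      rintro ω ⟨-, hs, -⟩
      apply hT
      have h1 := hs0.2.1.1.2
      have h2 := hs.2.1.1.2
      rw [hs0.1] at h1
      rw [hs.1] at h2
      have h3 := gp_of_Sh hX h1 h2
      rw [dist_eq_gp 1]
      have h4 := hs0.2.1.2.2
      have h5 := hs.2.1.2.2
      nlinarith
    have hsub : B n ⊆ ⋃ g ∈ T, B n ∩ {ω | (w n ω).2 = g} := by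
      intro ω hω
      simp only [Set.mem_iUnion]
      exact ⟨_, hmem ω hω, hω, rfl⟩
    calc M (B n) ≤ ∑ g ∈ T, M (B n ∩ {ω | (w n ω).2 = g}) :=
          (measure_mono hsub).trans (measure_biUnion_finset_le _ _)
      _ ≤ ∑ g ∈ T, ENNReal.ofReal (Real.exp (-(n * θ))) := by
          refine Finset.sum_le_sum fun g _ => ?_
          rcases Set.eq_empty_or_nonempty (B n ∩ {ω | (w n ω).2 = g}) with he | ⟨ω, hω, hg⟩
          · rw [he]; simp
          · refine (measure_mono Set.inter_subset_right).trans ?_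
            have := hω.2.2.le
            have hg : (w n ω).2 = g := hg
            rwa [hg] at this
      _ = ENNReal.ofReal (T.card * Real.exp (-(n * θ))) := by
          rw [Finset.sum_const, nsmul_eq_mul, ENNReal.ofReal_mul (by positivity), ENNReal.ofReal_natCast]
      _ ≤ ENNReal.ofReal (Real.exp (-(n * ε'))) := by
          apply ENNReal.ofReal_le_ofReal
          calc (T.card : ℝ) * Real.exp (-(n * θ)) ≤ c * Real.exp (c * (4 * ε' * n + 4 * δ)) * Real.exp (-(n * θ)) := by
                gcongr
            _ = (c * Real.exp (4 * c * δ)) * Real.exp (- (2 * (n * ε'))) := by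
                rw [mul_assoc c, ← Real.exp_add, mul_assoc c, ← Real.exp_add, hθ]; congr 2; ring
            _ ≤ Real.exp (n * ε') * Real.exp (- (2 * (n * ε'))) := by
                gcongr; exact hN0 n hn0
            _ = Real.exp (-(n * ε')) := by rw [← Real.exp_add]; ring_nf)
  filter_upwards [hη, hbas, hBC] with ω h1 h2 h3
  filter_upwards [h2, h3, eventually_ge_atTop N0] with n h2 h3 hn
  have hlow : ENNReal.ofReal (Real.exp (-(n * θ))) ≤ M {ω' | (w n ω').2 = (w n ω).2} := by
    by_contra hcon
    exact h3 ⟨hn, ⟨h1, h2⟩, not_le.1 hcon⟩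
  have hup : M {ω' | (w n ω').2 = (w n ω).2} ≤ 1 := prob_le_one
  obtain ⟨⟨⟨s1, s2⟩, d1, d2⟩, ⟨p1, p2⟩, q1, q2⟩ := h2
  have hεε : ε' ≤ ε := by nlinarith
  have hid := hid n (w n ω)
  have hn' : (0:ℝ) ≤ n := Nat.cast_nonneg n
  have hmt : m n (w n ω).2 ≠ ∞ := ne_top_of_le_ne_top ENNReal.ofReal_ne_top q2
  have hm0 : m n (w n ω).2 ≠ 0 := by
    intro h0
    rw [h0] at q1
    have := (ENNReal.ofReal_pos.2 (Real.exp_pos (-(n * (hμ + ε'))))).trans_le q1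
    exact lt_irrefl _ this
  refine ⟨⟨Sh_mono (by nlinarith) s1, Sh_mono (by nlinarith) s2⟩, ⟨d1.trans (by nlinarith), d2.trans (by nlinarith)⟩, ?_, ?_⟩
  · rw [← ENNReal.mul_le_mul_iff_left hm0 hmt, hid]
    calc ENNReal.ofReal (Real.exp (-(n * (hπ - hμ + ε)))) * m n (w n ω).2
        ≤ ENNReal.ofReal (Real.exp (-(n * (hπ - hμ + ε)))) * ENNReal.ofReal (Real.exp (-(n * (hμ - ε')))) := by
          gcongr
      _ ≤ ENNReal.ofReal (Real.exp (-(n * (hπ + ε')))) * ENNReal.ofReal (Real.exp (-(n * θ))) := by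
          rw [← ENNReal.ofReal_mul (Real.exp_pos _).le, ← ENNReal.ofReal_mul (Real.exp_pos _).le,
            ← Real.exp_add, ← Real.exp_add]
          apply ENNReal.ofReal_le_ofReal
          apply Real.exp_le_exp.2
          rw [hθ]
          have : (n:ℝ) * ((4 * c + 4) * ε') ≤ n * ε := by gcongr
          nlinarith
      _ ≤ _ := by gcongr
  · rw [← ENNReal.mul_le_mul_iff_left hm0 hmt, hid]
    calc π n (w n ω) * M {ω' | (w n ω').2 = (w n ω).2}
        ≤ ENNReal.ofReal (Real.exp (-(n * (hπ - ε')))) * 1 := by gcongr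
      _ ≤ ENNReal.ofReal (Real.exp (-(n * (hπ - hμ - ε)))) * ENNReal.ofReal (Real.exp (-(n * (hμ + ε')))) := by
          rw [mul_one, ← ENNReal.ofReal_mul (Real.exp_pos _).le, ← Real.exp_add]
          apply ENNReal.ofReal_le_ofReal
          apply Real.exp_le_exp.2
          have : (n:ℝ) * ((4 * c + 4) * ε') ≤ n * ε := by gcongr
          have : 0 ≤ n * (c * ε') := by positivity
          nlinarith
      _ ≤ _ := by gcongr

variable [MeasurableSpace G] [DiscreteMeasurableSpace G]
  {p : G → ℝ≥0∞} {r : G × G → ℝ≥0∞} {P : Measure (ℕ → G × G)}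
    {bnd : (ℕ → G × G) → Boundary G (1:G) × Boundary G (1:G)} {l hμ hπ : ℝ}

/-- the conditional theorem -/
lemma Setting.cond (S : Setting p r P bnd l hμ hπ) {νs : Measure (Boundary G (1:G))}
    {cond : Boundary G (1:G) → Measure (Boundary G (1:G) × Boundary G (1:G))}
    (hd : IsDisintegration (P.map bnd) Prod.snd νs cond) :
    ∀ᵐ η ∂νs, ExactDim (qbb (1:G) (1:G)) (cond η) ((hπ - hμ) / l) ∧
      HasDim (qbb (1:G) (1:G)) (cond η) ((hπ - hμ) / l) := by
  have := S.hP.1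
  have : IsProbabilityMeasure (P.map bnd) := Measure.isProbabilityMeasure_map S.meas.aemeasurable
  obtain ⟨K, hK, hgood⟩ := cond_good S.hG
  have hbas : ∀ᵐ η ∂νs, ∀ k : ℕ, ∀ᵐ ω ∂(lift P bnd cond η), ∀ᶠ n in atTop,
      Basic bnd (fun n ω => walk ω n) (piN r) (piN p) l hπ hμ (1 / (k + 1)) n ω := by
    rw [ae_all_iff]; intro k
    exact lift_ae S.meas measurable_snd hd (S.good (by positivity))
  filter_upwards [hbas, markov3 S hd, lift_prob hd, lift_map S.meas measurable_snd hd (meas_graph S.hG),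
    hd.2.2.1, hd.2.1] with η h1 h2 h3 h4 h5 h6
  set M := lift P bnd cond η with hM
  have hη : ∀ᵐ ω ∂M, (bnd ω).2 = η := by
    have hms : MeasurableSet (Prod.snd ⁻¹' {η} : Set (Boundary G (1:G) × Boundary G (1:G))) :=
      measurable_snd (meas_singleton_B S.hG η)
    rw [← h4, Measure.map_apply S.meas hms] at h5
    rw [ae_iff]
    exact (prob_compl_eq_zero_iff (S.meas hms)).2 h5
  have hcore := core S.hG M bnd S.meas (fun n ω => walk ω n) (fun n g => meas_walk_eq n g)
    l (hπ - hμ) S.hlpos (by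
      intro ε hε
      obtain ⟨k, hk⟩ := exists_nat_gt (K / ε)
      refine hgood M bnd _ (piN r) (piN p) l hπ hμ ε (1 / (k + 1)) η (by positivity) ?_ hη (h1 k) h2
      rw [mul_one_div, div_le_iff₀ (by positivity)]
      rw [div_lt_iff₀ hε] at hk
      nlinarith)
  rw [h4] at hcore
  obtain ⟨h0, hE, hpos⟩ := hcore
  refine ⟨hE, ?_⟩
  obtain ⟨a, B, hB, hcov⟩ := cover_pair S.hG
  obtain ⟨-, ⟨δ, hδ, hX⟩, -⟩ := S.hG
  exact hasDim_of_exactDim (qbb_quasi hδ hX) (fun x r => meas_qball_qbb x r) _ hE hpos hB hcov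
end G

end ModG5

section ModH1
set_option linter.unusedSectionVars false

section H
variable {G H : Type*} [Group G] [NormedAddCommGroup H] [InnerProductSpace ℝ H] [CompleteSpace H]
  {U : G → H →ₗᵢ[ℝ] H} {T : H → H} {w : G → ℝ}

lemma var_hasSum (hw1 : HasSum w 1) (hT : ∀ v, HasSum (fun s => w s • U s v) (T v)) (v : H) :
    HasSum (fun s => w s * ‖U s v - T v‖ ^ 2) (‖v‖ ^ 2 - ‖T v‖ ^ 2) := by
  have h1 : HasSum (fun s => w s * inner ℝ (U s v) (T v)) (‖T v‖ ^ 2) := by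
    have := (innerSL ℝ (T v)).hasSum (hT v)
    simp only [innerSL_apply_apply, inner_smul_right, real_inner_self_eq_norm_sq] at this
    simpa only [real_inner_comm] using this
  have h2 := (hw1.mul_right (‖v‖ ^ 2 + ‖T v‖ ^ 2)).sub (h1.mul_left 2)
  have e1 : (fun s => w s * ‖U s v - T v‖ ^ 2) =
      fun b => w b * (‖v‖ ^ 2 + ‖T v‖ ^ 2) - 2 * (w b * inner ℝ (U b v) (T v)) := by
    funext s
    rw [norm_sub_sq_real, LinearIsometry.norm_map]; ring
  have e2 : ‖v‖ ^ 2 - ‖T v‖ ^ 2 = 1 * (‖v‖ ^ 2 + ‖T v‖ ^ 2) - 2 * ‖T v‖ ^ 2 := by ring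
  rw [e1, e2]; exact h2

lemma var_le (hw : ∀ s, 0 ≤ w s) (hw1 : HasSum w 1) (hT : ∀ v, HasSum (fun s => w s • U s v) (T v)) (v : H)
    (s : G) : w s * ‖U s v - T v‖ ^ 2 ≤ ‖v‖ ^ 2 - ‖T v‖ ^ 2 :=
  le_hasSum (var_hasSum hw1 hT v) s fun j _ => mul_nonneg (hw j) (sq_nonneg _)

lemma T_norm_le (hw : ∀ s, 0 ≤ w s) (hw1 : HasSum w 1) (hT : ∀ v, HasSum (fun s => w s • U s v) (T v)) (v : H) :
    ‖T v‖ ≤ ‖v‖ := by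
  have := (var_hasSum hw1 hT v).nonneg fun s => mul_nonneg (hw s) (sq_nonneg _)
  exact (sq_le_sq₀ (norm_nonneg _) (norm_nonneg _)).1 (by linarith)

lemma iter_anti (hTn : ∀ v, ‖T v‖ ≤ ‖v‖) (v : H) {m n : ℕ} (h : m ≤ n) : ‖T^[n] v‖ ≤ ‖T^[m] v‖ := by
  induction n, h using Nat.le_induction with
  | base => exact le_rfl
  | succ n _ ih => rw [Function.iterate_succ_apply']; exact (hTn _).trans ih

def Qp (U : G → H →ₗᵢ[ℝ] H) (T : H → H) (g : G) : Prop :=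
  ∃ (p q : ℕ) (C : ℝ), 0 ≤ C ∧ ∀ (N : ℕ) (v : H) (η : ℝ), ‖v‖ ≤ 1 → 1 - η ≤ ‖T^[N] v‖ ^ 2 →
    ∀ m, m + p + q ≤ N → ‖U g (T^[m + q] v) - T^[m + p] v‖ ≤ C * √η

lemma Qp_closure (hw : ∀ s, 0 ≤ w s) (hw1 : HasSum w 1) (hT : ∀ v, HasSum (fun s => w s • U s v) (T v))
    (hU1 : ∀ v, U 1 v = v) (hUm : ∀ g h v, U (g * h) v = U h (U g v)) {g : G}
    (hg : g ∈ Subgroup.closure {x | w x ≠ 0}) : Qp U T g := by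
  have hTn := T_norm_le hw hw1 hT
  induction hg using Subgroup.closure_induction with
  | mem g hg =>
    have hpos : 0 < w g := lt_of_le_of_ne (hw g) (Ne.symm hg)
    refine ⟨1, 0, √(1 / w g), Real.sqrt_nonneg _, ?_⟩
    intro N v η hv hN m hm
    have h1 := var_le hw hw1 hT (T^[m] v) g
    rw [← Function.iterate_succ_apply' T m v] at h1
    have h2 : ‖T^[m] v‖ ≤ 1 := (iter_anti hTn v (Nat.zero_le m)).trans hv
    have h3 : ‖T^[N] v‖ ≤ ‖T^[m+1] v‖ := iter_anti hTn v (by omega)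
    have h4 : ‖T^[m] v‖ ^ 2 ≤ 1 := by nlinarith [norm_nonneg (T^[m] v)]
    have h5 : ‖T^[N] v‖ ^ 2 ≤ ‖T^[m+1] v‖ ^ 2 := by gcongr
    rw [← Real.sqrt_mul (by positivity)]
    apply Real.le_sqrt_of_sq_le
    rw [add_zero, one_div_mul_eq_div, le_div_iff₀ hpos]
    linarith
  | one => exact ⟨0, 0, 0, le_rfl, fun N v η _ _ m _ => by simp [hU1]⟩
  | mul g h _ _ ihg ihh =>
    obtain ⟨p, q, C, hC, h1⟩ := ihg
    obtain ⟨p', q', C', hC', h2⟩ := ihh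
    refine ⟨p + p', q + q', C + C', by positivity, ?_⟩
    intro N v η hv hN m hm
    have e1 := h1 N v η hv hN (m + q') (by omega)
    have e2 := h2 N v η hv hN (m + p) (by omega)
    rw [hUm, show m + (q + q') = m + q' + q by ring, show m + (p + p') = m + p + p' by ring]
    have e3 : ‖U h (U g (T^[m + q' + q] v)) - U h (T^[m + q' + p] v)‖ ≤ C * √η := by
      rw [← map_sub, LinearIsometry.norm_map]; exact e1
    rw [show m + q' + p = m + p + q' by ring] at e3
    calc _ ≤ _ := norm_sub_le_norm_sub_add_norm_sub _ (U h (T^[m + p + q'] v)) _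
      _ ≤ _ := by rw [add_mul]; exact add_le_add e3 e2
  | inv g _ ih =>
    obtain ⟨p, q, C, hC, h1⟩ := ih
    refine ⟨q, p, C, hC, ?_⟩
    intro N v η hv hN m hm
    have e1 := h1 N v η hv hN m (by omega)
    have e2 : U g (U g⁻¹ (T^[m + p] v)) = T^[m+p] v := by rw [← hUm]; simp [hU1]
    rw [← LinearIsometry.norm_map (U g), map_sub, e2, norm_sub_rev]
    exact e1
end H

end ModH1

section ModH2
set_option linter.unusedSectionVars false

lemma words {G : Type*} [Group G] (φ : FreeGroup (Fin 2) →* G) (hφ : Function.Injective φ) :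
    ∃ W : Fin 2 × Bool → Set G, (∀ i j, i ≠ j → Disjoint (W i) (W j)) ∧
      ∀ i x, x ∉ W (i, false) → x * (φ (FreeGroup.of i))⁻¹ ∈ W (i, true) := by
  have hex : ∀ x : G, ∃ u : FreeGroup (Fin 2), φ u = (Quotient.out (x : G ⧸ φ.range))⁻¹ * x := by
    intro x
    have : (Quotient.out (x : G ⧸ φ.range))⁻¹ * x ∈ φ.range := by
      rw [← QuotientGroup.eq]
      exact Quotient.out_eq _
    exact this
  choose u hu using hex
  have hmul : ∀ x h, u (x * φ h) = u x * h := by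
    intro x h
    apply hφ
    rw [hu, map_mul, hu]
    have : ((x * φ h : G) : G ⧸ φ.range) = (x : G ⧸ φ.range) := by
      rw [eq_comm, QuotientGroup.eq]
      simp
    rw [this]; group
  refine ⟨fun i => {x | (u x)⁻¹ ∈ FreeGroup.startsWith i}, ?_, ?_⟩
  · intro i j hij
    have := (FreeGroup.startsWith.disjoint_iff_ne (w := i) (w' := j)).2 hij
    rw [Set.disjoint_left] at this ⊢
    intro x hx hy
    exact this hx hy
  · intro i x hx
    show (u (x * (φ (FreeGroup.of i))⁻¹))⁻¹ ∈ FreeGroup.startsWith (i, true)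
    rw [← map_inv, hmul, mul_inv_rev, inv_inv]
    exact FreeGroup.startsWith_mk_mul (w := (i, true)) _ hx

section L
variable {G : Type*} [Group G]

/-- `ℓ²(G)` -/
abbrev L2 (G : Type*) := lp (fun _ : G => ℝ) 2

lemma l2_hasSum (v : L2 G) : HasSum (fun x => v x ^ 2) (‖v‖ ^ 2) := by
  have := lp.hasSum_norm (p := 2) (by norm_num) v
  simpa using this

lemma l2_mem {f : G → ℝ} (h : Summable fun x => f x ^ 2) : Memℓp f 2 := by
  apply memℓp_gen
  simpa using h

lemma l2_norm {f : G → ℝ} (h : Summable fun x => f x ^ 2) : ‖(⟨f, l2_mem h⟩ : L2 G)‖ ^ 2 = ∑' x, f x ^ 2 :=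
  (l2_hasSum (⟨f, l2_mem h⟩ : L2 G)).tsum_eq.symm

/-- translation -/
def Ut (g : G) : L2 G →ₗᵢ[ℝ] L2 G where
  toFun v := ⟨fun x => v (x * g⁻¹), l2_mem ((l2_hasSum v).summable.comp_injective (Equiv.mulRight g⁻¹).injective)⟩
  map_add' v w := by ext x; rfl
  map_smul' c v := by ext x; rfl
  norm_map' v := by
    have h1 := l2_norm ((l2_hasSum v).summable.comp_injective (Equiv.mulRight g⁻¹).injective)
    have h2 := ((Equiv.mulRight g⁻¹).hasSum_iff (f := fun x => v x ^ 2)).2 (l2_hasSum v)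
    have h3 := h2.tsum_eq
    refine (sq_eq_sq₀ (norm_nonneg _) (norm_nonneg _)).1 ?_
    rw [← h3]; exact h1

lemma Ut_apply (g : G) (v : L2 G) (x : G) : Ut g v x = v (x * g⁻¹) := rfl
lemma Ut_one (v : L2 G) : Ut 1 v = v := by ext x; simp [Ut_apply]
lemma Ut_mul (g h : G) (v : L2 G) : Ut (g * h) v = Ut h (Ut g v) := by
  ext x; simp [Ut_apply, mul_assoc]

lemma l2_ind (W : Set G) (v : L2 G) : Summable fun x => (W.indicator v x) ^ 2 := by
  refine Summable.of_nonneg_of_le (fun x => sq_nonneg _) (fun x => ?_) (l2_hasSum v).summable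
  by_cases h : x ∈ W <;> simp [h, sq_nonneg]

def pr (W : Set G) (v : L2 G) : L2 G := ⟨W.indicator v, l2_mem (l2_ind W v)⟩

def mass (W : Set G) (v : L2 G) : ℝ := ‖pr W v‖ ^ 2

lemma mass_hasSum (W : Set G) (v : L2 G) : HasSum (fun x => (W.indicator v x) ^ 2) (mass W v) :=
  l2_hasSum (pr W v)

lemma mass_nonneg (W : Set G) (v : L2 G) : 0 ≤ mass W v := sq_nonneg _

lemma massW_le (W : Set G) (v : L2 G) : mass W v ≤ ‖v‖ ^ 2 := by
  refine hasSum_le (fun x => ?_) (mass_hasSum W v) (l2_hasSum v)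
  by_cases h : x ∈ W <;> simp [h, sq_nonneg]

lemma pr_le (W : Set G) (v : L2 G) : ‖pr W v‖ ≤ ‖v‖ :=
  (sq_le_sq₀ (norm_nonneg _) (norm_nonneg _)).1 (massW_le W v)

lemma pr_sub (W : Set G) (u v : L2 G) : pr W u - pr W v = pr W (u - v) := by
  ext x
  show W.indicator u x - W.indicator v x = W.indicator (u - v : L2 G) x
  by_cases h : x ∈ W
  · rw [Set.indicator_of_mem h, Set.indicator_of_mem h, Set.indicator_of_mem h]; rfl
  · rw [Set.indicator_of_notMem h, Set.indicator_of_notMem h, Set.indicator_of_notMem h]; simp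

lemma mass_near (W : Set G) {u v : L2 G} (hu : ‖u‖ ≤ 1) (hv : ‖v‖ ≤ 1) {e : ℝ} (h : ‖u - v‖ ≤ e) :
    mass W u ≤ mass W v + 2 * e := by
  have h1 : ‖pr W u‖ ≤ ‖pr W v‖ + e := by
    have := pr_le W (u - v)
    rw [← pr_sub] at this
    have h2 := norm_sub_norm_le (pr W u) (pr W v)
    linarith
  have h2 := (pr_le W u).trans hu
  have h3 := (pr_le W v).trans hv
  unfold mass
  have h0 : 0 ≤ e := (norm_nonneg _).trans h
  nlinarith [norm_nonneg (pr W u), norm_nonneg (pr W v)]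

lemma mass_shift {W W' : Set G} {g : G} (h : ∀ x, x ∉ W' → x * g ∈ W) (v : L2 G) :
    ‖v‖ ^ 2 ≤ mass W (Ut g v) + mass W' v := by
  have h1 := ((Equiv.mulRight g).hasSum_iff (f := fun x => (W.indicator (Ut g v) x) ^ 2)).2 (mass_hasSum W (Ut g v))
  refine hasSum_le (fun x => ?_) (l2_hasSum v) (h1.add (mass_hasSum W' v))
  simp only [Function.comp, Equiv.coe_mulRight]
  by_cases hx : x ∈ W'
  · simp only [Set.indicator_of_mem hx]; nlinarith [sq_nonneg (W.indicator (Ut g v) (x * g))]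
  · simp [Set.indicator_of_notMem hx, Set.indicator_of_mem (h x hx), Ut_apply]

lemma mass_disj (W : Fin 2 × Bool → Set G) (hW : ∀ i j, i ≠ j → Disjoint (W i) (W j)) (v : L2 G) :
    ∑ i, mass (W i) v ≤ ‖v‖ ^ 2 := by
  refine hasSum_le (fun x => ?_) (hasSum_sum fun i _ => mass_hasSum (W i) v) (l2_hasSum v)
  by_cases h : ∃ i, x ∈ W i
  · obtain ⟨i, hi⟩ := h
    rw [Finset.sum_eq_single i]
    · simp [hi]
    · intro j _ hji
      have : x ∉ W j := fun hj => Set.disjoint_left.1 (hW j i hji) hj hi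
      simp [this]
    · simp
  · push Not at h
    simp [h, sq_nonneg]

lemma sum_shift (a : ℕ → ℝ) (K p : ℕ) (h : ∀ m < K + p, 0 ≤ a m ∧ a m ≤ 1) :
    ∑ m ∈ Finset.range K, a (m + p) ≤ ∑ m ∈ Finset.range K, a m + p := by
  induction p with
  | zero => simp
  | succ p ih =>
    have h1 := ih fun m hm => h m (by omega)
    have h2 := Finset.sum_range_succ (fun m => a (m + p)) K
    rw [Finset.sum_range_succ' (fun m => a (m + p)) K] at h2
    have h3 : ∑ m ∈ Finset.range K, a (m + (p + 1)) = ∑ m ∈ Finset.range K, a (m + 1 + p) :=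
      Finset.sum_congr rfl fun m _ => by rw [show m + (p + 1) = m + 1 + p by ring]
    have h4 := (h (K + p) (by omega)).2
    have h5 : 0 ≤ a (0 + p) := (h (0 + p) (by omega)).1
    push_cast
    linarith

lemma gap {w : G → ℝ} {T : L2 G → L2 G} (hw : ∀ s, 0 ≤ w s) (hw1 : HasSum w 1)
    (hT : ∀ v, HasSum (fun s => w s • Ut s v) (T v))
    (hne : IsNonElementarySubgroup (Subgroup.closure {x | w x ≠ 0})) :
    ∃ (N : ℕ) (θ : ℝ), 0 ≤ θ ∧ θ < 1 ∧ ∀ v, ‖T^[N] v‖ ≤ θ * ‖v‖ := by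
  obtain ⟨φ, hφ, hr⟩ := hne
  obtain ⟨W, hWd, hWs⟩ := words φ hφ
  have hTn := T_norm_le hw hw1 hT
  have hQ : ∀ i, Qp (Ut (G := G)) T (φ (FreeGroup.of i))⁻¹ := fun i =>
    Qp_closure hw hw1 hT Ut_one Ut_mul (inv_mem (hr ⟨_, rfl⟩))
  choose p q C hC hQ using hQ
  set L := p 0 + q 0 + (p 1 + q 1) with hL
  set K := 2 * L + 2 with hK
  set C' := C 0 + C 1 with hC'
  have hC'0 : 0 ≤ C' := add_nonneg (hC 0) (hC 1)
  set s := 1 / (8 * (1 + 2 * C')) with hs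
  have hs0 : 0 < s := by positivity
  have hs1 : s + 2 * C' * s = 1 / 8 := by rw [hs]; field_simp
  have hss : s ≤ 1 / 8 := by nlinarith
  have key : ∀ v : L2 G, ‖v‖ = 1 → ‖T^[K + L] v‖ ^ 2 ≤ 1 - s ^ 2 := by
    intro v hv
    by_contra hcon
    push Not at hcon
    have hn1 : ∀ m, ‖T^[m] v‖ ≤ 1 := fun m => (iter_anti hTn v (Nat.zero_le m)).trans hv.le
    have hn2 : ∀ m, ‖T^[m] v‖ ^ 2 ≤ 1 := fun m => by nlinarith [hn1 m, norm_nonneg (T^[m] v)]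
    have hstep : ∀ i m, m < K → 7 / 8 ≤ mass (W (i, true)) (T^[m + p i] v) + mass (W (i, false)) (T^[m + q i] v) := by
      intro i m hm
      have hiL : p i + q i ≤ L := by fin_cases i <;> simp [hL]
      have h1 := hQ i (K + L) v (s ^ 2) hv.le hcon.le m (by omega)
      rw [Real.sqrt_sq hs0.le] at h1
      have h2 := mass_near (W (i, true)) (by rw [LinearIsometry.norm_map]; exact hn1 _) (hn1 _) h1
      have h3 := mass_shift (hWs i) (T^[m + q i] v)
      have h4 : ‖T^[K + L] v‖ ≤ ‖T^[m + q i] v‖ := iter_anti hTn v (by omega)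
      have h5 : ‖T^[K + L] v‖ ^ 2 ≤ ‖T^[m + q i] v‖ ^ 2 := by gcongr
      have h6 : C i ≤ C' := by
        have h0 := hC 0
        have h1 := hC 1
        fin_cases i <;> simp [hC'] <;> assumption
      nlinarith
    have hsum : ∀ i, (K : ℝ) * (7 / 8) ≤ ∑ m ∈ Finset.range K, mass (W (i, true)) (T^[m] v) +
        ∑ m ∈ Finset.range K, mass (W (i, false)) (T^[m] v) + (p i + q i) := by
      intro i
      have h1 := sum_shift (fun m => mass (W (i, true)) (T^[m] v)) K (p i)
        fun m _ => ⟨mass_nonneg _ _, (massW_le _ _).trans (hn2 m)⟩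
      have h2 := sum_shift (fun m => mass (W (i, false)) (T^[m] v)) K (q i)
        fun m _ => ⟨mass_nonneg _ _, (massW_le _ _).trans (hn2 m)⟩
      have h3 := Finset.sum_le_sum (s := Finset.range K) fun m hm => hstep i m (Finset.mem_range.1 hm)
      rw [Finset.sum_const, Finset.card_range, nsmul_eq_mul, Finset.sum_add_distrib] at h3
      linarith
    have htot : ∑ m ∈ Finset.range K, ∑ i, mass (W i) (T^[m] v) ≤ K := by
      have := Finset.sum_le_sum (s := Finset.range K) fun m _ => (mass_disj W hWd (T^[m] v)).trans (hn2 m)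
      simpa using this
    simp only [Fintype.sum_prod_type, Fin.sum_univ_two, Fintype.sum_bool, Finset.sum_add_distrib] at htot
    have h0 := hsum 0
    have h1 := hsum 1
    have hKr : (K : ℝ) = 2 * L + 2 := by rw [hK]; push_cast; ring
    have hLr : (L : ℝ) = p 0 + q 0 + (p 1 + q 1) := by rw [hL]; push_cast; ring
    have hL0 : (0:ℝ) ≤ L := Nat.cast_nonneg _
    linarith
  have hTs : ∀ (c : ℝ) v, T (c • v) = c • T v := by
    intro c v
    refine (hT (c • v)).unique ?_
    have := (hT v).const_smul c
    simpa only [map_smul, smul_comm c] using this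
  have hTsN : ∀ (n : ℕ) (c : ℝ) v, T^[n] (c • v) = c • T^[n] v := by
    intro n c v
    induction n with
    | zero => rfl
    | succ n ih => rw [Function.iterate_succ_apply', ih, hTs, Function.iterate_succ_apply']
  refine ⟨K + L, √(1 - s ^ 2), Real.sqrt_nonneg _, ?_, ?_⟩
  · rw [Real.sqrt_lt' one_pos]; nlinarith
  · intro v
    rcases eq_or_ne v 0 with rfl | hv
    · have := iter_anti hTn (0 : L2 G) (Nat.zero_le (K + L))
      simpa using this
    · have hv' : ‖v‖ ≠ 0 := norm_ne_zero_iff.2 hv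
      have h1 := key (‖v‖⁻¹ • v) (by rw [norm_smul]; simp [hv'])
      rw [hTsN] at h1
      have h2 := Real.le_sqrt_of_sq_le h1
      rw [norm_smul, norm_inv, norm_norm, inv_mul_le_iff₀ (by positivity)] at h2
      linarith
end L

end ModH2

section ModH3
set_option linter.unusedSectionVars false

section M
variable {G : Type*}

def Bnd2 (f : G → ℝ≥0∞) (A : ℝ≥0∞) : Prop := ∑' x, f x ^ 2 ≤ A ^ 2

lemma Bnd2.le {f : G → ℝ≥0∞} {A : ℝ≥0∞} (h : Bnd2 f A) (x : G) : f x ≤ A := by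
  have := (ENNReal.le_tsum (f := fun x => f x ^ 2) x).trans h
  exact (ENNReal.pow_le_pow_left_iff (by norm_num)).1 this

lemma Bnd2.mono {f : G → ℝ≥0∞} {A B : ℝ≥0∞} (h : Bnd2 f A) (hAB : A ≤ B) : Bnd2 f B :=
  h.trans (by gcongr)

lemma Bnd2.cs {f g : G → ℝ≥0∞} {A B : ℝ≥0∞} (hf : Bnd2 f A) (hg : Bnd2 g B) :
    ∑' x, f x * g x ≤ A * B := by
  rw [ENNReal.tsum_eq_iSup_sum]
  refine iSup_le fun s => ?_
  refine (ENNReal.inner_le_Lp_mul_Lq s f g (p := 2) (q := 2) (by constructor <;> norm_num)).trans ?_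
  have key : ∀ (f : G → ℝ≥0∞) (A : ℝ≥0∞), Bnd2 f A → (∑ i ∈ s, f i ^ (2:ℝ)) ^ (1 / (2:ℝ)) ≤ A := by
    intro f A hf
    have h1 : ∑ i ∈ s, f i ^ (2:ℝ) ≤ A ^ (2:ℝ) := by
      have := (ENNReal.sum_le_tsum (f := fun x => f x ^ 2) s).trans hf
      simpa only [ENNReal.rpow_two] using this
    calc _ ≤ (A ^ (2:ℝ)) ^ (1 / (2:ℝ)) := by gcongr
      _ = A := by rw [← ENNReal.rpow_mul]; norm_num
  exact mul_le_mul' (key f A hf) (key g B hg)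

lemma sq_tsum {ι : Type*} (u : ι → ℝ≥0∞) : (∑' i, u i) ^ 2 = ∑' i, ∑' j, u i * u j := by
  rw [sq, ← ENNReal.tsum_mul_right]
  exact tsum_congr fun i => ENNReal.tsum_mul_left.symm

lemma mink {ι : Type*} {c : ι → ℝ≥0∞} {f : ι → G → ℝ≥0∞} {A : ι → ℝ≥0∞} (h : ∀ i, Bnd2 (f i) (A i)) :
    Bnd2 (fun x => ∑' i, c i * f i x) (∑' i, c i * A i) := by
  unfold Bnd2
  simp only [sq_tsum]
  rw [ENNReal.tsum_comm]
  refine ENNReal.tsum_le_tsum fun i => ?_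
  rw [ENNReal.tsum_comm]
  refine ENNReal.tsum_le_tsum fun j => ?_
  have : ∀ x, c i * f i x * (c j * f j x) = c i * c j * (f i x * f j x) := fun x => by ring
  simp only [this]
  rw [ENNReal.tsum_mul_left, mul_mul_mul_comm]
  gcongr
  exact (h i).cs (h j)

lemma mink2 {f g : G → ℝ≥0∞} {A B : ℝ≥0∞} (hf : Bnd2 f A) (hg : Bnd2 g B) :
    Bnd2 (fun x => f x + g x) (A + B) := by
  have := mink (ι := Bool) (c := fun _ => 1) (f := fun b => if b then f else g)
    (A := fun b => if b then A else B) (by intro b; cases b <;> simpa)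
  simpa [tsum_fintype] using this

end M

section C
variable {G : Type*} [Group G]

lemma conv_apply (f p : G → ℝ≥0∞) (x : G) : conv f p x = ∑' s, f (x * s⁻¹) * p s := by
  unfold conv
  rw [← (Equiv.divLeft x).tsum_eq]
  refine tsum_congr fun s => ?_
  simp [div_eq_mul_inv]

lemma conv_assoc (f g h : G → ℝ≥0∞) : conv (conv f g) h = conv f (conv g h) := by
  funext x
  unfold conv
  simp only [← ENNReal.tsum_mul_right, ← ENNReal.tsum_mul_left]
  rw [ENNReal.tsum_comm]
  refine tsum_congr fun z => ?_
  rw [← (Equiv.mulLeft z).tsum_eq]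
  refine tsum_congr fun y => ?_
  simp [mul_assoc]

lemma conv_delta (f p : G → ℝ≥0∞) : conv f (piN p 0) = f := by
  funext x
  rw [conv_apply, tsum_eq_single 1]
  · simp [piN]
  · intro b hb; simp [piN, hb]

lemma piN_add (p : G → ℝ≥0∞) (m k : ℕ) : piN p (m + k) = conv (piN p m) (piN p k) := by
  induction k with
  | zero => rw [conv_delta]; rfl
  | succ k ih =>
    show conv (piN p (m + k)) p = conv (piN p m) (conv (piN p k) p)
    rw [ih, conv_assoc]

lemma conv_iter (f p : G → ℝ≥0∞) (n : ℕ) : (fun f => conv f p)^[n] f = conv f (piN p n) := by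
  induction n with
  | zero => rw [conv_delta]; rfl
  | succ n ih =>
    rw [Function.iterate_succ_apply', ih]
    show conv (conv f (piN p n)) p = conv f (conv (piN p n) p)
    rw [conv_assoc]

lemma Bnd2_delta (p : G → ℝ≥0∞) : Bnd2 (piN p 0) 1 := by
  unfold Bnd2
  rw [tsum_eq_single 1]
  · simp [piN]
  · intro b hb; simp [piN, hb]

lemma contr {p : G → ℝ≥0∞} (hp : IsProb p) (hne : IsNonElemMeasure p) :
    ∃ (k : ℕ) (θ : ℝ), 0 < θ ∧ θ < 1 ∧ ∀ f A, A ≠ ∞ → Bnd2 f A →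
      Bnd2 (conv f (piN p k)) (ENNReal.ofReal θ * A) := by
  have hp' : ∑' x, p x = 1 := hp
  have hpt : ∀ x, p x ≠ ∞ := fun x => ne_top_of_le_ne_top (by rw [hp']; simp) (ENNReal.le_tsum x)
  set w : G → ℝ := fun s => (p s).toReal with hwd
  have hw : ∀ s, 0 ≤ w s := fun s => ENNReal.toReal_nonneg
  have hw1 : HasSum w 1 := by
    have h := (ENNReal.summable_toReal (f := p) (by rw [hp']; simp)).hasSum
    rwa [← ENNReal.tsum_toReal_eq hpt, hp', ENNReal.toReal_one] at h
  set T : L2 G → L2 G := fun v => ∑' s, w s • Ut s v with hTd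
  have hT : ∀ v, HasSum (fun s => w s • Ut s v) (T v) := by
    intro v
    refine Summable.hasSum (Summable.of_norm ?_)
    have : ∀ s, ‖w s • Ut s v‖ = w s * ‖v‖ := fun s => by
      rw [norm_smul, LinearIsometry.norm_map, Real.norm_of_nonneg (hw s)]
    simp only [this]
    exact hw1.summable.mul_right _
  have hne' : IsNonElementarySubgroup (Subgroup.closure {x | w x ≠ 0}) := by
    have : {x | w x ≠ 0} = {x | p x ≠ 0} := by
      ext x; simp [hwd, ENNReal.toReal_eq_zero_iff, hpt]
    rw [this]; exact hne
  obtain ⟨N, θ, h0, h1, hN⟩ := gap hw hw1 hT hne'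
  have hTa : ∀ (v : L2 G), (∀ x, 0 ≤ v x) → (∀ x, 0 ≤ T v x) ∧
      conv (fun x => ENNReal.ofReal (v x)) p = fun x => ENNReal.ofReal (T v x) := by
    intro v hv
    have hx : ∀ x, HasSum (fun s => w s * v (x * s⁻¹)) (T v x) := fun x =>
      (lp.evalCLM ℝ (fun _ : G => ℝ) 2 x).hasSum (hT v)
    refine ⟨fun x => (hx x).nonneg fun s => mul_nonneg (hw s) (hv _), ?_⟩
    funext x
    rw [conv_apply, ← (hx x).tsum_eq, ENNReal.ofReal_tsum_of_nonneg (fun s => mul_nonneg (hw s) (hv _)) (hx x).summable]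
    refine tsum_congr fun s => ?_
    rw [mul_comm, ENNReal.ofReal_mul (hw s), hwd, ENNReal.ofReal_toReal (hpt s)]
  have hTn : ∀ (n : ℕ) (v : L2 G), (∀ x, 0 ≤ v x) → (∀ x, 0 ≤ T^[n] v x) ∧
      conv (fun x => ENNReal.ofReal (v x)) (piN p n) = fun x => ENNReal.ofReal (T^[n] v x) := by
    intro n v hv
    induction n with
    | zero => exact ⟨hv, conv_delta _ _⟩
    | succ n ih =>
      have h2 := hTa _ ih.1
      rw [Function.iterate_succ_apply']
      refine ⟨h2.1, ?_⟩
      show conv _ (conv (piN p n) p) = _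
      rw [← conv_assoc, ih.2, h2.2]
  have hsq : ∀ v : L2 G, (∀ x, 0 ≤ v x) → ∑' x, ENNReal.ofReal (v x) ^ 2 = ENNReal.ofReal ‖v‖ ^ 2 := by
    intro v hv
    rw [← ENNReal.ofReal_pow (norm_nonneg _), ← (l2_hasSum v).tsum_eq,
      ENNReal.ofReal_tsum_of_nonneg (fun _ => sq_nonneg _) (l2_hasSum v).summable]
    exact tsum_congr fun x => (ENNReal.ofReal_pow (hv x) 2).symm
  refine ⟨N, max θ (1 / 2), by positivity, max_lt h1 (by norm_num), ?_⟩
  intro f A hA hf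
  have hft : ∀ x, f x ≠ ∞ := fun x => ne_top_of_le_ne_top hA (hf.le x)
  have hS : ∑' x, f x ^ 2 ≠ ∞ := ne_top_of_le_ne_top (by finiteness) hf
  have hsum : Summable fun x => (f x).toReal ^ 2 := by
    have := ENNReal.summable_toReal hS
    simpa only [ENNReal.toReal_pow] using this
  set v : L2 G := ⟨fun x => (f x).toReal, l2_mem hsum⟩ with hvd
  have hv0 : ∀ x, 0 ≤ v x := fun x => ENNReal.toReal_nonneg
  have hvf : (fun x => ENNReal.ofReal (v x)) = f := funext fun x => ENNReal.ofReal_toReal (hft x)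
  have h3 := hTn N v hv0
  rw [hvf] at h3
  have h4 := hsq v hv0
  have h5 : ENNReal.ofReal ‖v‖ ≤ A := by
    have : ENNReal.ofReal ‖v‖ ^ 2 ≤ A ^ 2 := by
      rw [← h4]
      refine le_trans (le_of_eq ?_) hf
      exact tsum_congr fun x => by rw [← congrFun hvf x]
    exact (ENNReal.pow_le_pow_left_iff (by norm_num)).1 this
  unfold Bnd2
  rw [h3.2, hsq _ h3.1]
  gcongr
  calc ENNReal.ofReal ‖T^[N] v‖ ≤ ENNReal.ofReal (θ * ‖v‖) := ENNReal.ofReal_le_ofReal (hN v)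
    _ = ENNReal.ofReal θ * ENNReal.ofReal ‖v‖ := ENNReal.ofReal_mul h0
    _ ≤ _ := mul_le_mul' (ENNReal.ofReal_le_ofReal (le_max_left _ _)) h5

lemma decay {p : G → ℝ≥0∞} {k : ℕ} {θ : ℝ}
    (hc : ∀ f A, A ≠ ∞ → Bnd2 f A → Bnd2 (conv f (piN p k)) (ENNReal.ofReal θ * A)) (n : ℕ) :
    Bnd2 (piN p (k * n)) (ENNReal.ofReal θ ^ n) := by
  induction n with
  | zero => simpa using Bnd2_delta p
  | succ n ih =>
    rw [mul_add, mul_one, piN_add, pow_succ']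
    exact hc _ _ (by finiteness) ih

lemma k_pos {p : G → ℝ≥0∞} {k : ℕ} {θ : ℝ} (h1 : θ < 1)
    (hc : ∀ f A, A ≠ ∞ → Bnd2 f A → Bnd2 (conv f (piN p k)) (ENNReal.ofReal θ * A)) : 0 < k := by
  rcases Nat.eq_zero_or_pos k with rfl | h
  · exfalso
    have := (decay hc 1).le 1
    simp [piN] at this
    linarith
  · exact h

end C

end ModH3

set_option linter.unusedSectionVars false

section P
variable {G : Type*} [Group G] [MetricSpace G] [Countable G] [MeasurableSpace G] [DiscreteMeasurableSpace G]
  {p : G → ℝ≥0∞}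

lemma drift_pos {P : Measure (ℕ → G)} (hG : IsHypGroupMetric G) (hP : IsRWMeasure p P) (hp : IsProb p)
    (hne : IsNonElemMeasure p)
    (hmom : FiniteFirstMoment p fun x => dist (1 : G) x) {l : ℝ}
    (hl : HasDrift p (fun x => dist (1 : G) x) l) : 0 < l := by
  have := hP.1
  by_contra hl0
  push Not at hl0
  obtain ⟨k, θ, h0, h1, hc⟩ := contr hp hne
  have hk : (0:ℝ) < k := by exact_mod_cast k_pos h1 hc
  obtain ⟨c, hc1, hgr⟩ := growth hG.2.2
  have hlog : Real.log θ < 0 := Real.log_neg h0 h1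
  set ε : ℝ := -Real.log θ / (2 * c * k) with hε
  have hε0 : 0 < ε := by
    rw [hε]; apply div_pos (by linarith); positivity
  have hεk : c * (ε * k) = -Real.log θ / 2 := by rw [hε]; field_simp
  set B : ℕ → Set (ℕ → G) := fun n => {ω | dist 1 (walk ω (k * n)) ≤ ε * ((k * n : ℕ) : ℝ)} with hB
  have hBm : ∀ n, P (B n) ≤ ENNReal.ofReal (c * Real.exp (Real.log θ / 2) ^ n) := by
    intro n
    have hR : 0 ≤ ε * ((k * n : ℕ) : ℝ) := by positivity
    obtain ⟨hf, hn⟩ := hgr _ hR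
    have hsub : B n ⊆ ⋃ g ∈ hf.toFinset, {ω | walk ω (k * n) = g} := by
      intro ω hω
      simp only [Set.mem_iUnion]
      refine ⟨walk ω (k * n), ?_, rfl⟩
      rw [Set.Finite.mem_toFinset]; exact hω
    calc P (B n) ≤ _ := measure_mono hsub
      _ ≤ ∑ g ∈ hf.toFinset, P {ω | walk ω (k * n) = g} := measure_biUnion_finset_le _ _
      _ ≤ ∑ g ∈ hf.toFinset, ENNReal.ofReal θ ^ n := by
        refine Finset.sum_le_sum fun g _ => ?_
        rw [law_walk hP]; exact (decay hc n).le g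
      _ = ENNReal.ofReal (hf.toFinset.card * θ ^ n) := by
        rw [Finset.sum_const, nsmul_eq_mul, ENNReal.ofReal_mul (Nat.cast_nonneg _), ENNReal.ofReal_natCast,
          ENNReal.ofReal_pow h0.le]
      _ ≤ _ := by
        apply ENNReal.ofReal_le_ofReal
        rw [← Set.ncard_eq_toFinset_card _ hf]
        calc _ ≤ c * Real.exp (c * (ε * ((k * n : ℕ) : ℝ))) * θ ^ n := by gcongr
          _ = c * Real.exp (Real.log θ / 2) ^ n := by
            rw [← Real.exp_nat_mul, ← Real.exp_log h0, ← Real.exp_nat_mul, mul_assoc, ← Real.exp_add, Real.log_exp]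
            congr 2
            push_cast
            have : c * (ε * (k * n)) = (c * (ε * k)) * n := by ring
            rw [this, hεk]; ring
  have hsum : ∑' n, P (B n) ≠ ∞ := by
    have hs : Summable fun n : ℕ => c * Real.exp (Real.log θ / 2) ^ n := by
      apply Summable.mul_left
      apply summable_geometric_of_lt_one (Real.exp_nonneg _)
      rw [Real.exp_lt_one_iff]; linarith
    refine ne_top_of_le_ne_top ?_ (ENNReal.tsum_le_tsum hBm)
    exact hs.tsum_ofReal_ne_top
  have hae : ∀ᵐ ω ∂P, False := by
    filter_upwards [ae_eventually_notMem hsum, dist_conv hG.1 hP hmom hl hε0] with ω h2 h3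
    have ht : Tendsto (fun n => k * n) atTop atTop :=
      tendsto_id.const_mul_atTop' (by exact_mod_cast hk)
    obtain ⟨n, h4, h5⟩ := (h2.and (ht.eventually h3)).exists
    apply h4
    refine h5.2.trans ?_
    have : (0:ℝ) ≤ ((k * n : ℕ) : ℝ) := by positivity
    nlinarith
  obtain ⟨ω, h⟩ := hae.exists
  exact h

lemma piN_lower {r : G × G → ℝ≥0∞} {c : ℝ≥0∞} (h : ∀ a b, c * (p a * p b) ≤ r (a, b)) (k : ℕ) (a b : G) :
    c ^ k * (piN p k a * piN p k b) ≤ piN r k (a, b) := by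
  induction k generalizing a b with
  | zero =>
    simp only [piN, Prod.mk_eq_one]
    split_ifs <;> simp_all
  | succ k ih =>
    show c ^ (k + 1) * (conv (piN p k) p a * conv (piN p k) p b) ≤ conv (piN r k) r (a, b)
    unfold conv
    rw [ENNReal.tsum_prod', ← ENNReal.tsum_mul_right, ← ENNReal.tsum_mul_left]
    refine ENNReal.tsum_le_tsum fun y => ?_
    rw [← ENNReal.tsum_mul_left, ← ENNReal.tsum_mul_left]
    refine ENNReal.tsum_le_tsum fun z => ?_
    refine le_trans (le_of_eq ?_) (mul_le_mul' (ih y z) (h (y⁻¹ * a) (z⁻¹ * b)))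
    ring

lemma pair_decay {r : G × G → ℝ≥0∞} {k : ℕ} {θ ρ : ℝ} (hθ0 : 0 < θ) (hρ : ρ ∈ Set.Icc (0:ℝ) 1)
    (hc : ∀ f A, A ≠ ∞ → Bnd2 f A → Bnd2 (conv f (piN p k)) (ENNReal.ofReal θ * A))
    (hpt : ∀ n a, piN p n a ≠ ∞)
    (hlow : ∀ a b, ENNReal.ofReal ρ * (piN p k a * piN p k b) ≤ piN r k (a, b))
    (hm : ∀ b, ∑' a, piN r k (a, b) = piN p k b) (h1 : ∑' a, piN p k a = 1) (n : ℕ) (y : G) :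
    Bnd2 (fun x => piN r (k * n) (x, y)) (ENNReal.ofReal (ρ * θ + (1 - ρ)) ^ n * piN p (k * n) y) := by
  set κ := ENNReal.ofReal (ρ * θ + (1 - ρ)) with hκ
  have hκ' : κ = ENNReal.ofReal ρ * ENNReal.ofReal θ + ENNReal.ofReal (1 - ρ) := by
    rw [hκ, ENNReal.ofReal_add (mul_nonneg hρ.1 hθ0.le) (by linarith [hρ.2]), ENNReal.ofReal_mul hρ.1]
  induction n generalizing y with
  | zero =>
    simp only [mul_zero, pow_zero, one_mul]
    by_cases hy : y = 1
    · subst hy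
      have := Bnd2_delta p
      simpa [piN, Prod.mk_eq_one] using this
    · simp [piN, Prod.mk_eq_one, hy, Bnd2]
  | succ n ih =>
    rw [mul_add, mul_one, piN_add, piN_add]
    set s : G × G → ℝ≥0∞ := fun g => piN r k g - ENNReal.ofReal ρ * (piN p k g.1 * piN p k g.2) with hs
    have hsr : ∀ a b, piN r k (a, b) = ENNReal.ofReal ρ * (piN p k a * piN p k b) + s (a, b) := fun a b =>
      (add_tsub_cancel_of_le (hlow a b)).symm
    have hsm : ∀ b, ∑' a, s (a, b) = ENNReal.ofReal (1 - ρ) * piN p k b := by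
      intro b
      have h2 := hm b
      simp only [hsr] at h2
      rw [ENNReal.tsum_add, ENNReal.tsum_mul_left, ENNReal.tsum_mul_right, h1, one_mul] at h2
      have h3 : ENNReal.ofReal ρ * piN p k b + ENNReal.ofReal (1 - ρ) * piN p k b = piN p k b := by
        rw [← add_mul, rho_add hρ, one_mul]
      refine (ENNReal.add_right_inj (a := ENNReal.ofReal ρ * piN p k b) (ENNReal.mul_ne_top ENNReal.ofReal_ne_top (hpt k b))).1 ?_
      rw [h2, h3]
    set F : G → G → ℝ≥0∞ := fun y x => piN r (k * n) (x, y) with hF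
    set A : G → ℝ≥0∞ := fun y => κ ^ n * piN p (k * n) y with hA
    have hAt : ∀ y, A y ≠ ∞ := fun y => ENNReal.mul_ne_top (by finiteness) (hpt _ _)
    have hshift : ∀ (a y : G), Bnd2 (fun x => F y (x * a⁻¹)) (A y) := by
      intro a y
      unfold Bnd2
      have := (Equiv.mulRight a⁻¹).tsum_eq (fun x => F y x ^ 2)
      exact this.le.trans (ih y)
    have e1 : (fun x => conv (piN r (k * n)) (piN r k) (x, y)) = fun x =>
        (∑' b, (ENNReal.ofReal ρ * piN p k b) * conv (F (y * b⁻¹)) (piN p k) x) +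
        ∑' g : G × G, s g * F (y * g.2⁻¹) (x * g.1⁻¹) := by
      funext x
      rw [conv_apply]
      have : ∀ g : G × G, piN r (k * n) ((x, y) * g⁻¹) * piN r k g =
          (ENNReal.ofReal ρ * piN p k g.2) * (F (y * g.2⁻¹) (x * g.1⁻¹) * piN p k g.1) +
          s g * F (y * g.2⁻¹) (x * g.1⁻¹) := by
        rintro ⟨a, b⟩
        rw [hsr]
        show F (y * b⁻¹) (x * a⁻¹) * _ = _
        ring
      simp only [this]
      rw [ENNReal.tsum_add]
      congr 1
      rw [ENNReal.tsum_prod', ENNReal.tsum_comm]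
      refine tsum_congr fun b => ?_
      dsimp only
      rw [ENNReal.tsum_mul_left, conv_apply]
    rw [e1]
    have b1 := mink (c := fun b => ENNReal.ofReal ρ * piN p k b)
      fun b => hc (F (y * b⁻¹)) (A (y * b⁻¹)) (hAt _) (ih _)
    have b2 := mink (c := s) fun g : G × G => hshift g.1 (y * g.2⁻¹)
    refine (mink2 b1 b2).mono (le_of_eq ?_)
    rw [ENNReal.tsum_prod', ENNReal.tsum_comm, ← ENNReal.tsum_add, conv_apply, ← ENNReal.tsum_mul_left]
    refine tsum_congr fun b => ?_
    dsimp only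
    rw [ENNReal.tsum_mul_right, hsm, hA]
    dsimp only
    rw [pow_succ, hκ']
    ring

variable {r : G × G → ℝ≥0∞} {P : Measure (ℕ → G × G)}
  {bnd : (ℕ → G × G) → Boundary G (1:G) × Boundary G (1:G)} {l hμ hπ : ℝ}

lemma ent_gap (S : Setting p r P bnd l hμ hπ) (hp : IsProb p) (hne : IsNonElemMeasure p) {ρ : ℝ}
    (hρ0 : 0 < ρ) (hρ1 : ρ ≤ 1) (hlow : ∀ a b, ENNReal.ofReal ρ * (p a * p b) ≤ r (a, b)) : hμ < hπ := by
  have := S.hP.1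
  obtain ⟨k, θ, h0, h1, hc⟩ := contr hp hne
  have hk : (0:ℝ) < k := by exact_mod_cast k_pos h1 hc
  have P2 := rw_snd S.hP S.m2
  have hρk0 : 0 < ρ ^ k := by positivity
  have hρk1 : ρ ^ k ≤ 1 := pow_le_one₀ hρ0.le hρ1
  set κ := ρ ^ k * θ + (1 - ρ ^ k) with hκ
  have hκ0 : 0 < κ := by nlinarith
  have hκ1 : κ < 1 := by nlinarith
  have hd := pair_decay (r := r) h0 ⟨hρk0.le, hρk1⟩ hc (piN_ne_top P2)
    (fun a b => by rw [ENNReal.ofReal_pow hρ0.le]; exact piN_lower hlow k a b)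
    (fun b => by
      rw [← law_snd S, ← Set.inter_univ {ω | _}, snd_sum k b MeasurableSet.univ]
      simp only [Set.inter_univ, law_walk S.hP]) (piN_tsum P2 k)
  by_contra hcon
  push Not at hcon
  have hlog : Real.log κ < 0 := Real.log_neg hκ0 hκ1
  set ε : ℝ := -Real.log κ / (4 * k) with hε
  have hε0 : 0 < ε := by rw [hε]; apply div_pos (by linarith); positivity
  have hεk : k * ε = -Real.log κ / 4 := by rw [hε]; field_simp
  obtain ⟨ω, hω⟩ := (S.good hε0).exists
  have ht : Tendsto (fun n => k * n) atTop atTop :=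
    tendsto_id.const_mul_atTop' (by exact_mod_cast hk)
  obtain ⟨n, h4, hn⟩ := ((ht.eventually hω).and (eventually_gt_atTop 0)).exists
  obtain ⟨-, ⟨h5, -⟩, -, h6⟩ := h4
  have h7 := (hd n (walk ω (k * n)).2).le (walk ω (k * n)).1
  have h8 := (h5.trans h7).trans (mul_le_mul_right h6 _)
  rw [← ENNReal.ofReal_pow hκ0.le, ← ENNReal.ofReal_mul (by positivity), ENNReal.ofReal_le_ofReal_iff (by positivity),
    ← Real.exp_log hκ0, ← Real.exp_nat_mul, ← Real.exp_add, Real.exp_le_exp] at h8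
  push_cast at h8
  have hn' : (0:ℝ) < n := by exact_mod_cast hn
  have h9 : (k * n : ℝ) * (hμ - hπ) ≥ 0 := mul_nonneg (by positivity) (by linarith)
  have h10 : (k * n : ℝ) * ε = n * (-Real.log κ / 4) := by rw [← hεk]; ring
  have h11 : n * Real.log κ < 0 := mul_neg_of_pos_of_neg hn' hlog
  nlinarith

lemma pRho_zero_piN (p : G → ℝ≥0∞) (n : ℕ) (g : G × G) :
    piN (pRho p 0) n g = if g.1 = g.2 then piN p n g.1 else 0 := by
  induction n generalizing g with
  | zero =>
    obtain ⟨a, b⟩ := g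
    simp only [piN, Prod.mk_eq_one]
    by_cases h : a = b
    · subst h; simp
    · rw [if_neg h, if_neg]; rintro ⟨rfl, rfl⟩; exact h rfl
  | succ n ih =>
    show conv (piN (pRho p 0) n) (pRho p 0) g = _
    unfold conv
    simp only [ih]
    rw [ENNReal.tsum_prod']
    have : ∀ a, ∑' b, (if a = b then piN p n a else 0) * pRho p 0 ((a, b)⁻¹ * g) =
        piN p n a * (if g.1 = g.2 then p (a⁻¹ * g.1) else 0) := by
      intro a
      rw [tsum_eq_single a]
      · simp [pRho]
      · intro b hb; rw [if_neg (Ne.symm hb), zero_mul]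
    simp only [this]
    split_ifs with h
    · rfl
    · simp

lemma pRho_zero_ent (p : G → ℝ≥0∞) (n : ℕ) : entropySeq (pRho p 0) n = entropySeq p n := by
  unfold entropySeq
  have hinj : Function.Injective fun a : G => (a, a) := fun a b h => congrArg Prod.fst h
  rw [← hinj.tsum_eq]
  · exact tsum_congr fun a => by rw [pRho_zero_piN]; simp
  · rintro ⟨a, b⟩ h
    rw [Function.mem_support, pRho_zero_piN] at h
    by_cases hab : a = b
    · subst hab; exact ⟨a, rfl⟩
    · simp [hab] at h

end P

/-- Example 1.5. -/
theorem statement18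
    (Γ : Type*) [Group Γ] [MetricSpace Γ] [Countable Γ]
    [MeasurableSpace Γ] [DiscreteMeasurableSpace Γ]
    (hΓ : IsHypGroupMetric Γ) (hneΓ : HasFreeSubgroup Γ)
    (p : Γ → ℝ≥0∞) (hp : IsProb p) (hμne : IsNonElemMeasure p)
    (hmom : FiniteFirstMoment p fun x => dist (1 : Γ) x)
    (l hμ : ℝ) (hl : HasDrift p (fun x => dist (1 : Γ) x) l)
    (hhμ : HasEntropy p hμ) :
    ∀ ρ : ℝ, ρ ∈ Set.Icc (0 : ℝ) 1 →
    ∀ hπρ : ℝ, HasEntropy (pRho p ρ) hπρ →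
    ∀ (P : Measure (ℕ → Γ × Γ)) (ν : Measure (Boundary Γ (1 : Γ) × Boundary Γ (1 : Γ)))
      (νs : Measure (Boundary Γ (1 : Γ)))
      (condν : Boundary Γ (1 : Γ) → Measure (Boundary Γ (1 : Γ) × Boundary Γ (1 : Γ))),
      IsRWMeasure (pRho p ρ) P →
      IsJointHarmonic (1 : Γ) (1 : Γ) P (fun ω n => (walk ω n).1)
        (fun ω n => (walk ω n).2) ν →
      IsDisintegration ν Prod.snd νs condν →
      (0 < ρ → 0 < (hπρ - hμ) / l ∧
          ∀ᵐ η ∂νs, ExactDim (qbb (1 : Γ) (1 : Γ)) (condν η) ((hπρ - hμ) / l) ∧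
            HasDim (qbb (1 : Γ) (1 : Γ)) (condν η) ((hπρ - hμ) / l)) ∧
        (ρ = 0 → hπρ = hμ ∧ ∀ᵐ η ∂νs, HasDim (qbb (1 : Γ) (1 : Γ)) (condν η) 0) ∧
        (ExactDim (qbb (1 : Γ) (1 : Γ)) ν (hπρ / l) ∧
          HasDim (qbb (1 : Γ) (1 : Γ)) ν (hπρ / l)) := by
  intro ρ hρ hπρ hhπ P ν νs condν hP hν hd
  obtain ⟨bnd, meas, rfl, hb⟩ := hν
  have m1 := pRho_marg1 hp hρ
  have m2 := pRho_marg2 hp hρ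
  have hlpos : 0 < l := drift_pos hΓ (rw_fst hP m1) hp hμne hmom hl
  have S : Setting p (pRho p ρ) P bnd l hμ hπρ :=
    ⟨hΓ, hP, m1, m2, hmom, hl, hhμ, hhπ, hlpos, meas, hb⟩
  refine ⟨fun hρ0 => ⟨?_, S.cond hd⟩, ?_, S.uncond⟩
  · have := ent_gap S hp hμne hρ0 hρ.2 fun a b => le_self_add
    exact div_pos (by linarith) hlpos
  · rintro rfl
    have he : hπρ = hμ := by
      refine tendsto_nhds_unique hhπ ?_
      simp only [pRho_zero_ent]
      exact hhμ
    refine ⟨he, ?_⟩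
    filter_upwards [S.cond hd] with η hη
    have := hη.2
    rwa [he, sub_self, zero_div] at this

end HMDim
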